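/- There exist a polynomial p ∈ ℝ[X] such that w(x,y) := p(x² + y²) > 0 for all (x,y) in the closed unit disk Ω̄, and a function u : ℝ² → ℝ that is real analytic on an open neighborhood of Ω̄, such that: −Δu = w·u³ on Ω; u = 0 on ∂Ω; the Morse index of u equals 2; and |u| is not invariant under any nontrivial rotation, i.e. for every α ∈ ℝ with e^{iα} ≠ 1 there exists (x,y) ∈ Ω with |u(R_α(x,y))| ≠ |u(x,y)|. -/

import Mathlib

open MeasureTheory

/-- The open unit disk in `ℝ²`. -/
def unitDisk : Set (ℝ × ℝ) := {p | p.1 ^ 2 + p.2 ^ 2 < 1}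

/-- The Laplacean `Δu = ∂²u/∂x² + ∂²u/∂y²`. -/
noncomputable def lap (u : ℝ × ℝ → ℝ) (p : ℝ × ℝ) : ℝ :=
  deriv (fun x => deriv (fun x' => u (x', p.2)) x) p.1 +
  deriv (fun y => deriv (fun y' => u (p.1, y')) y) p.2

/-- Rotation of the plane by angle `α` about the origin. -/
noncomputable def rot (α : ℝ) (p : ℝ × ℝ) : ℝ × ℝ :=
  (p.1 * Real.cos α - p.2 * Real.sin α, p.1 * Real.sin α + p.2 * Real.cos α)

/-- `|∇v|²`. -/
noncomputable def gradSq (v : ℝ × ℝ → ℝ) (p : ℝ × ℝ) : ℝ :=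
  (deriv (fun x => v (x, p.2)) p.1) ^ 2 + (deriv (fun y => v (p.1, y)) p.2) ^ 2

/-- The quadratic form `v ↦ ∫_Ω (|∇v|² − 3 w u² v²)`, i.e. `D²J(u)(v,v)`. -/
noncomputable def qform (w u v : ℝ × ℝ → ℝ) : ℝ :=
  ∫ p in unitDisk, (gradSq v p - 3 * w p * (u p) ^ 2 * (v p) ^ 2)

/-- A subspace of `C_c^∞(Ω)` on which the second variation of `J` at `u` is
negative definite. -/
def NegDefSubspace (w u : ℝ × ℝ → ℝ) (V : Submodule ℝ (ℝ × ℝ → ℝ)) : Prop :=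
  (∀ v ∈ V, ContDiff ℝ (⊤ : ℕ∞) v ∧ HasCompactSupport v ∧ tsupport v ⊆ unitDisk) ∧
  (∀ v ∈ V, v ≠ 0 → qform w u v < 0)

/-- The Morse index of `u` (the supremum of the dimensions of subspaces of
`C_c^∞(Ω)` on which the second variation is negative definite) equals `k`. -/
def MorseIndexEq (w u : ℝ × ℝ → ℝ) (k : ℕ) : Prop :=
  (∃ V : Submodule ℝ (ℝ × ℝ → ℝ), NegDefSubspace w u V ∧ Module.rank ℝ V = k) ∧
  (∀ V : Submodule ℝ (ℝ × ℝ → ℝ), NegDefSubspace w u V → Module.rank ℝ V ≤ k)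

/-! ### Integer polynomials in Horner form -/

namespace IntPoly

/-- Evaluation of the polynomial with the given list of coefficients. -/
def ev : List ℤ → ℝ → ℝ
  | [], _ => 0
  | c :: t, x => c + x * ev t x

def add : List ℤ → List ℤ → List ℤ
  | [], q => q
  | p, [] => p
  | c :: p, d :: q => (c + d) :: add p q

def smul (c : ℤ) : List ℤ → List ℤ
  | [] => []
  | d :: p => (c * d) :: smul c p

def mul : List ℤ → List ℤ → List ℤ
  | [], _ => []
  | c :: p, q => add (smul c q) (0 :: mul p q)

def der : List ℤ → List ℤ
  | [] => []
  | _ :: p => add p (0 :: der p)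

/-- The coefficients of `r + (a + h x) q`. -/
def lin (a h : ℤ) : ℤ → List ℤ → List ℤ
  | r, [] => [r]
  | r, d :: q => (r + a * d) :: lin a h (h * d) q

/-- `N ^ l.length` times the polynomial `l` at `(a + h x) / N`. -/
def comp (a h : ℤ) (N : ℕ) : List ℤ → List ℤ
  | [] => []
  | c :: p => lin a h (c * ((N ^ (p.length + 1) : ℕ) : ℤ)) (comp a h N p)

/-- A lower bound on `[0, 1]`. -/
def lower : List ℤ → ℤ
  | [] => 0
  | c :: p => c - ((-lower p).toNat : ℤ)

/-- The value of `comp a h N l` at an integer `x` with `y = a + h x`. -/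
def compAt (y : ℤ) (N : ℕ) : List ℤ → ℤ
  | [] => 0
  | c :: p => c * ((N ^ (p.length + 1) : ℕ) : ℤ) + y * compAt y N p

/-- The number with all digits `H` in base `B`. -/
def offset (B H : ℕ) : ℕ → ℕ
  | 0 => 0
  | n + 1 => H + B * offset B H n

/-- `lower`, computed from the value of the polynomial at `B`, with digits shifted by `H`. -/
def lowerDigits (B H : ℕ) : ℕ → ℕ → ℤ
  | 0, _ => 0
  | n + 1, M => ((M % B : ℕ) : ℤ) - (H : ℤ) - ((-lowerDigits B H n (M / B)).toNat : ℤ)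

def normOne : List ℤ → ℕ
  | [] => 0
  | c :: p => c.natAbs + normOne p

@[irreducible] def halfBase : ℕ := 2 ^ 519

/-- The base in which polynomials are packed. -/
@[irreducible] def base : ℕ := 2 * halfBase

/-- Positivity on the consecutive intervals with the given endpoints in units of `1 / 1024`. -/
def checkFrom (l : List ℤ) (n off : ℕ) : List ℤ → Bool
  | [] => true
  | [_] => true
  | a :: b :: r => decide (0 ≤ a) && decide (a < b) && decide (b ≤ 1024) &&
      decide (0 < lowerDigits base halfBase n
        (compAt (a + (b - a) * (base : ℤ)) 1024 l + (off : ℤ)).toNat) && checkFrom l n off (b :: r)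

def check (l r : List ℤ) : Bool :=
  decide (normOne l * 1024 ^ l.length < halfBase) &&
    checkFrom l l.length (offset base halfBase l.length) r

def checkQuad (A B C r : List ℤ) : Bool :=
  check (add A B) r && check (add A (smul (-1) B)) r &&
  check (add (add A B) C) r && check (add (add A (smul (-1) B)) C) r

@[simp] theorem ev_nil (x : ℝ) : ev [] x = 0 := rfl

@[simp] theorem ev_cons (c : ℤ) (p : List ℤ) (x : ℝ) : ev (c :: p) x = c + x * ev p x := rfl

@[simp] theorem ev_add (p q : List ℤ) (x : ℝ) : ev (add p q) x = ev p x + ev q x := by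
  induction p generalizing q with
  | nil => simp [add]
  | cons c p ih =>
    cases q with
    | nil => simp [add]
    | cons d q => simp [add, ih]; ring

@[simp] theorem ev_smul (c : ℤ) (p : List ℤ) (x : ℝ) : ev (smul c p) x = c * ev p x := by
  induction p with
  | nil => simp [smul]
  | cons d p ih => simp [smul, ih]; ring

@[simp] theorem ev_mul (p q : List ℤ) (x : ℝ) : ev (mul p q) x = ev p x * ev q x := by
  induction p with
  | nil => simp [mul]
  | cons d p ih => simp [mul, ih]; ring

theorem ev_lin (a h r : ℤ) (q : List ℤ) (x : ℝ) :
    ev (lin a h r q) x = r + (a + h * x) * ev q x := by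
  induction q generalizing r with
  | nil => simp [lin]
  | cons d q ih => simp [lin, ih]; ring

theorem ev_comp (a h : ℤ) (N : ℕ) (hN : N ≠ 0) (p : List ℤ) (x : ℝ) :
    ev (comp a h N p) x = (N : ℝ) ^ p.length * ev p ((a + h * x) / N) := by
  have hN' : (N : ℝ) ≠ 0 := by exact_mod_cast hN
  induction p with
  | nil => simp [comp]
  | cons c p ih => simp [comp, ev_lin, ih]; field_simp; ring

theorem length_lin (a h r : ℤ) (q : List ℤ) : (lin a h r q).length = q.length + 1 := by
  induction q generalizing r with
  | nil => rfl
  | cons d q ih => simp [lin, ih]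

theorem length_comp (a h : ℤ) (N : ℕ) (p : List ℤ) : (comp a h N p).length = p.length := by
  induction p with
  | nil => rfl
  | cons c p ih => simp [comp, length_lin, ih]

/-- Evaluation at an integer. -/
def evInt : List ℤ → ℤ → ℤ
  | [], _ => 0
  | c :: t, x => c + x * evInt t x

theorem evInt_lin (a h r : ℤ) (q : List ℤ) (x : ℤ) :
    evInt (lin a h r q) x = r + (a + h * x) * evInt q x := by
  induction q generalizing r with
  | nil => simp [lin, evInt]
  | cons d q ih => simp [lin, evInt, ih]; ring

theorem evInt_comp (a h : ℤ) (N : ℕ) (p : List ℤ) (x : ℤ) :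
    evInt (comp a h N p) x = compAt (a + h * x) N p := by
  induction p with
  | nil => rfl
  | cons c p ih => rw [comp, evInt_lin, ih, compAt]

theorem abs_le_of_mem_lin {a h D E : ℤ} (ha : 0 ≤ a) (hh : 0 ≤ h) (hE : 0 ≤ E) (hD : 0 ≤ D) :
    ∀ (q : List ℤ) (r : ℤ), |r| ≤ E + h * D → (∀ d ∈ q, |d| ≤ D) →
      ∀ c ∈ lin a h r q, |c| ≤ E + (a + h) * D
  | [], r, hr, _, c, hc => by
    have : c = r := by simpa [lin] using hc
    subst this
    nlinarith [mul_nonneg ha hD]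
  | d :: q, r, hr, hq, c, hc => by
    have hd := hq d (by simp)
    rcases List.mem_cons.1 hc with rfl | hc
    · calc |r + a * d| ≤ |r| + a * |d| := by
            simpa [abs_mul, abs_of_nonneg ha] using abs_add_le r (a * d)
        _ ≤ _ := by nlinarith [mul_le_mul_of_nonneg_left hd ha]
    · refine abs_le_of_mem_lin ha hh hE hD q (h * d) ?_ (fun e he => hq e (by simp [he])) c hc
      rw [abs_mul, abs_of_nonneg hh]
      nlinarith [mul_le_mul_of_nonneg_left hd hh]

theorem abs_le_of_mem_comp {a h : ℤ} {N : ℕ} (ha : 0 ≤ a) (hh : 0 ≤ h) (hN : a + h ≤ N)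
    (p : List ℤ) : ∀ c ∈ comp a h N p, |c| ≤ (normOne p : ℤ) * (N : ℤ) ^ p.length := by
  induction p with
  | nil => simp [comp]
  | cons d p ih =>
    intro c hc
    have hD : (0 : ℤ) ≤ (normOne p : ℤ) * (N : ℤ) ^ p.length := by positivity
    have := abs_le_of_mem_lin (E := |d| * (N : ℤ) ^ (p.length + 1)) ha hh (by positivity) hD
      (comp a h N p) _ ?_ ih c hc
    · refine this.trans ?_
      simp only [normOne, List.length_cons, Nat.cast_add, Int.natCast_natAbs, pow_succ]
      nlinarith [mul_le_mul_of_nonneg_right hN hD]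
    · rw [abs_mul]
      push_cast
      rw [abs_of_nonneg (by positivity : (0 : ℤ) ≤ (N : ℤ) ^ (p.length + 1))]
      nlinarith [mul_nonneg hh hD]

theorem lowerDigits_eq {B H : ℕ} (hB : B = 2 * H) (q : List ℤ) (hq : ∀ c ∈ q, |c| < H) :
    ∀ M : ℕ, (M : ℤ) = evInt q B + offset B H q.length → lowerDigits B H q.length M = lower q := by
  have key : ∀ q : List ℤ, (∀ c ∈ q, |c| < (H : ℤ)) →
      0 ≤ evInt q B + (offset B H q.length : ℤ) := by
    intro q
    induction q with
    | nil => simp [evInt, offset]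
    | cons c q ih =>
      intro h
      have h1 := ih fun d hd => h d (by simp [hd])
      have h2 := abs_lt.1 (h c (by simp))
      simp only [evInt, offset, List.length_cons]
      push_cast
      nlinarith [mul_nonneg (Int.natCast_nonneg B) h1]
  induction q with
  | nil => intros; rfl
  | cons c q ih =>
    intro M hM
    have hq' : ∀ d ∈ q, |d| < (H : ℤ) := fun d hd => hq d (by simp [hd])
    have h1 := key q hq'
    obtain ⟨M', hM'⟩ := Int.eq_ofNat_of_zero_le h1
    obtain ⟨h2, h3⟩ := abs_lt.1 (hq c (by simp))
    obtain ⟨d, hd⟩ := Int.eq_ofNat_of_zero_le (by linarith : 0 ≤ c + (H : ℤ))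
    have hdB : d < B := by
      have : (d : ℤ) < B := by rw [← hd, hB]; push_cast; linarith
      exact_mod_cast this
    have hMe : M = d + B * M' := by
      have : (M : ℤ) = d + B * M' := by
        rw [hM, ← hM', ← hd]
        simp only [evInt, offset, List.length_cons]
        push_cast
        ring
      exact_mod_cast this
    have e1 : M % B = d := by rw [hMe, Nat.add_mul_mod_self_left, Nat.mod_eq_of_lt hdB]
    have e2 : M / B = M' := by
      rw [hMe, Nat.add_mul_div_left _ _ (by omega), Nat.div_eq_of_lt hdB, zero_add]
    simp only [List.length_cons, lowerDigits, lower]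
    rw [e1, e2, ih hq' M' hM'.symm, ← hd]
    ring

theorem lower_comp_pos {l : List ℤ} {a b : ℤ} (hl : normOne l * 1024 ^ l.length < halfBase)
    (ha : 0 ≤ a) (hab : a < b) (hb : b ≤ 1024)
    (h : 0 < lowerDigits base halfBase l.length
        (compAt (a + (b - a) * (base : ℤ)) 1024 l
          + (offset base halfBase l.length : ℤ)).toNat) :
    0 < lower (comp a (b - a) 1024 l) := by
  have hB : base = 2 * halfBase := by rw [base]
  have hc : ∀ c ∈ comp a (b - a) 1024 l, |c| < (halfBase : ℤ) := fun c hc =>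
    (abs_le_of_mem_comp ha (by linarith) (by push_cast; linarith) l c hc).trans_lt
      (by exact_mod_cast hl)
  rw [← evInt_comp] at h
  have hn : 0 ≤ evInt (comp a (b - a) 1024 l) base + (offset base halfBase l.length : ℤ) := by
    by_contra hneg
    rw [Int.toNat_of_nonpos (le_of_not_ge hneg)] at h
    have : ∀ n, lowerDigits base halfBase n 0 ≤ 0 := by
      intro n
      induction n with
      | zero => exact le_rfl
      | succ n _ => simp only [lowerDigits, Nat.zero_mod]; push_cast; omega
    exact absurd h (this _).not_gt
  rwa [← length_comp a (b - a) 1024 l, lowerDigits_eq hB _ hc _ ?_] at h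
  rw [length_comp, Int.toNat_of_nonneg hn]

theorem hasDerivAt_ev (p : List ℤ) (x : ℝ) : HasDerivAt (ev p) (ev (der p) x) x := by
  induction p with
  | nil => simpa [ev, der] using hasDerivAt_const x (0 : ℝ)
  | cons c p ih =>
    have := ((hasDerivAt_id x).mul ih).const_add (c : ℝ)
    refine this.congr_deriv ?_
    simp [der]

theorem lower_le (p : List ℤ) {x : ℝ} (h0 : 0 ≤ x) (h1 : x ≤ 1) : (lower p : ℝ) ≤ ev p x := by
  induction p with
  | nil => simp [lower]
  | cons c p ih =>
    have e : (((-lower p).toNat : ℤ) : ℝ) = max (-(lower p : ℝ)) 0 := by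
      rw [Int.toNat_eq_max]; push_cast; rfl
    simp only [lower, ev_cons, Int.cast_sub, e]
    rcases le_total 0 (ev p x) with h | h
    · nlinarith [le_max_right (-(lower p : ℝ)) 0, mul_nonneg h0 h]
    · nlinarith [le_max_left (-(lower p : ℝ)) 0]

theorem ev_pos_of_interval {l : List ℤ} {a b : ℤ} (hab : a < b)
    (hl : 0 < lower (comp a (b - a) 1024 l)) {x : ℝ} (hax : (a : ℝ) ≤ 1024 * x)
    (hx : 1024 * x ≤ b) : 0 < ev l x := by
  have hab' : (0 : ℝ) < b - a := by
    have : (a : ℝ) < b := by exact_mod_cast hab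
    linarith
  have hlow := lower_le (comp a (b - a) 1024 l) (x := (1024 * x - a) / (b - a))
    (by apply div_nonneg <;> linarith) (by rw [div_le_one hab']; linarith)
  rw [ev_comp _ _ _ (by norm_num)] at hlow
  have he : ((a : ℝ) + ((b - a : ℤ) : ℝ) * ((1024 * x - a) / (b - a))) / ((1024 : ℕ) : ℝ) = x := by
    push_cast; field_simp; ring
  rw [he] at hlow
  have hl' : (0 : ℝ) < (lower (comp a (b - a) 1024 l) : ℝ) := by exact_mod_cast hl
  have : (0 : ℝ) < ((1024 : ℕ) : ℝ) ^ l.length := by positivity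
  exact pos_of_mul_pos_right (hl'.trans_le hlow) this.le

theorem ev_pos_of_checkFrom {l : List ℤ} (hl : normOne l * 1024 ^ l.length < halfBase) :
    ∀ (r : List ℤ) (a : ℤ),
      checkFrom l l.length (offset base halfBase l.length) (a :: r) = true → r ≠ [] →
    ∀ x : ℝ, (a : ℝ) ≤ 1024 * x → 1024 * x ≤ (((a :: r).getLast (by simp) : ℤ) : ℝ) → 0 < ev l x
  | [], _, _, h, _, _, _ => absurd rfl h
  | b :: r, a, hc, _, x, hax, hx => by
    simp only [checkFrom, Bool.and_eq_true, decide_eq_true_eq] at hc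
    obtain ⟨⟨⟨⟨ha, hab⟩, hb⟩, hlow⟩, hr⟩ := hc
    have hlow := lower_comp_pos hl ha hab hb hlow
    rcases le_total (1024 * x) (b : ℝ) with h | h
    · exact ev_pos_of_interval hab hlow hax h
    · cases r with
      | nil => exact ev_pos_of_interval hab hlow hax (by simpa using hx)
      | cons c r => exact ev_pos_of_checkFrom hl (c :: r) b hr (by simp) x h (by simpa using hx)

theorem ev_pos_of_check (l r : List ℤ) (a : ℤ) (h : check l (a :: r) = true) (hr : r ≠ []) (x : ℝ)
    (hax : (a : ℝ) ≤ 1024 * x) (hx : 1024 * x ≤ (((a :: r).getLast (by simp) : ℤ) : ℝ)) :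
    0 < ev l x := by
  simp only [check, Bool.and_eq_true, decide_eq_true_eq] at h
  exact ev_pos_of_checkFrom h.1 r a h.2 hr x hax hx

theorem quad_pos_of_check {A B C r : List ℤ} {a : ℤ} (h : checkQuad A B C (a :: r) = true)
    (hr : r ≠ []) {x : ℝ} (h0 : (a : ℝ) ≤ 1024 * x)
    (h1 : 1024 * x ≤ (((a :: r).getLast (by simp) : ℤ) : ℝ)) {δ : ℝ} (hδ : |δ| ≤ 1) :
    0 < ev A x + δ * ev B x + δ ^ 2 * ev C x := by
  simp only [checkQuad, Bool.and_eq_true] at h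
  obtain ⟨⟨⟨ha, hb⟩, hc⟩, hd⟩ := h
  have ha := ev_pos_of_check _ _ _ ha hr x h0 h1
  have hb := ev_pos_of_check _ _ _ hb hr x h0 h1
  have hc := ev_pos_of_check _ _ _ hc hr x h0 h1
  have hd := ev_pos_of_check _ _ _ hd hr x h0 h1
  simp only [ev_add, ev_smul, Int.cast_neg, Int.cast_one] at ha hb hc hd
  obtain ⟨hl, hu⟩ := abs_le.1 hδ
  have e1 : 0 < ev A x + δ * ev B x := by
    rcases le_total 0 (ev B x) with h | h <;> nlinarith
  have e2 : 0 < ev A x + δ * ev B x + ev C x := by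
    rcases le_total 0 (ev B x) with h | h <;> nlinarith
  have e3 : δ ^ 2 ≤ 1 := by nlinarith
  rcases le_total 0 (ev C x) with h | h
  · nlinarith [sq_nonneg δ]
  · nlinarith [sq_nonneg δ]

end IntPoly

/-- `600 η` at the centre of the parameter interval, as a polynomial in `s`. -/
def etaZero : List ℤ :=
  [-3715, 37000, -184245, 491520, -689340, 476340, -127860]

/-- The linear coefficient in `δ` of `600 η`. -/
def etaOne : List ℤ :=
  [12, -36, 36, -12]

/-- The constant coefficient in `δ` of `360000 R`. -/
def remZero : List ℤ :=
  [2589000, -57121225, 530021550, -2981216025, 13270722000, -48050836200, 126988620600,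
  -229777889400, 276092560800, -208603029600, 89113305600, -16348179600]

/-- The linear coefficient in `δ` of `360000 R`. -/
def remOne : List ℤ :=
  [-7200, 132360, -977160, 5309880, -16218360, 28340640, -27976320, 14500800, -3068640]

/-- The quadratic coefficient in `δ` of `360000 R`. -/
def remTwo : List ℤ :=
  [0, -144, 576, -864, 576, -144]

/-- A strict supersolution for angular mode one at `δ = -1`. -/
def superOne : List ℤ :=
  [999959540, -10829539414, 125673637538, -1132643103798, 8678619688488, -57460506197617,
  321785949089495, -1495688430983588, 5706466041712897, -17747974538735162, 44780388675967312,
  -91287964873459776, 149667605025692512, -196080960532392384, 203292898021560224,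
  -164346582392770720, 101270807447343024, -45893476579774376, 14405840623778388,
  -2795973979973412, 252628229137684]

/-- `1 - s` times this polynomial is a subsolution for angular mode one at `δ = 1`. -/
def subOneQuot : List ℤ :=
  [999983892, -9715968455, 114228089429, -996033340750, 7428615791269, -47632459640871,
  256111627679778, -1133910552163697, 4091822644370384, -11948361953460276, 28064209630284192,
  -52713374266333760, 78626626394406832, -92223389884040800, 83826610539624192,
  -57737009978989240, 29084491054643540, -10095442996161990, 2156100892632540,
  -213387927910691]

/-- A strict radial supersolution on `[0, 97/1024]`. -/
def superInner : List ℤ :=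
  [999974452, -21694311129, 244407011778, -2262106489821, 15277504792342, -65319183865310,
  128805498678588]

/-- A strict radial supersolution on `[97/1024, 1]`. -/
def superOuter : List ℤ :=
  [-357685665, 8296796048, -79109888511, 557206461605, -2744759541181, 9525237525734,
  -23643152110847, 42213579758132, -53631500111150, 46870403587152, -26086206810298,
  7370351801915, 277244892297, -794908036583, 157674367543]

/-- A strict supersolution for the mode-one operator with potential `(4 - M) V`. -/
def superQuartic : List ℤ :=
  [999959449, -14433801236, 184495167990, -1838266424980, 15299201713248, -107137071251452,
  620538563226203, -2932485235864762, 11228488196712838, -34724366609918728, 86581191021670128,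
  -173747055414238400, 279769588218131616, -359523558432022464, 365411666979824768,
  -289563529705471616, 174941786337597248, -77767795006964208, 23961949825063644,
  -4568825809817746, 405912147112019]

/-- The constant coefficient in `δ` of the flux polynomial. -/
def fluxZero : List ℤ :=
  [0, 28342782, -49250885, 89223150, 4452933021, -39642248397, 257095395183, -1139043899894,
  3507834083246, -7531092867190, 11322212354361, -11624268567774, 7763709776861,
  -3030623121202, 522459320223]

/-- The linear coefficient in `δ` of the flux polynomial. -/
def fluxOne : List ℤ :=
  [0, 13978, 295036, -9910, -1917163, 32873826, -163753445, 547849782, -1194525426, 1569934430,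
  -1018056499, -69511714, 605584694, -393172952, 87015489]

section Reference

open IntPoly

/-- The logarithmic derivative in `s` of the factor `e ^ h`. -/
noncomputable def eta (δ s : ℝ) : ℝ := (ev etaZero s + δ * ev etaOne s) / 600

/-- The derivative of `eta` in `s`. -/
noncomputable def etaDer (δ s : ℝ) : ℝ := (ev (der etaZero) s + δ * ev (der etaOne) s) / 600

/-- The positive factor in the potential. -/
noncomputable def rem (δ s : ℝ) : ℝ :=
  (ev remZero s + δ * ev remOne s + δ ^ 2 * ev remTwo s) / 360000

/-- The potential `w U²` as a function of `s = r²`. -/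
noncomputable def pot (δ s : ℝ) : ℝ := 4 * (1 - s) ^ 2 * rem δ s

theorem hasDerivAt_eta (δ s : ℝ) : HasDerivAt (eta δ) (etaDer δ s) s :=
  (((hasDerivAt_ev etaZero s).add ((hasDerivAt_ev etaOne s).const_mul δ)).div_const 600)

theorem riccati_eta (δ s : ℝ) :
    -1 + (1 - 3 * s) * eta δ s + (1 - s) * s * (etaDer δ s + eta δ s ^ 2) =
      -(1 - s) ^ 3 * rem δ s := by
  simp only [eta, etaDer, rem, etaZero, etaOne, remZero, remOne, remTwo, der, add, ev_cons, ev_nil]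
  push_cast
  ring

theorem rem_pos {δ s : ℝ} (hδ : |δ| ≤ 1) (h0 : 0 ≤ s) (h1 : s ≤ 1) : 0 < rem δ s := by
  have h : checkQuad remZero remOne remTwo
      [0, 37, 74, 101, 128, 178, 299, 366, 393, 413, 925, 1024] = true := by decide +kernel
  have := quad_pos_of_check h (by simp) (x := s) (by simpa using h0) (by simp; linarith) hδ
  unfold rem
  positivity

def potZero : List ℤ := mul [4, -8, 4] remZero
def potOne : List ℤ := mul [4, -8, 4] remOne
def potTwo : List ℤ := mul [4, -8, 4] remTwo

theorem pot_eq (δ s : ℝ) :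
    pot δ s = (ev potZero s + δ * ev potOne s + δ ^ 2 * ev potTwo s) / 360000 := by
  simp only [pot, rem, potZero, potOne, potTwo, ev_mul, ev_cons, ev_nil]
  push_cast
  ring

/-- Ten times the operator `f ↦ -4 (s f'' + k f')`, with `k` in tenths. -/
def radOp (k : ℤ) (f : List ℤ) : List ℤ :=
  add (smul (-40) (0 :: der (der f))) (smul (-4 * k) (der f))

@[simp] theorem ev_radOp (k : ℤ) (f : List ℤ) (x : ℝ) :
    ev (radOp k f) x = -40 * (x * ev (der (der f)) x) - 4 * k * ev (der f) x := by
  simp [radOp]; ring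

theorem superOne_pos {s : ℝ} (h0 : 0 ≤ s) (h1 : s ≤ 1) : 0 < ev superOne s :=
  ev_pos_of_check _ [90, 252, 540, 812, 971, 1010, 1024] 0 (by decide +kernel) (by simp) s
    (by simpa using h0) (by simp; linarith)

theorem superOne_deriv_neg {s : ℝ} (h0 : 0 ≤ s) (h1 : s ≤ 1) : ev (der superOne) s < 0 := by
  have := ev_pos_of_check (smul (-1) (der superOne)) [37, 87, 137, 204, 325, 541, 903, 1024] 0
    (by decide +kernel) (by simp) s (by simpa using h0) (by simp; linarith)
  simpa using this

theorem superOne_strict {s : ℝ} (h0 : 0 ≤ s) (h1 : s ≤ 1) :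
    3 * pot (-1) s * ev superOne s <
      -4 * (s * ev (der (der superOne)) s + 2 * ev (der superOne) s) := by
  have := ev_pos_of_check (add (smul 360000 (radOp 20 superOne))
    (smul (-30) (mul (add (add potZero (smul (-1) potOne)) potTwo) superOne)))
    [11, 31, 58, 95, 132, 182, 249, 316, 406, 496, 617, 745, 832, 913, 975, 1011, 1024] 0
    (by decide +kernel) (by simp) s (by simpa using h0) (by simp; linarith)
  simp only [ev_add, ev_smul, ev_mul, ev_radOp] at this
  push_cast at this
  rw [pot_eq]
  linarith

/-- The integer form of the strict supersolution inequality. -/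
theorem strict_of_check {f r : List ℤ} {k a : ℤ}
    (h : checkQuad (add (smul 360000 (radOp k f)) (smul (-10) (mul (add (smul 3 potZero) [360]) f)))
      (smul (-30) (mul potOne f)) (smul (-30) (mul potTwo f)) (a :: r) = true)
    (hr : r ≠ []) {s : ℝ} (h0 : (a : ℝ) ≤ 1024 * s)
    (h1 : 1024 * s ≤ (((a :: r).getLast (by simp) : ℤ) : ℝ)) {δ : ℝ} (hδ : |δ| ≤ 1) :
    (3 * pot δ s + 1 / 1000) * ev f s <
      -4 * (s * ev (der (der f)) s + k / 10 * ev (der f) s) := by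
  have := quad_pos_of_check h hr h0 h1 hδ
  simp only [ev_add, ev_smul, ev_mul, ev_radOp, ev_cons, ev_nil] at this
  push_cast at this
  rw [pot_eq]
  linarith

theorem superOne_strict_mode {δ s : ℝ} (hδ : |δ| ≤ 1) (h0 : 0 ≤ s) (h1 : s ≤ 1) :
    (3 * pot δ s + 1 / 1000) * ev superOne s <
      -4 * (s * ev (der (der superOne)) s + 12 / 5 * ev (der superOne) s) := by
  have := strict_of_check (f := superOne) (k := 24) (a := 0)
    (r := [37, 74, 124, 174, 264, 385, 547, 747, 954, 1024]) (by decide +kernel) (by simp)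
    (s := s) (by simpa using h0) (by simp; linarith) hδ
  norm_num at this ⊢
  linarith

theorem subOneQuot_pos {s : ℝ} (h0 : 0 ≤ s) (h1 : s ≤ 1) : 0 < ev subOneQuot s :=
  ev_pos_of_check _ [90, 252, 540, 903, 1024] 0 (by decide +kernel) (by simp) s
    (by simpa using h0) (by simp; linarith)

/-- A subsolution for angular mode one at `δ = 1` which vanishes at `s = 1`. -/
def subOne : List ℤ := mul [1, -1] subOneQuot

theorem subOne_strict {s : ℝ} (h0 : 0 ≤ s) (h1 : s ≤ 1) :
    -4 * (s * ev (der (der subOne)) s + 2 * ev (der subOne) s) < 3 * pot 1 s * ev subOne s := by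
  have := ev_pos_of_check (smul (-1) (add (smul 360000 (radOp 20 subOne))
    (smul (-30) (mul (add (add potZero potOne) potTwo) subOne))))
    [15, 42, 69, 96, 133, 183, 250, 340, 407, 528, 684, 827, 909, 973, 1011, 1024] 0
    (by decide +kernel) (by simp) s (by simpa using h0) (by simp; linarith)
  simp only [ev_add, ev_smul, ev_mul, ev_radOp] at this
  push_cast at this
  rw [pot_eq]
  linarith

theorem superInner_pos {s : ℝ} (h0 : 0 ≤ s) (h1 : s ≤ 97 / 1024) : 0 < ev superInner s :=
  ev_pos_of_check _ [40, 82, 97] 0 (by decide +kernel) (by simp) s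
    (by simpa using h0) (by simp; linarith)

theorem superInner_strict {δ s : ℝ} (hδ : |δ| ≤ 1) (h0 : 0 ≤ s) (h1 : s ≤ 97 / 1024) :
    (3 * pot δ s + 1 / 1000) * ev superInner s <
      -4 * (s * ev (der (der superInner)) s + ev (der superInner) s) := by
  have := strict_of_check (f := superInner) (k := 10) (a := 0)
    (r := [9, 24, 46, 74, 97]) (by decide +kernel) (by simp)
    (s := s) (by simpa using h0) (by simp; linarith) hδ
  norm_num at this ⊢
  linarith

theorem superOuter_pos {s : ℝ} (h0 : 97 / 1024 ≤ s) (h1 : s ≤ 1) : 0 < ev superOuter s :=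
  ev_pos_of_check _ [259, 547, 814, 971, 1010, 1024] 97 (by decide +kernel) (by simp) s
    (by push_cast; linarith) (by simp; linarith)

theorem superOuter_strict {δ s : ℝ} (hδ : |δ| ≤ 1) (h0 : 97 / 1024 ≤ s) (h1 : s ≤ 1) :
    (3 * pot δ s + 1 / 1000) * ev superOuter s <
      -4 * (s * ev (der (der superOuter)) s + ev (der superOuter) s) := by
  have := strict_of_check (f := superOuter) (k := 10) (a := 97)
    (r := [117, 144, 181, 248, 298, 388, 478, 568, 676, 757, 869, 956, 1007, 1024])
    (by decide +kernel) (by simp) (s := s) (by push_cast; linarith) (by simp; linarith) hδ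
  norm_num at this ⊢
  linarith

theorem superQuartic_pos {s : ℝ} (h0 : 0 ≤ s) (h1 : s ≤ 1) : 0 < ev superQuartic s :=
  ev_pos_of_check _ [67, 188, 404, 788, 965, 1009, 1024] 0 (by decide +kernel) (by simp) s
    (by simpa using h0) (by simp; linarith)

theorem superQuartic_strict {δ s : ℝ} (hδ : |δ| ≤ 1) (h0 : 0 ≤ s) (h1 : s ≤ 1) :
    (4 - 119 / 50 * s ^ 2) * pot δ s * ev superQuartic s <
      -4 * (s * ev (der (der superQuartic)) s + 2 * ev (der superQuartic) s) := by
  have h : checkQuad (add (smul 1800000 (radOp 20 superQuartic))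
      (smul (-1) (mul (mul [200, 0, -119] potZero) superQuartic)))
      (smul (-1) (mul (mul [200, 0, -119] potOne) superQuartic))
      (smul (-1) (mul (mul [200, 0, -119] potTwo) superQuartic))
      [0, 11, 26, 41, 61, 81, 96, 107, 118, 155, 192, 219, 286, 323, 350, 387, 454, 504, 594,
        669, 752, 837, 895, 949, 991, 1024] = true := by decide +kernel
  have := quad_pos_of_check h (by simp) (x := s) (by simpa using h0) (by simp; linarith) hδ
  simp only [ev_add, ev_smul, ev_mul, ev_radOp, ev_cons, ev_nil] at this
  push_cast at this
  rw [pot_eq]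
  generalize ev superQuartic s = f at *
  generalize ev (der superQuartic) s = f1 at *
  generalize ev (der (der superQuartic)) s = f2 at *
  generalize ev potZero s = p0 at *
  generalize ev potOne s = p1 at *
  generalize ev potTwo s = p2 at *
  have e : 1800000 * (-4 * (s * f2 + 2 * f1) -
      (4 - 119 / 50 * s ^ 2) * ((p0 + δ * p1 + δ ^ 2 * p2) / 360000) * f) * 10 =
      1800000 * (-40 * (s * f2) - 4 * 20 * f1) - (200 - 119 * s ^ 2) * p0 * f -
      δ * ((200 - 119 * s ^ 2) * p1 * f) - δ ^ 2 * ((200 - 119 * s ^ 2) * p2 * f) := by ring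
  nlinarith [this, e]

/-- The flux polynomial. -/
noncomputable def flux (δ s : ℝ) : ℝ := (ev fluxZero s + δ * ev fluxOne s) / 1000000

noncomputable def fluxDer (δ s : ℝ) : ℝ :=
  (ev (der fluxZero) s + δ * ev (der fluxOne) s) / 1000000

theorem hasDerivAt_flux (δ s : ℝ) : HasDerivAt (flux δ) (fluxDer δ s) s :=
  (((hasDerivAt_ev fluxZero s).add ((hasDerivAt_ev fluxOne s).const_mul δ)).div_const 1000000)

theorem flux_zero (δ : ℝ) : flux δ 0 = 0 := by simp [flux, fluxZero, fluxOne]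

theorem flux_ineq {δ s : ℝ} (hδ : |δ| ≤ 1) (h0 : 0 ≤ s) (h1 : s ≤ 1) :
    0 < 4 * rem δ s * (1 - 6 * (119 / 50 * s ^ 2) ^ 2) + 5 * flux δ s - (1 - s) * fluxDer δ s -
      2 * (1 - s) * flux δ s * eta δ s := by
  have h : checkQuad
      (add (add (smul 4000000 (mul remZero [2500, 0, 0, 0, -84966]))
        (add (smul 4500000000 fluxZero) (smul (-900000000) (mul [1, -1] (der fluxZero)))))
        (smul (-3000000) (mul (mul [1, -1] etaZero) fluxZero)))
      (add (add (add (smul 4000000 (mul remOne [2500, 0, 0, 0, -84966]))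
        (add (smul 4500000000 fluxOne) (smul (-900000000) (mul [1, -1] (der fluxOne)))))
        (smul (-3000000) (mul (mul [1, -1] etaZero) fluxOne)))
        (smul (-3000000) (mul (mul [1, -1] etaOne) fluxZero)))
      (add (smul 4000000 (mul remTwo [2500, 0, 0, 0, -84966]))
        (smul (-3000000) (mul (mul [1, -1] etaOne) fluxOne)))
      [0, 20, 57, 124, 245, 366, 528, 684, 827, 937, 1024] = true := by decide +kernel
  have := quad_pos_of_check h (by simp) (x := s) (by simpa using h0) (by simp; linarith) hδ
  simp only [ev_add, ev_smul, ev_mul, ev_cons, ev_nil] at this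
  push_cast at this
  simp only [rem, flux, fluxDer, eta]
  linarith

def hZero : List ℤ :=
  [0, -1560300, 7770000, -25794300, 51609600, -57904560, 33343800, -7671600]

def hOne : List ℤ := [0, 5040, -7560, 5040, -1260]

/-- The antiderivative of `eta` vanishing at `0`. -/
noncomputable def logFactor (δ s : ℝ) : ℝ := (ev hZero s + δ * ev hOne s) / 252000

theorem hasDerivAt_logFactor (δ s : ℝ) : HasDerivAt (logFactor δ) (eta δ s) s := by
  refine (((hasDerivAt_ev hZero s).add ((hasDerivAt_ev hOne s).const_mul δ)).div_const
    252000).congr_deriv ?_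
  simp only [eta, hZero, hOne, etaZero, etaOne, der, add, ev_cons, ev_nil]
  push_cast
  ring

end Reference

/-! ### The Banach algebra of absolutely convergent double power series -/

/-- Absolutely summable real coefficients of power series in two commuting variables. -/
def Coef : Type := lp (fun _ : ℕ × ℕ => ℝ) 1

namespace Coef

noncomputable instance : NormedAddCommGroup Coef :=
  inferInstanceAs (NormedAddCommGroup (lp (fun _ : ℕ × ℕ => ℝ) 1))

noncomputable instance : NormedSpace ℝ Coef :=
  inferInstanceAs (NormedSpace ℝ (lp (fun _ : ℕ × ℕ => ℝ) 1))

instance : CompleteSpace Coef :=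
  inferInstanceAs (CompleteSpace (lp (fun _ : ℕ × ℕ => ℝ) 1))

/-- The monomial with exponents `i`. -/
noncomputable def mono (i : ℕ × ℕ) : Coef :=
  (lp.single 1 i (1 : ℝ) : lp (fun _ : ℕ × ℕ => ℝ) 1)

/-- The coefficient of `mono i`. -/
noncomputable def coeff (i : ℕ × ℕ) : Coef →L[ℝ] ℝ := lp.evalCLM ℝ (fun _ : ℕ × ℕ => ℝ) 1 i

theorem norm_mono (i : ℕ × ℕ) : ‖mono i‖ = 1 :=
  (lp.norm_single (E := fun _ : ℕ × ℕ => ℝ) (p := 1) (by norm_num) i (1 : ℝ)).trans norm_one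

theorem coeff_mono (i j : ℕ × ℕ) : coeff i (mono j) = if i = j then 1 else 0 := by
  have : coeff i (mono j) = (Pi.single j (1 : ℝ) : ℕ × ℕ → ℝ) i := rfl
  rw [this, Pi.single_apply]

theorem hasSum_mono (a : Coef) : HasSum (fun i => coeff i a • mono i) a := by
  have := lp.hasSum_single (E := fun _ : ℕ × ℕ => ℝ) (p := 1) (by norm_num) a
  have e : ∀ i, lp.single 1 i (coeff i a) = (coeff i a • mono i : Coef) := fun i => by
    have := lp.single_smul (E := fun _ : ℕ × ℕ => ℝ) (𝕜 := ℝ) 1 i (coeff i a) (1 : ℝ)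
    rw [smul_eq_mul, mul_one] at this
    exact this
  exact (funext e) ▸ this

theorem hasSum_norm (a : Coef) : HasSum (fun i => |coeff i a|) ‖a‖ := by
  have := lp.hasSum_norm (E := fun _ : ℕ × ℕ => ℝ) (p := 1) (by norm_num) a
  simp only [ENNReal.toReal_one, Real.rpow_one] at this
  exact this

variable {E F : Type*} [NormedAddCommGroup E] [NormedSpace ℝ E]
  [NormedAddCommGroup F] [NormedSpace ℝ F]

theorem ext_mono {f g : Coef →L[ℝ] E} (h : ∀ i, f (mono i) = g (mono i)) : f = g := by
  ext a
  have hf := (hasSum_mono a).mapL f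
  have hg := (hasSum_mono a).mapL g
  simp only [map_smul, h] at hf hg
  exact hf.unique hg

theorem ext_coeff {a b : Coef} (h : ∀ i, coeff i a = coeff i b) : a = b := by
  have ha := hasSum_mono a
  simp only [h] at ha
  exact ha.unique (hasSum_mono b)

theorem norm_le_of_mono {f : Coef →L[ℝ] E} {C : ℝ} (hC : 0 ≤ C) (h : ∀ i, ‖f (mono i)‖ ≤ C) :
    ‖f‖ ≤ C := by
  refine f.opNorm_le_bound hC fun a => ?_
  have hf := (hasSum_mono a).mapL f
  have hs : HasSum (fun i => C * |coeff i a|) (C * ‖a‖) := (hasSum_norm a).mul_left C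
  refine hf.norm_le_of_bounded hs fun i => ?_
  rw [map_smul, norm_smul, Real.norm_eq_abs, mul_comm]
  exact mul_le_mul_of_nonneg_right (h i) (abs_nonneg _)

section lift

variable [CompleteSpace E]

theorem summable_lift {x : ℕ × ℕ → E} {C : ℝ} (h : ∀ i, ‖x i‖ ≤ C) (a : Coef) :
    Summable fun i => coeff i a • x i := by
  refine Summable.of_norm_bounded (g := fun i => |coeff i a| * C)
    ((hasSum_norm a).summable.mul_right C) fun i => ?_
  rw [norm_smul, Real.norm_eq_abs]
  exact mul_le_mul_of_nonneg_left (h i) (abs_nonneg _)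

/-- The bounded linear map with prescribed bounded values on monomials. -/
noncomputable def lift (x : ℕ × ℕ → E) (C : ℝ) (h : ∀ i, ‖x i‖ ≤ C) : Coef →L[ℝ] E :=
  LinearMap.mkContinuous
    { toFun := fun a => ∑' i, coeff i a • x i
      map_add' := fun a b => by
        simp only [map_add, add_smul]
        exact (summable_lift h a).tsum_add (summable_lift h b)
      map_smul' := fun c a => by
        simp only [map_smul, smul_assoc, RingHom.id_apply]
        exact (summable_lift h a).tsum_const_smul c } C fun a => by
    have h1 : HasSum (fun i => |coeff i a| * C) (‖a‖ * C) := (hasSum_norm a).mul_right C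
    rw [mul_comm]
    refine tsum_of_norm_bounded h1 fun i => ?_
    rw [norm_smul, Real.norm_eq_abs]
    exact mul_le_mul_of_nonneg_left (h i) (abs_nonneg _)

@[simp] theorem lift_mono (x : ℕ × ℕ → E) (C : ℝ) (h : ∀ i, ‖x i‖ ≤ C) (i : ℕ × ℕ) :
    lift x C h (mono i) = x i := by
  have : lift x C h (mono i) = ∑' j, coeff j (mono i) • x j := rfl
  rw [this, tsum_eq_single i]
  · simp [coeff_mono]
  · intro j hj
    simp [coeff_mono, hj]

/-- A linear map whose values on monomials tend to zero is compact. -/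
theorem isCompactOperator_of_tendsto_mono (f : Coef →L[ℝ] E)
    (h : Filter.Tendsto (fun i => ‖f (mono i)‖) Filter.cofinite (nhds 0)) :
    IsCompactOperator f := by
  let g : Finset (ℕ × ℕ) → Coef →L[ℝ] E := fun s =>
    ∑ i ∈ s, (coeff i).smulRight (f (mono i))
  have hg : ∀ (s : Finset (ℕ × ℕ)) j, g s (mono j) = if j ∈ s then f (mono j) else 0 := by
    intro s j
    simp [g, coeff_mono]
  refine isCompactOperator_of_tendsto (l := Filter.atTop) (F := g) ?_ ?_
  · rw [tendsto_iff_norm_sub_tendsto_zero, Metric.tendsto_atTop]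
    intro ε hε
    have h2 := (Metric.tendsto_nhds.1 h) (ε / 2) (by positivity)
    rw [Filter.eventually_cofinite] at h2
    refine ⟨h2.toFinset, fun s hs => ?_⟩
    have : ‖g s - f‖ ≤ ε / 2 := by
      refine norm_le_of_mono (by positivity) fun j => ?_
      rw [sub_apply, hg]
      split_ifs with hj
      · simp; linarith
      · have : j ∉ h2.toFinset := fun hh => hj (hs hh)
        simp only [Set.Finite.mem_toFinset, Set.mem_ofPred_eq, not_not] at this
        simpa using this.le
    simp only [dist_zero_right, norm_norm]
    linarith
  · refine Filter.Eventually.of_forall fun s => ?_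
    have : ∀ s : Finset (ℕ × ℕ), IsCompactOperator (g s) := by
      intro s
      induction s using Finset.induction_on with
      | empty => simpa [g] using isCompactOperator_zero
      | insert i s hi ih =>
        have e : g (insert i s) = (coeff i).smulRight (f (mono i)) + g s := by
          simp [g, Finset.sum_insert hi]
        rw [e]
        refine IsCompactOperator.add ?_ ih
        have h1 : IsCompactOperator (id : ℝ → ℝ) :=
          (isCompactOperator_id_iff_finiteDimensional (𝕜 := ℝ)).2 inferInstance
        exact (h1.comp_clm (coeff i)).clm_comp ((1 : ℝ →L[ℝ] ℝ).smulRight (f (mono i)))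
    exact this s

end lift

end Coef

namespace Coef

/-- The Cauchy product as a bilinear map. -/
noncomputable def mulBilin : Coef →L[ℝ] Coef →L[ℝ] Coef :=
  lift (fun i => lift (fun j => mono (i + j)) 1 fun j => (norm_mono _).le) 1 fun i =>
    norm_le_of_mono zero_le_one fun j => by rw [lift_mono, norm_mono]

theorem mulBilin_mono (i j : ℕ × ℕ) : mulBilin (mono i) (mono j) = mono (i + j) := by
  simp [mulBilin]

noncomputable instance : Mul Coef := ⟨fun a b => mulBilin a b⟩

noncomputable instance : One Coef := ⟨mono 0⟩

theorem one_def : (1 : Coef) = mono 0 := rfl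

@[simp] theorem mono_mul_mono (i j : ℕ × ℕ) : mono i * mono j = mono (i + j) := mulBilin_mono i j

variable {E : Type*} [NormedAddCommGroup E] [NormedSpace ℝ E]

/-- Two bilinear maps which agree on monomials are equal. -/
theorem ext_mono₂ {f g : Coef →L[ℝ] Coef →L[ℝ] E}
    (h : ∀ i j, f (mono i) (mono j) = g (mono i) (mono j)) (a b : Coef) : f a b = g a b := by
  have : f = g := ext_mono fun i => ext_mono fun j => h i j
  rw [this]

theorem mulBilin_comm (a b : Coef) : mulBilin a b = mulBilin b a :=
  ext_mono₂ (f := mulBilin) (g := mulBilin.flip)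
    (fun i j => by simp [mulBilin_mono, add_comm]) a b

theorem mulBilin_one (a : Coef) : mulBilin (mono 0) a = a := by
  have : mulBilin (mono 0) = ContinuousLinearMap.id ℝ Coef :=
    ext_mono fun i => by simp [mulBilin_mono]
  rw [this]; rfl

theorem mulBilin_assoc (a b c : Coef) :
    mulBilin (mulBilin a b) c = mulBilin a (mulBilin b c) := by
  have key : ∀ k, mulBilin (mulBilin a b) (mono k) = mulBilin a (mulBilin b (mono k)) := by
    intro k
    refine ext_mono₂ (f := (ContinuousLinearMap.compL ℝ Coef Coef Coef
      (mulBilin.flip (mono k))).comp mulBilin)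
      (g := (ContinuousLinearMap.flip (ContinuousLinearMap.compL ℝ Coef Coef Coef)
        (mulBilin.flip (mono k))).comp mulBilin) (fun i j => ?_) a b
    simp [mulBilin_mono, add_assoc]
  have : mulBilin (mulBilin a b) = (mulBilin a).comp (mulBilin b) := ext_mono key
  rw [this]; rfl

theorem norm_mulBilin_le (a b : Coef) : ‖mulBilin a b‖ ≤ ‖a‖ * ‖b‖ := by
  have h1 : ‖mulBilin‖ ≤ 1 := norm_le_of_mono zero_le_one fun i =>
    norm_le_of_mono zero_le_one fun j => by rw [mulBilin_mono, norm_mono]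
  calc ‖mulBilin a b‖ ≤ ‖mulBilin‖ * ‖a‖ * ‖b‖ := mulBilin.le_opNorm₂ a b
    _ ≤ 1 * ‖a‖ * ‖b‖ := by gcongr
    _ = _ := by rw [one_mul]

noncomputable instance : NormedCommRing Coef where
  __ := (inferInstance : NormedAddCommGroup Coef)
  mul a b := a * b
  one := 1
  left_distrib a b c := map_add (mulBilin a) b c
  right_distrib a b c := by
    change mulBilin (a + b) c = mulBilin a c + mulBilin b c
    simp
  zero_mul a := by change mulBilin 0 a = 0; simp
  mul_zero a := map_zero (mulBilin a)
  mul_assoc := mulBilin_assoc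
  one_mul := mulBilin_one
  mul_one a := (mulBilin_comm a _).trans (mulBilin_one a)
  mul_comm := mulBilin_comm
  norm_mul_le := norm_mulBilin_le

noncomputable instance : NormedAlgebra ℝ Coef where
  __ := Algebra.ofModule (R := ℝ) (A := Coef)
    (fun r a b => by change mulBilin (r • a) b = r • mulBilin a b; simp)
    (fun r a b => map_smul (mulBilin a) r b)
  norm_smul_le := norm_smul_le

end Coef

namespace Coef

theorem map_mul_of_mono {B : Type*} [NormedRing B] [NormedAlgebra ℝ B] (f : Coef →L[ℝ] B)
    (h : ∀ i j, f (mono (i + j)) = f (mono i) * f (mono j)) (a b : Coef) :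
    f (a * b) = f a * f b :=
  ext_mono₂ (f := (ContinuousLinearMap.compL ℝ Coef Coef B f).comp mulBilin)
    (g := (ContinuousLinearMap.mul ℝ B).bilinearComp f f)
    (fun i j => by simp [mulBilin_mono, h]) a b

/-- Exchange of the two variables. -/
noncomputable def swap : Coef →L[ℝ] Coef :=
  lift (fun i => mono i.swap) 1 fun _ => (norm_mono _).le

/-- Change of sign of both variables. -/
noncomputable def flip : Coef →L[ℝ] Coef :=
  lift (fun i => (-1 : ℝ) ^ (i.1 + i.2) • mono i) 1 fun i => by simp [norm_smul, norm_mono]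

/-- Restriction to the powers of the product of the variables. -/
noncomputable def rad : Coef →L[ℝ] Coef :=
  lift (fun i => if i.1 = i.2 then mono i else 0) 1 fun i => by split_ifs <;> simp [norm_mono]

@[simp] theorem swap_mono (i : ℕ × ℕ) : swap (mono i) = mono i.swap := lift_mono ..

@[simp] theorem flip_mono (i : ℕ × ℕ) : flip (mono i) = (-1 : ℝ) ^ (i.1 + i.2) • mono i :=
  lift_mono ..

@[simp] theorem rad_mono (i : ℕ × ℕ) : rad (mono i) = if i.1 = i.2 then mono i else 0 :=
  lift_mono ..

theorem swap_mul (a b : Coef) : swap (a * b) = swap a * swap b :=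
  map_mul_of_mono swap (fun i j => by simp) a b

theorem flip_mul (a b : Coef) : flip (a * b) = flip a * flip b :=
  map_mul_of_mono flip (fun i j => by
    simp only [flip_mono, Prod.fst_add, Prod.snd_add, smul_mul_smul_comm, mono_mul_mono, ← pow_add]
    congr 2; omega) a b

theorem swap_swap (a : Coef) : swap (swap a) = a := by
  have : swap.comp swap = ContinuousLinearMap.id ℝ Coef := ext_mono fun i => by simp
  exact congrArg (fun f => f a) this

theorem flip_flip (a : Coef) : flip (flip a) = a := by
  have : flip.comp flip = ContinuousLinearMap.id ℝ Coef := ext_mono fun i => by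
    simp [smul_smul, ← pow_add]
  exact congrArg (fun f => f a) this

theorem swap_flip (a : Coef) : swap (flip a) = flip (swap a) := by
  have : swap.comp flip = flip.comp swap := ext_mono fun i => by simp [add_comm]
  exact congrArg (fun f => f a) this

theorem swap_rad (a : Coef) : swap (rad a) = rad a := by
  have : swap.comp rad = rad := ext_mono fun i => by
    rcases i with ⟨j, k⟩
    by_cases h : j = k <;> simp [h]
  exact congrArg (fun f => f a) this

theorem flip_rad (a : Coef) : flip (rad a) = rad a := by
  have : flip.comp rad = rad := ext_mono fun i => by
    rcases i with ⟨j, k⟩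
    by_cases h : j = k <;> simp [h, ← two_mul]
  exact congrArg (fun f => f a) this

theorem rad_rad_mul_rad (a b : Coef) : rad (rad a * rad b) = rad a * rad b :=
  ext_mono₂ (f := (ContinuousLinearMap.compL ℝ Coef Coef Coef rad).comp
      (mulBilin.bilinearComp rad rad))
    (g := mulBilin.bilinearComp rad rad)
    (fun i j => by
      obtain ⟨i, k⟩ := i
      obtain ⟨l, m⟩ := j
      by_cases h : i = k <;> by_cases h' : l = m <;> simp [h, h', mulBilin_mono]) a b

/-- Symmetrization onto the part even in both Cartesian variables. -/
noncomputable def evenProj : Coef →L[ℝ] Coef :=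
  (1 / 4 : ℝ) • (1 + swap + flip + flip.comp swap)

/-- Symmetrization onto the part odd under the antipodal map and even in the second Cartesian
variable. -/
noncomputable def oddProj : Coef →L[ℝ] Coef :=
  (1 / 4 : ℝ) • (1 + swap - flip - flip.comp swap)

theorem evenProj_apply (a : Coef) :
    evenProj a = (1 / 4 : ℝ) • (a + swap a + flip a + flip (swap a)) := rfl

theorem oddProj_apply (a : Coef) :
    oddProj a = (1 / 4 : ℝ) • (a + swap a - flip a - flip (swap a)) := rfl

theorem swap_evenProj (a : Coef) : swap (evenProj a) = evenProj a := by
  simp only [evenProj_apply, map_smul, map_add, swap_swap, swap_flip]; abel_nf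

theorem swap_oddProj (a : Coef) : swap (oddProj a) = oddProj a := by
  simp only [oddProj_apply, map_smul, map_add, map_sub, swap_swap, swap_flip]; abel_nf

theorem flip_evenProj (a : Coef) : flip (evenProj a) = evenProj a := by
  simp only [evenProj_apply, map_smul, map_add, flip_flip]; abel_nf

theorem flip_oddProj (a : Coef) : flip (oddProj a) = -oddProj a := by
  simp only [oddProj_apply, map_smul, map_add, map_sub, flip_flip]; module

theorem evenProj_eq {a : Coef} (h1 : swap a = a) (h2 : flip a = a) : evenProj a = a := by
  rw [evenProj_apply, h1, h2]; module

theorem oddProj_eq {a : Coef} (h1 : swap a = a) (h2 : flip a = -a) : oddProj a = a := by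
  rw [oddProj_apply, h1, h2]; module

/-- The solution operator of `-Δ v = f`, `v = 0` on the unit circle, when the monomials are
`(z / 2) ^ j * (conj z / 2) ^ k`. -/
noncomputable def green : Coef →L[ℝ] Coef :=
  lift (fun i => (1 / (4 * (i.1 + 1) * (i.2 + 1)) : ℝ) •
    ((1 / 4 : ℝ) ^ min i.1 i.2 • mono (i.1 - i.2, i.2 - i.1) - (4 : ℝ) • mono (i + (1, 1)))) 2
    (fun i => by
      rw [norm_smul]
      have h1 : ‖(1 / (4 * (i.1 + 1) * (i.2 + 1)) : ℝ)‖ ≤ 1 / 4 := by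
        rw [Real.norm_eq_abs, abs_of_nonneg (by positivity), div_le_div_iff₀ (by positivity)
          (by positivity)]
        nlinarith [(Nat.cast_nonneg i.1 : (0 : ℝ) ≤ i.1), (Nat.cast_nonneg i.2 : (0 : ℝ) ≤ i.2),
          mul_nonneg (Nat.cast_nonneg i.1 : (0 : ℝ) ≤ i.1) (Nat.cast_nonneg i.2 : (0 : ℝ) ≤ i.2)]
      have h2 : ‖(1 / 4 : ℝ) ^ min i.1 i.2 • mono (i.1 - i.2, i.2 - i.1) -
          (4 : ℝ) • mono (i + (1, 1))‖ ≤ 5 := by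
        refine (norm_sub_le _ _).trans ?_
        rw [norm_smul, norm_smul, norm_mono, norm_mono, Real.norm_eq_abs,
          abs_of_nonneg (by positivity)]
        have : (1 / 4 : ℝ) ^ min i.1 i.2 ≤ 1 := pow_le_one₀ (by norm_num) (by norm_num)
        norm_num at *
        linarith
      calc _ ≤ (1 / 4 : ℝ) * 5 := by gcongr
        _ ≤ 2 := by norm_num)

theorem green_mono (i : ℕ × ℕ) : green (mono i) = (1 / (4 * (i.1 + 1) * (i.2 + 1)) : ℝ) •
    ((1 / 4 : ℝ) ^ min i.1 i.2 • mono (i.1 - i.2, i.2 - i.1) - (4 : ℝ) • mono (i + (1, 1))) :=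
  lift_mono ..

theorem swap_green (a : Coef) : swap (green a) = green (swap a) := by
  have : swap.comp green = green.comp swap := ext_mono fun i => by
    simp only [ContinuousLinearMap.comp_apply, green_mono, map_smul, map_sub, swap_mono,
      Prod.swap_prod_mk, Prod.fst_swap, Prod.snd_swap, min_comm i.1 i.2]
    congr 1
    ring
  exact congrArg (fun f => f a) this

theorem flip_green (a : Coef) : flip (green a) = green (flip a) := by
  have : flip.comp green = green.comp flip := ext_mono fun i => by
    simp only [ContinuousLinearMap.comp_apply, green_mono, map_smul, map_sub, flip_mono]
    have h1 : (-1 : ℝ) ^ (i.1 - i.2 + (i.2 - i.1)) = (-1) ^ (i.1 + i.2) := by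
      rcases le_total i.1 i.2 with h | h
      · obtain ⟨c, hc⟩ := Nat.exists_eq_add_of_le h
        have e1 : i.1 - i.2 + (i.2 - i.1) = c := by omega
        have e2 : i.1 + i.2 = 2 * i.1 + c := by omega
        rw [e1, e2, pow_add, pow_mul]; simp
      · obtain ⟨c, hc⟩ := Nat.exists_eq_add_of_le h
        have e1 : i.1 - i.2 + (i.2 - i.1) = c := by omega
        have e2 : i.1 + i.2 = 2 * i.2 + c := by omega
        rw [e1, e2, pow_add, pow_mul]; simp
    have h2 : (-1 : ℝ) ^ ((i + (1, 1)).1 + (i + (1, 1)).2) = (-1) ^ (i.1 + i.2) := by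
      have : (i + (1, 1)).1 + (i + (1, 1)).2 = i.1 + i.2 + 2 := by
        simp only [Prod.fst_add, Prod.snd_add]; omega
      rw [this, pow_add]; simp
    rw [h1, h2]
    module
  exact congrArg (fun f => f a) this

theorem isCompactOperator_of_norm_mono_le {E : Type*} [NormedAddCommGroup E] [NormedSpace ℝ E]
    [CompleteSpace E] (f : Coef →L[ℝ] E) (C : ℝ)
    (hb : ∀ i, ‖f (mono i)‖ ≤ C * (1 / ((i.1 : ℝ) + i.2 + 1))) : IsCompactOperator f := by
  refine isCompactOperator_of_tendsto_mono f ?_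
  refine squeeze_zero (fun i => norm_nonneg _) hb ?_
  rw [show (0 : ℝ) = C * 0 by simp]
  refine Filter.Tendsto.const_mul _ ?_
  rw [Metric.tendsto_nhds]
  intro ε hε
  obtain ⟨N, hN⟩ := exists_nat_one_div_lt hε
  rw [Filter.eventually_cofinite]
  refine Set.Finite.subset ((Set.finite_Iio N).prod (Set.finite_Iio N)) fun i hi => ?_
  simp only [Set.mem_ofPred_eq, dist_zero_right, not_lt] at hi
  rw [Real.norm_eq_abs, abs_of_nonneg (by positivity)] at hi
  have h3 : 1 / ((N : ℝ) + 1) < 1 / ((i.1 : ℝ) + i.2 + 1) := hN.trans_le hi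
  rw [div_lt_div_iff₀ (by positivity) (by positivity)] at h3
  have h4 : i.1 + i.2 < N := by
    have : ((i.1 + i.2 : ℕ) : ℝ) < N := by push_cast; linarith
    exact_mod_cast this
  simp only [Set.mem_prod, Set.mem_Iio]
  omega

theorem isCompactOperator_green : IsCompactOperator green := by
  refine isCompactOperator_of_norm_mono_le green 2 fun i => ?_
  rw [green_mono, norm_smul]
  have h2 : ‖(1 / 4 : ℝ) ^ min i.1 i.2 • mono (i.1 - i.2, i.2 - i.1) -
      (4 : ℝ) • mono (i + (1, 1))‖ ≤ 5 := by
    refine (norm_sub_le _ _).trans ?_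
    rw [norm_smul, norm_smul, norm_mono, norm_mono, Real.norm_eq_abs,
      abs_of_nonneg (by positivity)]
    have : (1 / 4 : ℝ) ^ min i.1 i.2 ≤ 1 := pow_le_one₀ (by norm_num) (by norm_num)
    norm_num at *
    linarith
  have h1 : ‖(1 / (4 * (i.1 + 1) * (i.2 + 1)) : ℝ)‖ ≤ 1 / 4 * (1 / ((i.1 : ℝ) + i.2 + 1)) := by
    rw [Real.norm_eq_abs, abs_of_nonneg (by positivity), div_mul_div_comm,
      div_le_div_iff₀ (by positivity) (by positivity)]
    nlinarith [mul_nonneg (Nat.cast_nonneg i.1 : (0 : ℝ) ≤ i.1)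
      (Nat.cast_nonneg i.2 : (0 : ℝ) ≤ i.2)]
  calc _ ≤ 1 / 4 * (1 / ((i.1 : ℝ) + i.2 + 1)) * 5 := by gcongr
    _ ≤ _ := by
      have : 0 ≤ 1 / ((i.1 : ℝ) + i.2 + 1) := by positivity
      linarith

end Coef

/-! ### Laplaceans of vector valued functions of two variables -/

section VectorLaplacean

variable {X Y : Type*} [NormedAddCommGroup X] [NormedSpace ℝ X]
  [NormedAddCommGroup Y] [NormedSpace ℝ Y]

/-- The Laplacean of a vector valued function. -/
noncomputable def lapF (F : ℝ × ℝ → X) (p : ℝ × ℝ) : X :=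
  fderiv ℝ (fun q => fderiv ℝ F q (1, 0)) p (1, 0) + fderiv ℝ (fun q => fderiv ℝ F q (0, 1)) p (0, 1)

theorem AnalyticAt.fderiv_apply_vec [CompleteSpace X] {F : ℝ × ℝ → X} {p : ℝ × ℝ} (h : AnalyticAt ℝ F p)
    (v : ℝ × ℝ) : AnalyticAt ℝ (fun q => fderiv ℝ F q v) p :=
  ((ContinuousLinearMap.apply ℝ X v).analyticAt _).comp h.fderiv

theorem fderiv_clm_comp_apply {F : ℝ × ℝ → X} {p : ℝ × ℝ} (h : DifferentiableAt ℝ F p)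
    (l : X →L[ℝ] Y) (v : ℝ × ℝ) : fderiv ℝ (fun q => l (F q)) p v = l (fderiv ℝ F p v) := by
  have := (l.hasFDerivAt.comp p h.hasFDerivAt).fderiv
  rw [show (fun q => l (F q)) = l ∘ F from rfl, this]
  rfl

theorem lapF_clm_comp [CompleteSpace X] {F : ℝ × ℝ → X} {p : ℝ × ℝ} (h : AnalyticAt ℝ F p) (l : X →L[ℝ] Y) :
    lapF (fun q => l (F q)) p = l (lapF F p) := by
  have key : ∀ v : ℝ × ℝ, fderiv ℝ (fun q => fderiv ℝ (fun q => l (F q)) q v) p v =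
      l (fderiv ℝ (fun q => fderiv ℝ F q v) p v) := by
    intro v
    have : (fun q => fderiv ℝ (fun q => l (F q)) q v) =ᶠ[nhds p] fun q => l (fderiv ℝ F q v) := by
      filter_upwards [h.eventually_analyticAt] with q hq
      exact fderiv_clm_comp_apply hq.differentiableAt l v
    rw [this.fderiv_eq]
    exact fderiv_clm_comp_apply (h.fderiv_apply_vec v).differentiableAt l v
  rw [lapF, lapF, key, key, map_add]

theorem lapF_congr {F G : ℝ × ℝ → X} {p : ℝ × ℝ} (h : F =ᶠ[nhds p] G) : lapF F p = lapF G p := by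
  have key : ∀ v : ℝ × ℝ, (fun q => fderiv ℝ F q v) =ᶠ[nhds p] fun q => fderiv ℝ G q v := by
    intro v
    filter_upwards [h.eventually_nhds] with q hq
    rw [Filter.EventuallyEq.fderiv_eq (hq : F =ᶠ[nhds q] G)]
  rw [lapF, lapF, (key _).fderiv_eq, (key _).fderiv_eq]

theorem deriv_fst_eq {u : ℝ × ℝ → ℝ} {x y : ℝ} (h : DifferentiableAt ℝ u (x, y)) :
    deriv (fun x' => u (x', y)) x = fderiv ℝ u (x, y) (1, 0) := by
  have h1 : HasDerivAt (fun x' : ℝ => (x', y)) ((1 : ℝ), (0 : ℝ)) x :=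
    (hasDerivAt_id x).prodMk (hasDerivAt_const x y)
  exact (h.hasFDerivAt.comp_hasDerivAt x h1).deriv

theorem deriv_snd_eq {u : ℝ × ℝ → ℝ} {x y : ℝ} (h : DifferentiableAt ℝ u (x, y)) :
    deriv (fun y' => u (x, y')) y = fderiv ℝ u (x, y) (0, 1) := by
  have h1 : HasDerivAt (fun y' : ℝ => (x, y')) ((0 : ℝ), (1 : ℝ)) y :=
    (hasDerivAt_const y x).prodMk (hasDerivAt_id y)
  exact (h.hasFDerivAt.comp_hasDerivAt y h1).deriv

theorem lap_eq_lapF {u : ℝ × ℝ → ℝ} {p : ℝ × ℝ} (h : AnalyticAt ℝ u p) : lap u p = lapF u p := by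
  obtain ⟨x, y⟩ := p
  have hc1 : ContinuousAt (fun x' : ℝ => (x', y)) x := by fun_prop
  have hc2 : ContinuousAt (fun y' : ℝ => (x, y')) y := by fun_prop
  have e1 : (fun x' => deriv (fun x'' => u (x'', y)) x') =ᶠ[nhds x]
      fun x' => fderiv ℝ u (x', y) (1, 0) := by
    filter_upwards [hc1.eventually h.eventually_analyticAt] with x' hx'
    exact deriv_fst_eq hx'.differentiableAt
  have e2 : (fun y' => deriv (fun y'' => u (x, y'')) y') =ᶠ[nhds y]
      fun y' => fderiv ℝ u (x, y') (0, 1) := by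
    filter_upwards [hc2.eventually h.eventually_analyticAt] with y' hy'
    exact deriv_snd_eq hy'.differentiableAt
  unfold lap lapF
  simp only
  rw [e1.deriv_eq, e2.deriv_eq,
    deriv_fst_eq (u := fun q => fderiv ℝ u q (1, 0)) (h.fderiv_apply_vec _).differentiableAt,
    deriv_snd_eq (u := fun q => fderiv ℝ u q (0, 1)) (h.fderiv_apply_vec _).differentiableAt]

end VectorLaplacean

/-- The solution of a fixed point equation with a small linear coefficient depends analytically on
the parameter. -/
theorem analyticAt_of_resolvent {P X : Type*} [NormedAddCommGroup P] [NormedSpace ℝ P]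
    [NormedAddCommGroup X] [NormedSpace ℝ X] [CompleteSpace X]
    {L : P → X →L[ℝ] X} {x y : P → X} {p : P} (hL : AnalyticAt ℝ L p) (hx : AnalyticAt ℝ x p)
    (hy : ∀ᶠ q in nhds p, ‖L q‖ < 1 ∧ y q - L q (y q) = x q) : AnalyticAt ℝ y p := by
  have hu : IsUnit (1 - L p) := isUnit_one_sub_of_norm_lt_one hy.self_of_nhds.1
  have h1 : AnalyticAt ℝ (fun q => Ring.inverse (1 - L q)) p := by
    obtain ⟨v, hv⟩ := hu
    have := analyticAt_inverse (𝕜 := ℝ) v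
    rw [hv] at this
    exact AnalyticAt.fun_comp (f := fun q => 1 - L q) this (analyticAt_const.sub hL)
  have h2 : AnalyticAt ℝ (fun q => Ring.inverse (1 - L q) (x q)) p :=
    ((ContinuousLinearMap.id ℝ (X →L[ℝ] X)).analyticAt_bilinear (Ring.inverse (1 - L p), x p)).comp₂ h1 hx
  refine h2.congr ?_
  filter_upwards [hy] with q hq
  have hu : IsUnit (1 - L q) := isUnit_one_sub_of_norm_lt_one hq.1
  have e : (1 - L q) (y q) = x q := hq.2
  rw [← e, ← mul_apply_eq_comp, Ring.inverse_mul_cancel _ hu]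
  rfl

theorem analyticAt_fst_smul_add_snd_smul {Y : Type*} [NormedAddCommGroup Y] [NormedSpace ℝ Y]
    (a b : Y) (p : ℝ × ℝ) : AnalyticAt ℝ (fun q : ℝ × ℝ => q.1 • a + q.2 • b) p :=
  (analyticAt_fst.smul analyticAt_const).add (analyticAt_snd.smul analyticAt_const)

namespace Coef

/-- The complex number with given Cartesian coordinates. -/
noncomputable def toC : ℝ × ℝ →L[ℝ] ℂ :=
  Complex.ofRealCLM.comp (ContinuousLinearMap.fst ℝ ℝ ℝ) +
    Complex.I • Complex.ofRealCLM.comp (ContinuousLinearMap.snd ℝ ℝ ℝ)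

theorem toC_apply (p : ℝ × ℝ) : toC p = p.1 + Complex.I * p.2 := rfl

/-- The complex conjugate of `toC`. -/
noncomputable def toCbar : ℝ × ℝ →L[ℝ] ℂ :=
  Complex.ofRealCLM.comp (ContinuousLinearMap.fst ℝ ℝ ℝ) -
    Complex.I • Complex.ofRealCLM.comp (ContinuousLinearMap.snd ℝ ℝ ℝ)

theorem toCbar_apply (p : ℝ × ℝ) : toCbar p = p.1 - Complex.I * p.2 := rfl

theorem toC_mul_toCbar (p : ℝ × ℝ) : toC p * toCbar p = ((p.1 ^ 2 + p.2 ^ 2 : ℝ) : ℂ) := by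
  rw [toC_apply, toCbar_apply]; push_cast; linear_combination (-(p.2 : ℂ) ^ 2) * Complex.I_sq

theorem toCbar_eq_conj (p : ℝ × ℝ) : toCbar p = (starRingEnd ℂ) (toC p) := by
  simp [toC_apply, toCbar_apply, sub_eq_add_neg]

theorem norm_toC (p : ℝ × ℝ) : ‖toC p‖ = √(p.1 ^ 2 + p.2 ^ 2) := by
  rw [toC_apply, mul_comm, Complex.norm_add_mul_I]

theorem norm_toCbar (p : ℝ × ℝ) : ‖toCbar p‖ = √(p.1 ^ 2 + p.2 ^ 2) := by
  rw [toCbar_eq_conj, Complex.norm_conj, norm_toC]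

/-- The monomials in half the complex coordinate and its conjugate. -/
noncomputable def monoFun (i : ℕ × ℕ) (p : ℝ × ℝ) : ℂ := (toC p / 2) ^ i.1 * (toCbar p / 2) ^ i.2

theorem norm_monoFun_le (i : ℕ × ℕ) {p : ℝ × ℝ} (hp : p.1 ^ 2 + p.2 ^ 2 ≤ 4) :
    ‖monoFun i p‖ ≤ 1 := by
  have h : √(p.1 ^ 2 + p.2 ^ 2) ≤ 2 := by
    rw [Real.sqrt_le_left (by norm_num)]; linarith
  rw [monoFun, norm_mul, norm_pow, norm_pow, norm_div, norm_div, norm_toC, norm_toCbar,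
    Complex.norm_ofNat, ← pow_add]
  exact pow_le_one₀ (by positivity) (by linarith)

open scoped Classical in
/-- Evaluation of a power series at a point of the disk of radius `2`. -/
noncomputable def val (p : ℝ × ℝ) : Coef →L[ℝ] ℂ :=
  lift (fun i => if p.1 ^ 2 + p.2 ^ 2 ≤ 4 then monoFun i p else 0) 1 fun i => by
    split_ifs with h
    · exact norm_monoFun_le i h
    · simp

theorem val_mono {p : ℝ × ℝ} (hp : p.1 ^ 2 + p.2 ^ 2 ≤ 4) (i : ℕ × ℕ) :
    val p (mono i) = monoFun i p := by
  rw [val, lift_mono, if_pos hp]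

theorem val_mul {p : ℝ × ℝ} (hp : p.1 ^ 2 + p.2 ^ 2 ≤ 4) (a b : Coef) :
    val p (a * b) = val p a * val p b :=
  map_mul_of_mono (val p) (fun i j => by
    simp only [val_mono hp, monoFun, Prod.fst_add, Prod.snd_add, pow_add]; ring) a b

theorem val_one {p : ℝ × ℝ} (hp : p.1 ^ 2 + p.2 ^ 2 ≤ 4) : val p 1 = 1 := by
  simp [one_def, val_mono hp, monoFun]

theorem val_pow {p : ℝ × ℝ} (hp : p.1 ^ 2 + p.2 ^ 2 ≤ 4) (a : Coef) (n : ℕ) :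
    val p (a ^ n) = val p a ^ n := by
  induction n with
  | zero => simp [val_one hp]
  | succ n ih => rw [pow_succ, pow_succ, val_mul hp, ih]

theorem norm_val_le (p : ℝ × ℝ) : ‖val p‖ ≤ 1 :=
  norm_le_of_mono zero_le_one fun i => by
    rw [val, lift_mono]
    split_ifs with h
    · exact norm_monoFun_le i h
    · simp

theorem val_swap {p : ℝ × ℝ} (hp : p.1 ^ 2 + p.2 ^ 2 ≤ 4) (a : Coef) :
    val p (swap a) = (starRingEnd ℂ) (val p a) := by
  have : (val p).comp swap = (Complex.conjCLE : ℂ →L[ℝ] ℂ).comp (val p) := ext_mono fun i => by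
    simp [val_mono hp, monoFun, toCbar_eq_conj, mul_comm, Complex.conj_ofNat]
  exact congrArg (fun f => f a) this

theorem val_im_eq_zero {p : ℝ × ℝ} (hp : p.1 ^ 2 + p.2 ^ 2 ≤ 4) {a : Coef} (h : swap a = a) :
    (val p a).im = 0 := by
  have := val_swap hp a
  rw [h] at this
  exact Complex.conj_eq_iff_im.1 this.symm

theorem val_neg {p : ℝ × ℝ} (hp : p.1 ^ 2 + p.2 ^ 2 ≤ 4) (a : Coef) :
    val (-p) a = val p (flip a) := by
  have hn : (-p).1 ^ 2 + (-p).2 ^ 2 ≤ 4 := by simpa using hp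
  have : val (-p) = (val p).comp flip := ext_mono fun i => by
    simp only [ContinuousLinearMap.comp_apply, flip_mono, map_smul, val_mono hp, val_mono hn,
      monoFun, map_neg, neg_div]
    rw [neg_pow (toC p / 2), neg_pow (toCbar p / 2), Complex.real_smul]
    push_cast
    ring
  exact congrArg (fun f => f a) this

/-- Division by the first variable, of the monomials where this is possible. -/
noncomputable def shiftFst : Coef →L[ℝ] Coef :=
  lift (fun i => if i.1 = 0 then 0 else mono (i.1 - 1, i.2)) 1 fun i => by
    split_ifs <;> simp [norm_mono]

/-- Division of the powers of the second variable by this variable. -/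
noncomputable def shiftSnd : Coef →L[ℝ] Coef :=
  lift (fun i => if i.1 = 0 ∧ i.2 ≠ 0 then mono (0, i.2 - 1) else 0) 1 fun i => by
    split_ifs <;> simp [norm_mono]

/-- The coefficient of the linear fixed point equation satisfied by the evaluation map. -/
noncomputable def valStep (p : ℝ × ℝ) : (Coef →L[ℝ] ℂ) →L[ℝ] (Coef →L[ℝ] ℂ) :=
  p.1 • ((1 / 2 : ℝ) • ((ContinuousLinearMap.compL ℝ Coef Coef ℂ).flip shiftFst +
    (ContinuousLinearMap.compL ℝ Coef Coef ℂ).flip shiftSnd)) +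
  p.2 • ((Complex.I / 2 : ℂ) • ((ContinuousLinearMap.compL ℝ Coef Coef ℂ).flip shiftFst -
    (ContinuousLinearMap.compL ℝ Coef Coef ℂ).flip shiftSnd))

theorem valStep_apply (p : ℝ × ℝ) (f : Coef →L[ℝ] ℂ) (a : Coef) :
    valStep p f a = toC p / 2 * f (shiftFst a) + toCbar p / 2 * f (shiftSnd a) := by
  simp only [valStep, add_apply, smul_apply, sub_apply,
    ContinuousLinearMap.flip_apply, ContinuousLinearMap.compL_apply, ContinuousLinearMap.comp_apply,
    toC_apply, toCbar_apply, Complex.real_smul, smul_eq_mul]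
  push_cast
  ring

theorem analyticAt_val {p : ℝ × ℝ} (hp : p.1 ^ 2 + p.2 ^ 2 < 4) : AnalyticAt ℝ val p := by
  have hev : ∀ᶠ q : ℝ × ℝ in nhds p, q.1 ^ 2 + q.2 ^ 2 < 4 := by
    refine ContinuousAt.eventually_lt ?_ continuousAt_const hp
    fun_prop
  have hL : AnalyticAt ℝ valStep p := by
    unfold valStep
    exact analyticAt_fst_smul_add_snd_smul _ _ p
  refine analyticAt_of_resolvent (x := fun _ => lift (fun i => if i = 0 then 1 else 0) 1
    fun i => by split_ifs <;> simp) hL analyticAt_const ?_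
  filter_upwards [hev] with q hq
  have hs : √(q.1 ^ 2 + q.2 ^ 2) < 2 := by
    rw [Real.sqrt_lt' (by norm_num)]; linarith
  constructor
  · refine lt_of_le_of_lt (ContinuousLinearMap.opNorm_le_bound _ (M := √(q.1 ^ 2 + q.2 ^ 2) / 2)
      (by positivity) fun f => ?_) (by linarith)
    refine norm_le_of_mono (by positivity) fun i => ?_
    rw [valStep_apply, shiftFst, shiftSnd, lift_mono, lift_mono]
    have hf : ∀ j, ‖f (mono j)‖ ≤ ‖f‖ := fun j => by simpa [norm_mono] using f.le_opNorm (mono j)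
    by_cases h1 : i.1 = 0
    · by_cases h2 : i.2 = 0
      · simp [h1, h2]; positivity
      · simp only [h1, h2, if_true, map_zero, mul_zero, zero_add, true_and, ne_eq,
          not_false_eq_true, norm_mul, norm_div, norm_toCbar, Complex.norm_ofNat]
        gcongr; exact hf _
    · simp only [h1, if_false, map_zero, mul_zero, add_zero, false_and,
        norm_mul, norm_div, norm_toC, Complex.norm_ofNat]
      gcongr; exact hf _
  · refine ext_mono fun i => ?_
    rw [sub_apply, valStep_apply, shiftFst, shiftSnd, lift_mono, lift_mono, lift_mono]
    rcases i with ⟨j, k⟩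
    rcases j with _ | j
    · rcases k with _ | k
      · simp [val_mono hq.le, monoFun]
      · simp [val_mono hq.le, monoFun, pow_succ]; ring
    · simp [val_mono hq.le, monoFun, pow_succ]; ring

theorem hasFDerivAt_monoFun (i : ℕ × ℕ) (p : ℝ × ℝ) :
    HasFDerivAt (monoFun i) ((i.1 / 2 * monoFun (i.1 - 1, i.2) p) • toC +
      (i.2 / 2 * monoFun (i.1, i.2 - 1) p) • toCbar) p := by
  have h1 : HasFDerivAt (fun q => (toC q / 2) ^ i.1)
      ((i.1 / 2 * (toC p / 2) ^ (i.1 - 1) : ℂ) • toC) p := by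
    have := ((toC.hasFDerivAt (x := p)).mul_const (2⁻¹ : ℂ)).pow i.1
    refine (this.congr_fderiv ?_)
    ext <;> simp [div_eq_mul_inv] <;> ring
  have h2 : HasFDerivAt (fun q => (toCbar q / 2) ^ i.2)
      ((i.2 / 2 * (toCbar p / 2) ^ (i.2 - 1) : ℂ) • toCbar) p := by
    have := ((toCbar.hasFDerivAt (x := p)).mul_const (2⁻¹ : ℂ)).pow i.2
    refine (this.congr_fderiv ?_)
    ext <;> simp [div_eq_mul_inv] <;> ring
  refine (h1.mul h2).congr_fderiv ?_
  ext <;> simp [monoFun] <;> ring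

end Coef

namespace Coef

theorem fderiv_monoFun_apply (i : ℕ × ℕ) (p v : ℝ × ℝ) :
    fderiv ℝ (monoFun i) p v = i.1 / 2 * monoFun (i.1 - 1, i.2) p * toC v +
      i.2 / 2 * monoFun (i.1, i.2 - 1) p * toCbar v := by
  rw [(hasFDerivAt_monoFun i p).fderiv]
  simp

theorem lapF_monoFun (i : ℕ × ℕ) (p : ℝ × ℝ) :
    lapF (monoFun i) p = i.1 * i.2 * monoFun (i.1 - 1, i.2 - 1) p := by
  have key : ∀ v : ℝ × ℝ, fderiv ℝ (fun q => fderiv ℝ (monoFun i) q v) p v =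
      i.1 / 2 * fderiv ℝ (monoFun (i.1 - 1, i.2)) p v * toC v +
        i.2 / 2 * fderiv ℝ (monoFun (i.1, i.2 - 1)) p v * toCbar v := by
    intro v
    have e : (fun q => fderiv ℝ (monoFun i) q v) = fun q =>
        i.1 / 2 * monoFun (i.1 - 1, i.2) q * toC v +
          i.2 / 2 * monoFun (i.1, i.2 - 1) q * toCbar v :=
      funext fun q => fderiv_monoFun_apply i q v
    have h1 := (((hasFDerivAt_monoFun (i.1 - 1, i.2) p).const_mul (i.1 / 2 : ℂ)).mul_const
      (toC v)).add (((hasFDerivAt_monoFun (i.1, i.2 - 1) p).const_mul (i.2 / 2 : ℂ)).mul_const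
      (toCbar v))
    rw [e]
    have h2 := h1.fderiv
    simp only [Pi.add_def] at h2
    rw [h2, fderiv_monoFun_apply, fderiv_monoFun_apply]
    simp
    ring
  rw [lapF, key, key]
  simp only [fderiv_monoFun_apply, toC_apply, toCbar_apply]
  push_cast
  linear_combination (i.1 / 2 * ((i.1 - 1 : ℕ) / 2 * monoFun (i.1 - 1 - 1, i.2) p) -
    i.1 * i.2 / 2 * monoFun (i.1 - 1, i.2 - 1) p +
    i.2 / 2 * ((i.2 - 1 : ℕ) / 2 * monoFun (i.1, i.2 - 1 - 1) p)) * Complex.I_sq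

variable {p : ℝ × ℝ}

theorem eventually_lt_four (hp : p.1 ^ 2 + p.2 ^ 2 < 4) :
    ∀ᶠ q : ℝ × ℝ in nhds p, q.1 ^ 2 + q.2 ^ 2 < 4 := by
  refine ContinuousAt.eventually_lt ?_ continuousAt_const hp
  fun_prop

theorem val_mono_eventuallyEq (hp : p.1 ^ 2 + p.2 ^ 2 < 4) (i : ℕ × ℕ) :
    (fun q => val q (mono i)) =ᶠ[nhds p] monoFun i := by
  filter_upwards [eventually_lt_four hp] with q hq using val_mono hq.le i

theorem fderiv_val_apply (hp : p.1 ^ 2 + p.2 ^ 2 < 4) (a : Coef) (v : ℝ × ℝ) :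
    fderiv ℝ (fun q => val q a) p v = fderiv ℝ val p v a :=
  fderiv_clm_comp_apply (analyticAt_val hp).differentiableAt (ContinuousLinearMap.apply ℝ ℂ a) v

theorem analyticAt_val_apply (hp : p.1 ^ 2 + p.2 ^ 2 < 4) (a : Coef) :
    AnalyticAt ℝ (fun q => val q a) p :=
  ((ContinuousLinearMap.apply ℝ ℂ a).analyticAt _).comp (analyticAt_val hp)

theorem lapF_val_apply (hp : p.1 ^ 2 + p.2 ^ 2 < 4) (a : Coef) :
    lapF (fun q => val q a) p = lapF val p a :=
  lapF_clm_comp (analyticAt_val hp) (ContinuousLinearMap.apply ℝ ℂ a)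

theorem lapF_val_mono (hp : p.1 ^ 2 + p.2 ^ 2 < 4) (i : ℕ × ℕ) :
    lapF val p (mono i) = i.1 * i.2 * monoFun (i.1 - 1, i.2 - 1) p := by
  rw [← lapF_val_apply hp, lapF_congr (val_mono_eventuallyEq hp i), lapF_monoFun]

theorem monoFun_add_one_one (i : ℕ × ℕ) (p : ℝ × ℝ) :
    monoFun (i + (1, 1)) p = ((p.1 ^ 2 + p.2 ^ 2) / 4 : ℝ) * monoFun i p := by
  simp only [monoFun, Prod.fst_add, Prod.snd_add, pow_succ]
  push_cast
  have := toC_mul_toCbar p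
  push_cast at this
  linear_combination (toC p / 2) ^ i.1 * (toCbar p / 2) ^ i.2 / 4 * this

theorem monoFun_of_eq_one (hp : p.1 ^ 2 + p.2 ^ 2 = 1) (i : ℕ × ℕ) :
    monoFun i p = ((1 / 4 : ℝ) ^ min i.1 i.2 : ℝ) * monoFun (i.1 - i.2, i.2 - i.1) p := by
  have key : ∀ (n : ℕ) (j : ℕ × ℕ), monoFun (j + (n, n)) p = ((1 / 4 : ℝ) ^ n : ℝ) * monoFun j p := by
    intro n j
    induction n with
    | zero => rw [show j + (0, 0) = j from rfl]; simp
    | succ n ih =>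
      rw [show j + (n + 1, n + 1) = (j + (n, n)) + (1, 1) from rfl, monoFun_add_one_one, ih, hp]
      push_cast; ring
  have h := key (min i.1 i.2) (i.1 - i.2, i.2 - i.1)
  rw [← h]
  congr 1
  ext
  · simp
  · simp; omega

theorem lapF_val_green (hp : p.1 ^ 2 + p.2 ^ 2 < 4) (a : Coef) :
    lapF val p (green a) = -val p a := by
  have : (lapF val p).comp green = -val p := ext_mono fun i => by
    rw [ContinuousLinearMap.comp_apply, green_mono, map_smul, map_sub, map_smul, map_smul,
      lapF_val_mono hp, lapF_val_mono hp, neg_apply, val_mono hp.le, Complex.real_smul,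
      Complex.real_smul, Complex.real_smul]
    have h1 : ((i.1 - i.2 : ℕ) : ℂ) * ((i.2 - i.1 : ℕ) : ℂ) = 0 := by
      rcases le_total i.1 i.2 with h | h <;> simp [Nat.sub_eq_zero_of_le h]
    have h2 : (i.1 + 1 : ℂ) ≠ 0 := Nat.cast_add_one_ne_zero _
    have h3 : (i.2 + 1 : ℂ) ≠ 0 := Nat.cast_add_one_ne_zero _
    rw [h1]
    simp
    field_simp
  exact congrArg (fun f => f a) this

theorem val_green_of_eq_one (hp : p.1 ^ 2 + p.2 ^ 2 = 1) (a : Coef) : val p (green a) = 0 := by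
  have h4 : p.1 ^ 2 + p.2 ^ 2 ≤ 4 := by linarith
  have : (val p).comp green = 0 := ext_mono fun i => by
    rw [ContinuousLinearMap.comp_apply, green_mono, map_smul, map_sub, map_smul, map_smul,
      val_mono h4, val_mono h4, monoFun_add_one_one, hp, monoFun_of_eq_one hp i]
    simp [Complex.real_smul]
  exact congrArg (fun f => f a) this

/-- The angular derivative. -/
noncomputable def dth (p : ℝ × ℝ) : Coef →L[ℝ] ℂ := fderiv ℝ val p (-p.2, p.1)

theorem dth_apply (hp : p.1 ^ 2 + p.2 ^ 2 < 4) (a : Coef) :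
    dth p a = fderiv ℝ (fun q => val q a) p (-p.2, p.1) :=
  (fderiv_val_apply hp a _).symm

theorem dth_mono (hp : p.1 ^ 2 + p.2 ^ 2 < 4) (i : ℕ × ℕ) :
    dth p (mono i) = Complex.I * (i.1 - i.2) * monoFun i p := by
  rw [dth_apply hp, (val_mono_eventuallyEq hp i).fderiv_eq, fderiv_monoFun_apply]
  have h1 : toC (-p.2, p.1) = Complex.I * toC p := by
    simp only [toC_apply]; push_cast; linear_combination (-(p.2 : ℂ)) * Complex.I_sq
  have h2 : toCbar (-p.2, p.1) = -(Complex.I * toCbar p) := by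
    simp only [toCbar_apply]; push_cast; linear_combination (-(p.2 : ℂ)) * Complex.I_sq
  rw [h1, h2]
  rcases i with ⟨j, k⟩
  rcases j with _ | j <;> rcases k with _ | k <;> simp [monoFun, pow_succ] <;> ring

theorem analyticAt_dth (hp : p.1 ^ 2 + p.2 ^ 2 < 4) : AnalyticAt ℝ dth p :=
  ((ContinuousLinearMap.id ℝ ((ℝ × ℝ) →L[ℝ] (Coef →L[ℝ] ℂ))).analyticAt_bilinear _).comp₂
    (analyticAt_val hp).fderiv (analyticAt_snd.neg.prod analyticAt_fst)

theorem analyticAt_dth_apply (hp : p.1 ^ 2 + p.2 ^ 2 < 4) (a : Coef) :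
    AnalyticAt ℝ (fun q => dth q a) p :=
  ((ContinuousLinearMap.apply ℝ ℂ a).analyticAt _).comp (analyticAt_dth hp)

theorem lapF_dth_apply (hp : p.1 ^ 2 + p.2 ^ 2 < 4) (a : Coef) :
    lapF (fun q => dth q a) p = lapF dth p a :=
  lapF_clm_comp (analyticAt_dth hp) (ContinuousLinearMap.apply ℝ ℂ a)

theorem lapF_dth_mono (hp : p.1 ^ 2 + p.2 ^ 2 < 4) (i : ℕ × ℕ) :
    lapF dth p (mono i) = Complex.I * (i.1 - i.2) * lapF val p (mono i) := by
  have e : (fun q => dth q (mono i)) =ᶠ[nhds p]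
      fun q => (Complex.I * (i.1 - i.2)) • monoFun i q := by
    filter_upwards [eventually_lt_four hp] with q hq using dth_mono hq i
  have ha : AnalyticAt ℝ (monoFun i) p :=
    (analyticAt_val_apply hp (mono i)).congr (val_mono_eventuallyEq hp i)
  have hl := lapF_clm_comp ha ((Complex.I * (i.1 - i.2) : ℂ) • ContinuousLinearMap.id ℝ ℂ)
  simp only [smul_apply, ContinuousLinearMap.id_apply] at hl
  rw [← lapF_dth_apply hp, lapF_congr e, hl, lapF_monoFun, lapF_val_mono hp, smul_eq_mul]

theorem green_weight (l₁ l₂ : Coef →L[ℝ] ℂ)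
    (h : ∀ i : ℕ × ℕ, l₁ (mono i) = Complex.I * (i.1 - i.2) * l₂ (mono i)) (i : ℕ × ℕ) :
    l₁ (green (mono i)) = Complex.I * (i.1 - i.2) * l₂ (green (mono i)) := by
  have h1 : ((i.1 - i.2 : ℕ) : ℂ) - ((i.2 - i.1 : ℕ) : ℂ) = i.1 - i.2 := by
    rcases le_total i.1 i.2 with h | h
    · simp [Nat.sub_eq_zero_of_le h, Nat.cast_sub h]
    · simp [Nat.sub_eq_zero_of_le h, Nat.cast_sub h]
  rw [green_mono]
  simp only [map_smul, map_sub, h, Complex.real_smul, h1, Prod.fst_add, Prod.snd_add]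
  push_cast
  ring

theorem lapF_dth_green (hp : p.1 ^ 2 + p.2 ^ 2 < 4) (a : Coef) :
    lapF dth p (green a) = -dth p a := by
  have : (lapF dth p).comp green = -dth p := ext_mono fun i => by
    rw [ContinuousLinearMap.comp_apply, green_weight _ _ (lapF_dth_mono hp), lapF_val_green hp,
      neg_apply, dth_mono hp, val_mono hp.le]
    ring
  exact congrArg (fun f => f a) this

theorem dth_green_of_eq_one (hp : p.1 ^ 2 + p.2 ^ 2 = 1) (a : Coef) : dth p (green a) = 0 := by
  have h4 : p.1 ^ 2 + p.2 ^ 2 < 4 := by linarith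
  have : (dth p).comp green = 0 := ext_mono fun i => by
    rw [ContinuousLinearMap.comp_apply,
      green_weight (dth p) (val p) (fun i => by rw [dth_mono h4, val_mono h4.le]),
      val_green_of_eq_one hp]
    simp
  exact congrArg (fun f => f a) this

theorem dth_mul (hp : p.1 ^ 2 + p.2 ^ 2 < 4) (a b : Coef) :
    dth p (a * b) = dth p a * val p b + val p a * dth p b := by
  have e : (fun q => val q (a * b)) =ᶠ[nhds p] fun q => val q a * val q b := by
    filter_upwards [eventually_lt_four hp] with q hq using val_mul hq.le a b
  have h1 := (analyticAt_val_apply hp a).differentiableAt.hasFDerivAt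
  have h2 := (analyticAt_val_apply hp b).differentiableAt.hasFDerivAt
  rw [dth_apply hp, e.fderiv_eq]
  have := (h1.mul h2).fderiv
  simp only [Pi.mul_def] at this
  rw [this, dth_apply hp, dth_apply hp]
  simp
  ring

theorem dth_rad (hp : p.1 ^ 2 + p.2 ^ 2 < 4) (a : Coef) : dth p (rad a) = 0 := by
  have : (dth p).comp rad = 0 := ext_mono fun i => by
    rcases i with ⟨j, k⟩
    by_cases h : j = k <;> simp [h, dth_mono hp]
  exact congrArg (fun f => f a) this

theorem dth_swap (hp : p.1 ^ 2 + p.2 ^ 2 < 4) (a : Coef) :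
    dth p (swap a) = (starRingEnd ℂ) (dth p a) := by
  have : (dth p).comp swap = (Complex.conjCLE : ℂ →L[ℝ] ℂ).comp (dth p) := ext_mono fun i => by
    have := val_swap hp.le (mono i)
    simp only [swap_mono, val_mono hp.le] at this
    simp [dth_mono hp, this]
    ring
  exact congrArg (fun f => f a) this

end Coef

namespace Coef

open scoped Classical in
/-- The coefficient of the `m`-th power of the complex coordinate, as a function of the squared
radius. -/
noncomputable def row (m : ℕ) (s : ℝ) : Coef →L[ℝ] ℝ :=
  lift (fun i => if |s| ≤ 4 ∧ i.1 = i.2 + m then (s / 4) ^ i.2 / 2 ^ m else 0) 1 fun i => by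
    split_ifs with h
    · rw [norm_div, norm_pow, norm_pow, Real.norm_eq_abs, Real.norm_eq_abs, abs_div]
      have h1 : |s| / |4| ≤ 1 := by rw [abs_of_pos (by norm_num : (0:ℝ) < 4)]; linarith [h.1]
      have h2 : (1 : ℝ) ≤ |2| ^ m := by
        rw [abs_of_pos (by norm_num : (0:ℝ) < 2)]; exact one_le_pow₀ (by norm_num)
      rw [div_le_one (by positivity)]
      exact (pow_le_one₀ (by positivity) h1).trans h2
    · simp

theorem row_mono {m : ℕ} {s : ℝ} (hs : |s| ≤ 4) (i : ℕ × ℕ) :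
    row m s (mono i) = if i.1 = i.2 + m then (s / 4) ^ i.2 / 2 ^ m else 0 := by
  rw [row, lift_mono]; simp [hs]

/-- Division by the product of the variables, of the monomials where this is possible. -/
noncomputable def shiftRad : Coef →L[ℝ] Coef :=
  lift (fun i => if i.1 = 0 ∨ i.2 = 0 then 0 else mono (i.1 - 1, i.2 - 1)) 1 fun i => by
    split_ifs <;> simp [norm_mono]

@[simp] theorem shiftRad_mono (i : ℕ × ℕ) :
    shiftRad (mono i) = if i.1 = 0 ∨ i.2 = 0 then 0 else mono (i.1 - 1, i.2 - 1) := lift_mono ..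

theorem norm_shiftRad_le : ‖shiftRad‖ ≤ 1 := norm_le_of_mono zero_le_one fun i => by
  rw [shiftRad_mono]; split_ifs <;> simp [norm_mono]

theorem row_eq {m : ℕ} {s : ℝ} (hs : |s| ≤ 4) (a : Coef) :
    row m s a = coeff (m, 0) a / 2 ^ m + s / 4 * row m s (shiftRad a) := by
  have : row m s = (1 / 2 ^ m : ℝ) • coeff (m, 0) + (s / 4) • (row m s).comp shiftRad :=
    ext_mono fun i => by
      rcases i with ⟨j, k⟩
      simp only [add_apply, smul_apply, ContinuousLinearMap.comp_apply, shiftRad_mono, coeff_mono,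
        row_mono hs, smul_eq_mul, Prod.mk.injEq]
      rcases k with _ | k
      · by_cases h : m = j
        · simp [h]
        · simp [h, Ne.symm h]
      · rcases j with _ | j
        · simp; omega
        · simp only [show (j + 1 = k + 1 + m) ↔ (j = k + m) by omega, Nat.add_one_ne_zero, or_self,
            if_false, and_false, mul_zero, zero_add, row_mono hs, Nat.add_sub_cancel,
            eq_comm (a := 0) (b := k + 1)]
          split_ifs
          · rw [pow_succ]; ring
          · simp
  have h := congrArg (fun f => f a) this
  simp only [add_apply, smul_apply, ContinuousLinearMap.comp_apply, smul_eq_mul] at h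
  rw [h]; ring

theorem analyticAt_row (m : ℕ) {s : ℝ} (hs : |s| < 4) : AnalyticAt ℝ (row m) s := by
  have hev : ∀ᶠ q : ℝ in nhds s, |q| < 4 := by
    refine ContinuousAt.eventually_lt ?_ continuousAt_const hs
    fun_prop
  refine analyticAt_of_resolvent
    (L := fun q => q • ((1 / 4 : ℝ) • (ContinuousLinearMap.compL ℝ Coef Coef ℝ).flip shiftRad))
    (x := fun _ => (1 / 2 ^ m : ℝ) • coeff (m, 0))
    (ContinuousLinearMap.analyticAt ((ContinuousLinearMap.id ℝ ℝ).smulRight _) s)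
    analyticAt_const ?_
  filter_upwards [hev] with q hq
  constructor
  · refine lt_of_le_of_lt (ContinuousLinearMap.opNorm_le_bound _ (M := |q| / 4)
      (by positivity) fun f => ?_) (by linarith)
    simp only [smul_apply, ContinuousLinearMap.flip_apply, ContinuousLinearMap.compL_apply,
      smul_smul]
    rw [norm_smul]
    have h1 := f.opNorm_comp_le shiftRad
    have h2 : ‖f‖ * ‖shiftRad‖ ≤ ‖f‖ := by
      simpa using mul_le_mul_of_nonneg_left norm_shiftRad_le (norm_nonneg f)
    rw [Real.norm_eq_abs, abs_mul, abs_of_pos (by norm_num : (0:ℝ) < 1/4)]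
    nlinarith [abs_nonneg q, h1.trans h2]
  · ext a
    have := row_eq (m := m) hq.le a
    simp only [sub_apply, smul_apply, ContinuousLinearMap.flip_apply,
      ContinuousLinearMap.compL_apply, ContinuousLinearMap.comp_apply, smul_eq_mul]
    rw [this]; ring

/-- The derivative of `row m`. -/
noncomputable def rowD (m : ℕ) (s : ℝ) : Coef →L[ℝ] ℝ := deriv (row m) s

/-- The second derivative of `row m`. -/
noncomputable def rowDD (m : ℕ) (s : ℝ) : Coef →L[ℝ] ℝ := deriv (rowD m) s

theorem hasDerivAt_row (m : ℕ) {s : ℝ} (hs : |s| < 4) (a : Coef) :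
    HasDerivAt (fun t => row m t a) (rowD m s a) s := by
  have h := (analyticAt_row m hs).differentiableAt.hasDerivAt
  exact (ContinuousLinearMap.apply ℝ ℝ a).hasFDerivAt.comp_hasDerivAt s h

theorem hasDerivAt_rowD (m : ℕ) {s : ℝ} (hs : |s| < 4) (a : Coef) :
    HasDerivAt (fun t => rowD m t a) (rowDD m s a) s := by
  have h := (analyticAt_row m hs).deriv.differentiableAt.hasDerivAt
  exact (ContinuousLinearMap.apply ℝ ℝ a).hasFDerivAt.comp_hasDerivAt s h

theorem eventually_abs_lt_four {s : ℝ} (hs : |s| < 4) : ∀ᶠ q : ℝ in nhds s, |q| < 4 := by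
  refine ContinuousAt.eventually_lt ?_ continuousAt_const hs
  fun_prop

theorem rowD_mono {m : ℕ} {s : ℝ} (hs : |s| < 4) (i : ℕ × ℕ) :
    rowD m s (mono i) =
      if i.1 = i.2 + m then i.2 / 4 * (s / 4) ^ (i.2 - 1) / 2 ^ m else 0 := by
  refine (hasDerivAt_row m hs (mono i)).unique ?_
  have e : (fun t => row m t (mono i)) =ᶠ[nhds s]
      fun t => if i.1 = i.2 + m then (t / 4) ^ i.2 / 2 ^ m else 0 := by
    filter_upwards [eventually_abs_lt_four hs] with q hq using row_mono hq.le i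
  refine HasDerivAt.congr_of_eventuallyEq ?_ e
  split_ifs
  · have := (((hasDerivAt_id s).div_const 4).pow i.2).div_const (2 ^ m)
    refine this.congr_deriv ?_
    simp; ring
  · exact hasDerivAt_const s 0

theorem rowDD_mono {m : ℕ} {s : ℝ} (hs : |s| < 4) (i : ℕ × ℕ) :
    rowDD m s (mono i) = if i.1 = i.2 + m then
      i.2 / 4 * ((i.2 - 1 : ℕ) / 4 * (s / 4) ^ (i.2 - 1 - 1)) / 2 ^ m else 0 := by
  refine (hasDerivAt_rowD m hs (mono i)).unique ?_
  have e : (fun t => rowD m t (mono i)) =ᶠ[nhds s]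
      fun t => if i.1 = i.2 + m then i.2 / 4 * (t / 4) ^ (i.2 - 1) / 2 ^ m else 0 := by
    filter_upwards [eventually_abs_lt_four hs] with q hq using rowD_mono hq i
  refine HasDerivAt.congr_of_eventuallyEq ?_ e
  split_ifs
  · have := ((((hasDerivAt_id s).div_const 4).pow (i.2 - 1)).const_mul (i.2 / 4 : ℝ)).div_const
      (2 ^ m)
    refine this.congr_deriv ?_
    simp only [id]; ring
  · exact hasDerivAt_const s 0

theorem row_green_ode (m : ℕ) {s : ℝ} (hs : |s| < 4) (a : Coef) :
    -4 * (s * rowDD m s (green a) + (m + 1) * rowD m s (green a)) = row m s a := by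
  have : ((-4 * s) • rowDD m s + (-4 * (m + 1) : ℝ) • rowD m s).comp green = row m s :=
    ext_mono fun i => by
      rcases i with ⟨j, k⟩
      simp only [ContinuousLinearMap.comp_apply, add_apply, smul_apply, green_mono, map_smul,
        map_sub, rowDD_mono hs, rowD_mono hs, row_mono hs.le, smul_eq_mul, Prod.mk_add_mk]
      by_cases h : j = k + m
      · have h1 : k - j = 0 := by omega
        subst h
        have h2 : (k + m : ℝ) + 1 ≠ 0 := by positivity
        have h3 : (k : ℝ) + 1 ≠ 0 := by positivity
        simp only [h1, show k + m + 1 = k + 1 + m by omega, if_true, Nat.add_sub_cancel]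
        push_cast
        rcases k with _ | k
        · simp
          field_simp
        · simp only [Nat.add_sub_cancel, pow_succ]
          push_cast at h2 h3 ⊢
          simp only [zero_div, zero_mul, ite_self, mul_zero]
          field_simp
          ring
      · have h1 : ¬ (j - k = k - j + m) ∨ k - j = 0 := by omega
        have h2 : ¬ (j + 1 = k + 1 + m) := by omega
        rcases h1 with h1 | h1
        · simp [h, h1, h2]
        · simp [h, h1, h2]
  have h := congrArg (fun f => f a) this
  simp only [add_apply, smul_apply, ContinuousLinearMap.comp_apply, smul_eq_mul] at h
  rw [← h]; ring

theorem row_one_green (m : ℕ) (a : Coef) : row m 1 (green a) = 0 := by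
  have h1 : |(1:ℝ)| ≤ 4 := by norm_num
  have : (row m 1).comp green = 0 := ext_mono fun i => by
    rcases i with ⟨j, k⟩
    simp only [ContinuousLinearMap.comp_apply, green_mono, map_smul,
        map_sub, row_mono h1, smul_eq_mul, Prod.mk_add_mk]
    by_cases h : j = k + m
    · subst h
      simp [show k + m + 1 = k + 1 + m by omega, show k - (k + m) = 0 by omega, pow_succ]
      right
      ring
    · have h1 : ¬ (j - k = k - j + m) := by omega
      have h2 : ¬ (j + 1 = k + 1 + m) := by omega
      simp [h1, h2]
  exact congrArg (fun f => f a) this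

theorem row_rad_mul (m : ℕ) {s : ℝ} (hs : |s| ≤ 4) (a b : Coef) :
    row m s (rad a * b) = row 0 s (rad a) * row m s b := by
  refine ext_mono₂ (f := (ContinuousLinearMap.compL ℝ Coef Coef ℝ (row m s)).comp
      (mulBilin.comp rad))
    (g := (ContinuousLinearMap.mul ℝ ℝ).bilinearComp ((row 0 s).comp rad) (row m s)) ?_ a b
  rintro ⟨j, k⟩ ⟨j', k'⟩
  by_cases h : j = k
  · subst h
    by_cases h' : j' = k' + m
    · subst h'
      simp [mulBilin_mono, row_mono hs, show j + (k' + m) = j + k' + m by omega, pow_add]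
      ring
    · simp [mulBilin_mono, row_mono hs, h', show ¬ (j + j' = j + k' + m) by omega]
  · simp [h]

theorem row_rad_of_ne {m : ℕ} (hm : m ≠ 0) (s : ℝ) (a : Coef) : row m s (rad a) = 0 := by
  have : (row m s).comp rad = 0 := ext_mono fun i => by
    rcases i with ⟨j, k⟩
    by_cases h : j = k <;> simp [h, row, hm]
  exact congrArg (fun f => f a) this

theorem val_rad {p : ℝ × ℝ} (hp : p.1 ^ 2 + p.2 ^ 2 ≤ 4) (a : Coef) :
    val p (rad a) = row 0 (p.1 ^ 2 + p.2 ^ 2) a := by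
  have hs : |p.1 ^ 2 + p.2 ^ 2| ≤ 4 := by rwa [abs_of_nonneg (by positivity)]
  have : (val p).comp rad = Complex.ofRealCLM.comp (row 0 (p.1 ^ 2 + p.2 ^ 2)) :=
    ext_mono fun i => by
      rcases i with ⟨j, k⟩
      by_cases h : j = k
      · subst h
        have := toC_mul_toCbar p
        simp only [ContinuousLinearMap.comp_apply, rad_mono, if_true, val_mono hp, monoFun,
          row_mono hs, ← mul_pow, Complex.ofRealCLM_apply, add_zero, pow_zero, div_one]
        rw [div_mul_div_comm, this]
        push_cast; norm_num
      · simp [h, row_mono hs]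
  exact congrArg (fun f => f a) this

theorem coeff_shiftRad (i : ℕ × ℕ) (a : Coef) :
    coeff i (shiftRad a) = coeff (i + (1, 1)) a := by
  have : (coeff i).comp shiftRad = coeff (i + (1, 1)) := ext_mono fun j => by
    rcases i with ⟨i, i'⟩
    rcases j with ⟨j, j'⟩
    rcases j with _ | j <;> rcases j' with _ | j' <;>
      simp [coeff_mono]
  exact congrArg (fun f => f a) this

theorem coeff_eq_zero_of_row {m : ℕ} (k : ℕ) {a : Coef}
    (h : ∀ s ∈ Set.Icc (0 : ℝ) 1, row m s a = 0) : coeff (k + m, k) a = 0 := by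
  induction k generalizing a with
  | zero =>
    have := row_eq (m := m) (s := 0) (by norm_num) a
    rw [h 0 (by simp)] at this
    simpa using this.symm
  | succ k ih =>
    have h0 : coeff (m, 0) a = 0 := by
      have := row_eq (m := m) (s := 0) (by norm_num) a
      rw [h 0 (by simp)] at this
      simpa using this.symm
    have h1 : ∀ s ∈ Set.Ioc (0 : ℝ) 1, row m s (shiftRad a) = 0 := by
      intro s hs
      have := row_eq (m := m) (s := s) (by rw [abs_of_pos hs.1]; linarith [hs.2]) a
      rw [h s ⟨hs.1.le, hs.2⟩, h0] at this
      have hs0 := hs.1.ne'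
      simpa [hs0] using this
    have h2 : ∀ s ∈ Set.Icc (0 : ℝ) 1, row m s (shiftRad a) = 0 := by
      intro s hs
      rcases eq_or_lt_of_le hs.1 with h3 | h3
      · subst h3
        have hc := (hasDerivAt_row m (s := 0) (by norm_num) (shiftRad a)).continuousAt
        have hc' := hc.tendsto.mono_left (nhdsWithin_le_nhds (s := Set.Ioi 0))
        refine tendsto_nhds_unique (hc'.congr' ?_) tendsto_const_nhds
        filter_upwards [Ioc_mem_nhdsGT (zero_lt_one' ℝ)] with t ht using h1 t ht
      · exact h1 s ⟨h3, hs.2⟩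
    have := ih h2
    rw [coeff_shiftRad] at this
    rw [← this]; congr 2; ext <;> simp; omega

theorem coeff_swap (i : ℕ × ℕ) (a : Coef) : coeff i.swap (swap a) = coeff i a := by
  have : (coeff i.swap).comp swap = coeff i := ext_mono fun j => by
    simp [coeff_mono]
  exact congrArg (fun f => f a) this

theorem eq_zero_of_row {a : Coef} (ha : swap a = a)
    (h : ∀ m, ∀ s ∈ Set.Icc (0 : ℝ) 1, row m s a = 0) : a = 0 := by
  have key : ∀ i : ℕ × ℕ, i.2 ≤ i.1 → coeff i a = 0 := by
    rintro ⟨j, k⟩ hi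
    have := coeff_eq_zero_of_row k (h (j - k))
    rwa [show k + (j - k) = j by simp at hi; omega] at this
  refine ext_coeff fun i => ?_
  rw [map_zero]
  rcases le_total i.2 i.1 with hi | hi
  · exact key i hi
  · have := coeff_swap i.swap a
    rw [ha, Prod.swap_swap] at this
    rw [this]
    exact key i.swap hi

end Coef

open Polynomial in
/-- The real polynomial with given integer coefficients. -/
noncomputable def IntPoly.toPoly : List ℤ → ℝ[X]
  | [] => 0
  | c :: t => C (c : ℝ) + X * toPoly t

@[simp] theorem IntPoly.eval_toPoly (p : List ℤ) (s : ℝ) : (toPoly p).eval s = ev p s := by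
  induction p with
  | nil => simp [toPoly]
  | cons c t ih => simp [toPoly, ih]

namespace Coef

open Polynomial

/-- Power series in the squared radius. -/
def IsRad (a : Coef) : Prop := rad a = a

theorem isRad_zero : IsRad 0 := map_zero rad

theorem isRad_one : IsRad 1 := by simp [IsRad, one_def]

theorem IsRad.add {a b : Coef} (ha : IsRad a) (hb : IsRad b) : IsRad (a + b) := by
  rw [IsRad, map_add, ha, hb]

theorem IsRad.sub {a b : Coef} (ha : IsRad a) (hb : IsRad b) : IsRad (a - b) := by
  rw [IsRad, map_sub, ha, hb]

theorem IsRad.smul {a : Coef} (ha : IsRad a) (c : ℝ) : IsRad (c • a) := by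
  rw [IsRad, map_smul, ha]

theorem IsRad.mul {a b : Coef} (ha : IsRad a) (hb : IsRad b) : IsRad (a * b) := by
  rw [IsRad, ← ha, ← hb, rad_rad_mul_rad]

theorem IsRad.pow {a : Coef} (ha : IsRad a) (n : ℕ) : IsRad (a ^ n) := by
  induction n with
  | zero => rw [pow_zero]; exact isRad_one
  | succ n ih => rw [pow_succ]; exact ih.mul ha

theorem isClosed_isRad : IsClosed {a | IsRad a} := isClosed_eq rad.continuous continuous_id

theorem IsRad.exp {a : Coef} (ha : IsRad a) : IsRad (NormedSpace.exp a) := by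
  refine isClosed_isRad.mem_of_tendsto
    (NormedSpace.exp_series_hasSum_exp' (𝕂 := ℝ) a) (Filter.Eventually.of_forall fun n => ?_)
  simp only [Set.mem_ofPred_eq]
  induction n using Finset.induction_on with
  | empty => simpa using isRad_zero
  | insert i s hi ih =>
    rw [Finset.sum_insert hi]
    exact ((ha.pow i).smul _).add ih

theorem IsRad.swap {a : Coef} (ha : IsRad a) : swap a = a := by
  have := swap_rad a
  rwa [ha] at this

theorem IsRad.flip {a : Coef} (ha : IsRad a) : flip a = a := by
  have := flip_rad a
  rwa [ha] at this

theorem IsRad.row_mul {a : Coef} (ha : IsRad a) (m : ℕ) {s : ℝ} (hs : |s| ≤ 4) (b : Coef) :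
    row m s (a * b) = row 0 s a * row m s b := by
  have := row_rad_mul m hs a b
  rwa [ha] at this

theorem IsRad.row_of_ne {a : Coef} (ha : IsRad a) {m : ℕ} (hm : m ≠ 0) (s : ℝ) :
    row m s a = 0 := by
  have := row_rad_of_ne hm s a
  rwa [ha] at this

theorem IsRad.val {a : Coef} (ha : IsRad a) {p : ℝ × ℝ} (hp : p.1 ^ 2 + p.2 ^ 2 ≤ 4) :
    val p a = row 0 (p.1 ^ 2 + p.2 ^ 2) a := by
  have := val_rad hp a
  rwa [ha] at this

theorem IsRad.dth {a : Coef} (ha : IsRad a) {p : ℝ × ℝ} (hp : p.1 ^ 2 + p.2 ^ 2 < 4) :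
    dth p a = 0 := by
  have := dth_rad hp a
  rwa [ha] at this

theorem row_zero_one {s : ℝ} (hs : |s| ≤ 4) : row 0 s 1 = 1 := by simp [one_def, row_mono hs]

theorem IsRad.row_pow {a : Coef} (ha : IsRad a) {s : ℝ} (hs : |s| ≤ 4) (n : ℕ) :
    row 0 s (a ^ n) = row 0 s a ^ n := by
  induction n with
  | zero => rw [pow_zero, pow_zero, row_zero_one hs]
  | succ n ih => rw [pow_succ', pow_succ', ha.row_mul 0 hs, ih]

theorem IsRad.row_exp {a : Coef} (ha : IsRad a) {s : ℝ} (hs : |s| ≤ 4) :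
    row 0 s (NormedSpace.exp a) = Real.exp (row 0 s a) := by
  have h1 := (NormedSpace.exp_series_hasSum_exp' (𝕂 := ℝ) a).mapL (row 0 s)
  have h2 := NormedSpace.exp_series_hasSum_exp' (𝕂 := ℝ) (row 0 s a)
  rw [← Real.exp_eq_exp_ℝ] at h2
  refine h1.unique ?_
  simpa [ha.row_pow hs] using h2

theorem IsRad.eq_zero {a : Coef} (ha : IsRad a) (h : ∀ s ∈ Set.Icc (0 : ℝ) 1, row 0 s a = 0) :
    a = 0 :=
  eq_zero_of_row ha.swap fun m s hs => by
    rcases eq_or_ne m 0 with rfl | hm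
    · exact h s hs
    · exact ha.row_of_ne hm s

/-- The square of the radius. -/
noncomputable def sqRad : Coef := (4 : ℝ) • mono (1, 1)

theorem isRad_sqRad : IsRad sqRad := by simp [IsRad, sqRad]

theorem row_sqRad {s : ℝ} (hs : |s| ≤ 4) : row 0 s sqRad = s := by
  simp [sqRad, row_mono hs]; ring

/-- A polynomial in the square of the radius. -/
noncomputable def ofPoly (p : ℝ[X]) : Coef := aeval sqRad p

theorem isRad_ofPoly (p : ℝ[X]) : IsRad (ofPoly p) := by
  induction p using Polynomial.induction_on' with
  | add p q hp hq => rw [ofPoly, map_add]; exact hp.add hq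
  | monomial n c =>
    rw [ofPoly, aeval_monomial, ← Algebra.smul_def]
    exact (isRad_sqRad.pow n).smul c

theorem row_ofPoly {s : ℝ} (hs : |s| ≤ 4) (p : ℝ[X]) : row 0 s (ofPoly p) = p.eval s := by
  induction p using Polynomial.induction_on' with
  | add p q hp hq =>
    rw [ofPoly, map_add, map_add, eval_add, ← hp, ← hq]; rfl
  | monomial n c =>
    rw [ofPoly, aeval_monomial, ← Algebra.smul_def, map_smul, isRad_sqRad.row_pow hs,
      row_sqRad hs, eval_monomial, smul_eq_mul]

theorem val_ofPoly {p : ℝ × ℝ} (hp : p.1 ^ 2 + p.2 ^ 2 ≤ 4) (P : ℝ[X]) :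
    val p (ofPoly P) = P.eval (p.1 ^ 2 + p.2 ^ 2) := by
  rw [(isRad_ofPoly P).val hp, row_ofPoly (by rwa [abs_of_nonneg (by positivity)])]

theorem IsRad.exists_ofPoly {a : Coef} (ha : IsRad a) {ε : ℝ} (hε : 0 < ε) :
    ∃ P : ℝ[X], ‖ofPoly P - a‖ < ε := by
  have h1 := (hasSum_mono a).mapL rad
  rw [ha] at h1
  have h2 := h1.eventually (Metric.ball_mem_nhds a hε)
  obtain ⟨F, hF⟩ := h2.exists
  have key : ∀ F : Finset (ℕ × ℕ), ∃ P : ℝ[X], ofPoly P = ∑ i ∈ F, rad (coeff i a • mono i) := by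
    intro F
    induction F using Finset.induction_on with
    | empty => exact ⟨0, by simp [ofPoly]⟩
    | insert i s hi ih =>
      obtain ⟨P, hP⟩ := ih
      rcases i with ⟨j, k⟩
      by_cases h : j = k
      · subst h
        refine ⟨monomial j (coeff (j, j) a / 4 ^ j) + P, ?_⟩
        have hm : ∀ n : ℕ, mono (1, 1) ^ n = mono (n, n) := fun n => by
          induction n with
          | zero => rfl
          | succ n ih => rw [pow_succ, ih, mono_mul_mono]; rfl
        rw [Finset.sum_insert hi, ← hP, ofPoly, map_add, aeval_monomial, ← Algebra.smul_def,
          sqRad, _root_.smul_pow, hm, smul_smul, div_mul_cancel₀ _ (by positivity)]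
        simp [ofPoly, sqRad]
      · exact ⟨P, by rw [Finset.sum_insert hi, hP]; simp [h]⟩
  obtain ⟨P, hP⟩ := key F
  refine ⟨P, ?_⟩
  rw [hP]
  simpa [dist_eq_norm] using hF

/-- The solution operator, on power series in `s`, of `-4 (s f'' + 2 f') = g`, `f 0 = 0`. -/
noncomputable def volt : Coef →L[ℝ] Coef :=
  lift (fun i => if i.1 = i.2 then
    (-1 / ((i.1 + 1) * (i.1 + 2)) : ℝ) • mono (i + (1, 1)) else 0) 1 fun i => by
    split_ifs
    · rw [norm_smul, norm_mono, mul_one, Real.norm_eq_abs, abs_div, abs_neg, abs_one,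
        abs_of_nonneg (by positivity), div_le_one (by positivity)]
      nlinarith [(Nat.cast_nonneg i.1 : (0 : ℝ) ≤ i.1)]
    · simp

theorem volt_mono (i : ℕ × ℕ) : volt (mono i) = if i.1 = i.2 then
    (-1 / ((i.1 + 1) * (i.1 + 2)) : ℝ) • mono (i + (1, 1)) else 0 := lift_mono ..

theorem isRad_volt (a : Coef) : IsRad (volt a) := by
  have : rad.comp volt = volt := ext_mono fun i => by
    rcases i with ⟨j, k⟩
    by_cases h : j = k <;> simp [h, volt_mono]
  exact congrArg (fun f => f a) this

theorem isCompactOperator_volt : IsCompactOperator volt := by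
  refine isCompactOperator_of_norm_mono_le volt 1 fun i => ?_
  rw [volt_mono]
  split_ifs with h
  · rw [norm_smul, norm_mono, mul_one, Real.norm_eq_abs, abs_div, abs_neg, abs_one,
      abs_of_nonneg (by positivity), one_mul, ← h]
    gcongr
    nlinarith [(Nat.cast_nonneg i.1 : (0 : ℝ) ≤ i.1)]
  · rw [norm_zero]; positivity

theorem row_volt_ode {s : ℝ} (hs : |s| < 4) (a : Coef) :
    -4 * (s * rowDD 0 s (volt a) + 2 * rowD 0 s (volt a)) = row 0 s a := by
  have : ((-4 * s) • rowDD 0 s + (-4 * 2 : ℝ) • rowD 0 s).comp volt = row 0 s :=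
    ext_mono fun i => by
      rcases i with ⟨j, k⟩
      by_cases h : j = k
      · subst h
        simp only [ContinuousLinearMap.comp_apply, add_apply, smul_apply, volt_mono, map_smul,
          rowDD_mono hs, rowD_mono hs, row_mono hs.le, smul_eq_mul, Prod.mk_add_mk, if_true,
          add_zero, Nat.add_sub_cancel, pow_zero, div_one]
        have h2 : (j : ℝ) + 1 ≠ 0 := by positivity
        have h3 : (j : ℝ) + 2 ≠ 0 := by positivity
        push_cast
        rcases j with _ | j
        · simp
          norm_num
        · simp only [Nat.add_sub_cancel, pow_succ]
          push_cast at h2 h3 ⊢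
          field_simp
          ring
      · simp [h, volt_mono, row_mono hs.le]
  have h := congrArg (fun f => f a) this
  simp only [add_apply, smul_apply, ContinuousLinearMap.comp_apply, smul_eq_mul] at h
  rw [← h]; ring

theorem row_zero_volt (a : Coef) : row 0 0 (volt a) = 0 := by
  have : (row 0 0).comp volt = 0 := ext_mono fun i => by
    by_cases h : i.1 = i.2 <;> simp [h, volt_mono, row_mono]
  exact congrArg (fun f => f a) this

/-- The action of `volt` on multiples of a power of the squared radius. -/
noncomputable def voltShift (N : ℕ) : Coef →L[ℝ] Coef :=
  lift (fun i => if i.1 = i.2 then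
    (-1 / ((i.1 + N + 1) * (i.1 + N + 2)) : ℝ) • mono i else 0) 1 fun i => by
    split_ifs
    · rw [norm_smul, norm_mono, mul_one, Real.norm_eq_abs, abs_div, abs_neg, abs_one,
        abs_of_nonneg (by positivity), div_le_one (by positivity)]
      nlinarith [(Nat.cast_nonneg i.1 : (0 : ℝ) ≤ i.1), (Nat.cast_nonneg N : (0 : ℝ) ≤ N),
        mul_nonneg (Nat.cast_nonneg i.1 : (0 : ℝ) ≤ i.1) (Nat.cast_nonneg N : (0 : ℝ) ≤ N)]
    · simp

theorem volt_mono_mul (N : ℕ) (a : Coef) :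
    volt (mono (N, N) * a) = mono (N + 1, N + 1) * voltShift N a := by
  have : volt.comp (mulBilin (mono (N, N))) =
      (mulBilin (mono (N + 1, N + 1))).comp (voltShift N) := ext_mono fun i => by
    rcases i with ⟨j, k⟩
    by_cases h : j = k
    · subst h
      simp only [ContinuousLinearMap.comp_apply, mulBilin_mono, volt_mono, voltShift, lift_mono,
        if_true, map_smul, Prod.mk_add_mk]
      push_cast
      rw [add_comm (N : ℝ) j, show N + j + 1 = N + 1 + j by omega]
    · simp [h, mulBilin_mono, volt_mono, voltShift]
  exact congrArg (fun f => f a) this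

theorem coeff_mono_mul {N : ℕ} {i : ℕ × ℕ} (h : i.1 < N) (a : Coef) :
    coeff i (mono (N, N) * a) = 0 := by
  have : (coeff i).comp (mulBilin (mono (N, N))) = 0 := ext_mono fun j => by
    rcases i with ⟨i, i'⟩
    rcases j with ⟨j, j'⟩
    simp only [ContinuousLinearMap.comp_apply, mulBilin_mono, coeff_mono, Prod.mk_add_mk,
      Prod.mk.injEq, zero_apply, ite_eq_right_iff, one_ne_zero, imp_false, not_and]
    intro h'
    simp only at h
    omega
  exact congrArg (fun f => f a) this

/-- The Volterra operator with a given potential. -/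
noncomputable def voltMul (v : Coef) : Coef →L[ℝ] Coef := volt.comp (mulBilin v)

theorem voltMul_apply (v a : Coef) : voltMul v a = volt (v * a) := rfl

theorem eq_zero_of_voltMul_eq {v a : Coef} (h : voltMul v a = a) : a = 0 := by
  have key : ∀ N : ℕ, ∃ c, a = mono (N, N) * c := by
    intro N
    induction N with
    | zero => exact ⟨a, (one_mul a).symm⟩
    | succ N ih =>
      obtain ⟨c, hc⟩ := ih
      refine ⟨voltShift N (v * c), ?_⟩
      rw [← volt_mono_mul, ← h, voltMul_apply]
      congr 1
      rw [hc]; ring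
  refine ext_coeff fun i => ?_
  obtain ⟨c, hc⟩ := key (i.1 + 1)
  rw [hc, coeff_mono_mul (Nat.lt_succ_self _), map_zero]

theorem isUnit_one_sub_voltMul (v : Coef) : IsUnit (1 - voltMul v) := by
  have hc : IsCompactOperator (voltMul v) := isCompactOperator_volt.comp_clm _
  rcases hc.hasEigenvalue_or_mem_resolventSet (one_ne_zero (α := ℝ)) with h | h
  · obtain ⟨x, hx⟩ := h.exists_hasEigenvector
    have h1 : voltMul v x = x := by simpa using hx.apply_eq_smul
    exact absurd (eq_zero_of_voltMul_eq h1) hx.2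
  · have := spectrum.mem_resolventSet_iff.1 h
    simpa using this

end Coef

/-! ### Radial ordinary differential equations -/

section RadialODE

variable {m : ℕ} {f f' f'' g g' g'' : ℝ → ℝ}

theorem hasDerivAt_wronskian {s : ℝ} (hf : HasDerivAt f (f' s) s) (hf' : HasDerivAt f' (f'' s) s)
    (hg : HasDerivAt g (g' s) s) (hg' : HasDerivAt g' (g'' s) s) :
    HasDerivAt (fun s => 4 * s ^ (m + 1) * (f s * g' s - g s * f' s))
      (s ^ m * (f s * (4 * (s * g'' s + (m + 1) * g' s)) -
        g s * (4 * (s * f'' s + (m + 1) * f' s)))) s := by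
  have h1 := ((hasDerivAt_id s).pow (m + 1)).const_mul 4
  have h2 := (hf.mul hg').sub (hg.mul hf')
  refine (h1.mul h2).congr_deriv ?_
  simp
  ring

theorem hasDerivAt_picone {s : ℝ} (hf : HasDerivAt f (f' s) s) (hf' : HasDerivAt f' (f'' s) s)
    (hg : HasDerivAt g (g' s) s) (hg' : HasDerivAt g' (g'' s) s) (h0 : g s ≠ 0) :
    HasDerivAt (fun s => 4 * s ^ (m + 1) * (f s * f' s - g' s / g s * f s ^ 2))
      (s ^ m * (4 * s * (f' s - g' s / g s * f s) ^ 2 +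
        f s * (4 * (s * f'' s + (m + 1) * f' s)) -
        4 * (s * g'' s + (m + 1) * g' s) / g s * f s ^ 2)) s := by
  have h1 := ((hasDerivAt_id s).pow (m + 1)).const_mul 4
  have h2 := (hf.mul hf').sub ((hg'.div hg h0).mul (hf.pow 2))
  refine (h1.mul h2).congr_deriv ?_
  simp
  field_simp
  ring

/-- A solution which vanishes, or has vanishing flux, at both ends of an interval carrying a strict
positive supersolution vanishes identically. -/
theorem eq_zero_of_supersolution {a b : ℝ} (ha : 0 ≤ a) (hab : a < b) {q : ℝ → ℝ}
    (hf : ∀ s ∈ Set.Icc a b, HasDerivAt f (f' s) s)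
    (hf' : ∀ s ∈ Set.Icc a b, HasDerivAt f' (f'' s) s)
    (hg : ∀ s ∈ Set.Icc a b, HasDerivAt g (g' s) s)
    (hg' : ∀ s ∈ Set.Icc a b, HasDerivAt g' (g'' s) s)
    (hpos : ∀ s ∈ Set.Icc a b, 0 < g s)
    (hsup : ∀ s ∈ Set.Icc a b, q s * g s < -4 * (s * g'' s + (m + 1) * g' s))
    (hsol : ∀ s ∈ Set.Icc a b, -4 * (s * f'' s + (m + 1) * f' s) = q s * f s)
    (h1 : a = 0 ∨ f a = 0) (h2 : f b = 0) : ∀ s ∈ Set.Icc a b, f s = 0 := by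
  set E := fun s => 4 * s ^ (m + 1) * (f s * f' s - g' s / g s * f s ^ 2) with hE
  have hd := fun s (hs : s ∈ Set.Icc a b) => hasDerivAt_picone (m := m) (hf s hs) (hf' s hs)
    (hg s hs) (hg' s hs) (hpos s hs).ne'
  have hpos' : ∀ s ∈ Set.Icc a b, s ^ m * ((-4 * (s * g'' s + (m + 1) * g' s) / g s - q s) * f s ^ 2)
      ≤ s ^ m * (4 * s * (f' s - g' s / g s * f s) ^ 2 +
        f s * (4 * (s * f'' s + (m + 1) * f' s)) -
        4 * (s * g'' s + (m + 1) * g' s) / g s * f s ^ 2) := by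
    intro s hs
    have h0 : 0 ≤ s := ha.trans hs.1
    refine mul_le_mul_of_nonneg_left ?_ (pow_nonneg h0 m)
    have e : f s * (4 * (s * f'' s + (m + 1) * f' s)) = - (q s * f s ^ 2) := by
      linear_combination (-f s) * hsol s hs
    rw [e]
    have : 0 ≤ 4 * s * (f' s - g' s / g s * f s) ^ 2 := by positivity
    have e2 : -4 * (s * g'' s + (m + 1) * g' s) / g s =
      -(4 * (s * g'' s + (m + 1) * g' s) / g s) := by ring
    rw [e2]
    nlinarith
  have hq : ∀ s ∈ Set.Icc a b, 0 < -4 * (s * g'' s + (m + 1) * g' s) / g s - q s := by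
    intro s hs
    rw [sub_pos, lt_div_iff₀ (hpos s hs)]
    exact hsup s hs
  have hmono : MonotoneOn E (Set.Icc a b) := by
    refine monotoneOn_of_hasDerivWithinAt_nonneg (convex_Icc a b)
      (fun s hs => (hd s hs).continuousAt.continuousWithinAt)
      (fun s hs => (hd s (interior_subset hs)).hasDerivWithinAt) fun s hs => ?_
    have hs := interior_subset hs
    refine le_trans ?_ (hpos' s hs)
    have h0 : 0 ≤ s := ha.trans hs.1
    have := hq s hs
    positivity
  have hEa : E a = 0 := by
    rcases h1 with h | h
    · simp [hE, h]
    · simp [hE, h]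
  have hEb : E b = 0 := by simp [hE, h2]
  have hE0 : ∀ s ∈ Set.Icc a b, E s = 0 := by
    intro s hs
    have l := hmono ⟨le_rfl, hab.le⟩ hs hs.1
    have u := hmono hs ⟨hab.le, le_rfl⟩ hs.2
    linarith
  have hin : ∀ s ∈ Set.Ioo a b, f s = 0 := by
    intro s hs
    have hs' := Set.Ioo_subset_Icc_self hs
    have e : E =ᶠ[nhds s] fun _ => 0 := by
      filter_upwards [Icc_mem_nhds hs.1 hs.2] with t ht using hE0 t ht
    have hz := (hd s hs').unique ((hasDerivAt_const s (0 : ℝ)).congr_of_eventuallyEq e)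
    have := hpos' s hs'
    rw [hz] at this
    have h3 : 0 < s ^ m := pow_pos (ha.trans_lt hs.1) m
    have h4 := hq s hs'
    by_contra hne
    have : 0 < s ^ m * ((-4 * (s * g'' s + (m + 1) * g' s) / g s - q s) * f s ^ 2) := by positivity
    linarith
  have hcl : Set.Icc a b ⊆ closure (Set.Ioo a b) := by rw [closure_Ioo hab.ne]
  intro s hs
  have : Set.EqOn f (fun _ => 0) (Set.Icc a b) := by
    refine Set.EqOn.of_subset_closure (s := Set.Ioo a b) (fun s hs => hin s hs)
      (fun s hs => (hf s hs).continuousAt.continuousWithinAt) continuousOn_const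
      Set.Ioo_subset_Icc_self hcl
  exact this hs

/-- A solution of the homogeneous equation with vanishing boundary value vanishes. -/
theorem eq_zero_of_homogeneous (hf : ∀ s ∈ Set.Icc (0 : ℝ) 1, HasDerivAt f (f' s) s)
    (hf' : ∀ s ∈ Set.Icc (0 : ℝ) 1, HasDerivAt f' (f'' s) s)
    (hsol : ∀ s ∈ Set.Icc (0 : ℝ) 1, s * f'' s + (m + 1) * f' s = 0) (h1 : f 1 = 0) :
    ∀ s ∈ Set.Icc (0 : ℝ) 1, f s = 0 := by
  refine eq_zero_of_supersolution (m := m) (g := fun s => 2 - s) (g' := fun _ => -1)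
    (g'' := fun _ => 0) (q := fun _ => 0) le_rfl one_pos hf hf' (fun s _ => ?_)
    (fun s _ => hasDerivAt_const s _) (fun s hs => by linarith [hs.2]) (fun s _ => ?_)
    (fun s hs => by rw [hsol s hs]; simp) (Or.inl rfl) h1
  · simpa using (hasDerivAt_id s).const_sub 2
  · have : (0 : ℝ) < m + 1 := by positivity
    linarith

end RadialODE

namespace Coef

theorem abs_lt_four {s : ℝ} (hs : s ∈ Set.Icc (0 : ℝ) 1) : |s| < 4 := by
  rw [abs_of_nonneg hs.1]; linarith [hs.2]

theorem eq_green_of_ode {a b : Coef} (ha : swap a = a) (hb : swap b = b)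
    (h : ∀ m : ℕ, ∀ s ∈ Set.Icc (0 : ℝ) 1,
      -4 * (s * rowDD m s a + (m + 1) * rowD m s a) = row m s b)
    (h1 : ∀ m, row m 1 a = 0) : a = green b := by
  rw [← sub_eq_zero]
  refine eq_zero_of_row (by rw [map_sub, swap_green, ha, hb]) fun m => ?_
  refine eq_zero_of_homogeneous (m := m) (f' := fun s => rowD m s (a - green b))
    (f'' := fun s => rowDD m s (a - green b))
    (fun s hs => hasDerivAt_row m (abs_lt_four hs) _)
    (fun s hs => hasDerivAt_rowD m (abs_lt_four hs) _) (fun s hs => ?_) ?_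
  · have e1 := h m s hs
    have e2 := row_green_ode m (abs_lt_four hs) b
    rw [map_sub, map_sub]
    linarith
  · rw [map_sub, h1, row_one_green, sub_zero]

theorem IsRad.eq_green_of_ode {a b : Coef} (ha : IsRad a) (hb : IsRad b)
    (h : ∀ s ∈ Set.Icc (0 : ℝ) 1, -4 * (s * rowDD 0 s a + rowD 0 s a) = row 0 s b)
    (h1 : row 0 1 a = 0) : a = Coef.green b := by
  have hz : ∀ m : ℕ, m ≠ 0 → ∀ s, |s| < 4 → rowD m s a = 0 := fun m hm s hs => by
    refine (hasDerivAt_row m hs a).unique ?_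
    simp only [ha.row_of_ne hm]
    exact hasDerivAt_const s 0
  refine Coef.eq_green_of_ode ha.swap hb.swap (fun m s hs => ?_) fun m => ?_
  · rcases eq_or_ne m 0 with rfl | hm
    · rw [← h s hs]; simp
    · have h2 : rowDD m s a = 0 := by
        refine (hasDerivAt_rowD m (abs_lt_four hs) a).unique ?_
        refine (hasDerivAt_const s (0 : ℝ)).congr_of_eventuallyEq ?_
        filter_upwards [eventually_abs_lt_four (abs_lt_four hs)] with t ht using hz m hm t ht
      rw [hz m hm s (abs_lt_four hs), h2, hb.row_of_ne hm]; simp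
  · rcases eq_or_ne m 0 with rfl | hm
    · exact h1
    · exact ha.row_of_ne hm 1

end Coef

/-! ### The radial base solution and the first angular mode -/

namespace Coef

open Polynomial IntPoly

theorem rowD_eq {m : ℕ} {a : Coef} {f' : ℝ → ℝ}
    (h : ∀ s : ℝ, |s| < 4 → HasDerivAt (fun t => row m t a) (f' s) s) {s : ℝ} (hs : |s| < 4) :
    rowD m s a = f' s :=
  (hasDerivAt_row m hs a).unique (h s hs)

theorem rowDD_eq {m : ℕ} {a : Coef} {f' f'' : ℝ → ℝ}
    (h : ∀ s : ℝ, |s| < 4 → HasDerivAt (fun t => row m t a) (f' s) s)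
    (h' : ∀ s : ℝ, |s| < 4 → HasDerivAt f' (f'' s) s) {s : ℝ} (hs : |s| < 4) :
    rowDD m s a = f'' s := by
  refine (hasDerivAt_rowD m hs a).unique ((h' s hs).congr_of_eventuallyEq ?_)
  filter_upwards [eventually_abs_lt_four hs] with t ht using rowD_eq h ht

theorem hasDerivAt_row_of_eq {m : ℕ} {a : Coef} {f : ℝ → ℝ} {y s : ℝ} (hs : |s| < 4)
    (h : ∀ s : ℝ, |s| < 4 → row m s a = f s) (hf : HasDerivAt f y s) :
    HasDerivAt (fun t => row m t a) y s := by
  refine hf.congr_of_eventuallyEq ?_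
  filter_upwards [eventually_abs_lt_four hs] with t ht using h t ht

/-- The exponent of the base solution. -/
noncomputable def hElt (δ : ℝ) : Coef :=
  (1 / 252000 : ℝ) • (ofPoly (toPoly hZero) + δ • ofPoly (toPoly hOne))

/-- The positive factor of the potential. -/
noncomputable def remElt (δ : ℝ) : Coef :=
  (1 / 360000 : ℝ) • (ofPoly (toPoly remZero) + δ • ofPoly (toPoly remOne) +
    δ ^ 2 • ofPoly (toPoly remTwo))

/-- The potential `w U²`. -/
noncomputable def potElt (δ : ℝ) : Coef := (4 : ℝ) • ((1 - sqRad) ^ 2 * remElt δ)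

/-- The radial base solution. -/
noncomputable def baseU (δ : ℝ) : Coef := (1 - sqRad) * NormedSpace.exp (hElt δ)

/-- The weight of the base solution. -/
noncomputable def baseW (δ : ℝ) : Coef :=
  (4 : ℝ) • (remElt δ * NormedSpace.exp ((-2 : ℝ) • hElt δ))

theorem isRad_hElt (δ : ℝ) : IsRad (hElt δ) :=
  ((isRad_ofPoly _).add ((isRad_ofPoly _).smul _)).smul _

theorem isRad_remElt (δ : ℝ) : IsRad (remElt δ) :=
  (((isRad_ofPoly _).add ((isRad_ofPoly _).smul _)).add ((isRad_ofPoly _).smul _)).smul _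

theorem isRad_one_sub : IsRad (1 - sqRad) := isRad_one.sub isRad_sqRad

theorem isRad_potElt (δ : ℝ) : IsRad (potElt δ) :=
  ((isRad_one_sub.pow 2).mul (isRad_remElt δ)).smul _

theorem isRad_baseU (δ : ℝ) : IsRad (baseU δ) := isRad_one_sub.mul (isRad_hElt δ).exp

theorem isRad_baseW (δ : ℝ) : IsRad (baseW δ) :=
  ((isRad_remElt δ).mul ((isRad_hElt δ).smul _).exp).smul _

variable {δ s : ℝ}

theorem row_one_sub (hs : |s| ≤ 4) : row 0 s (1 - sqRad) = 1 - s := by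
  rw [map_sub, row_zero_one hs, row_sqRad hs]

theorem row_hElt (hs : |s| ≤ 4) : row 0 s (hElt δ) = logFactor δ s := by
  rw [hElt, map_smul, map_add, map_smul, row_ofPoly hs, row_ofPoly hs, eval_toPoly, eval_toPoly,
    logFactor, smul_eq_mul, smul_eq_mul]
  ring

theorem row_remElt (hs : |s| ≤ 4) : row 0 s (remElt δ) = rem δ s := by
  rw [remElt, map_smul, map_add, map_add, map_smul, map_smul, row_ofPoly hs, row_ofPoly hs,
    row_ofPoly hs, eval_toPoly, eval_toPoly, eval_toPoly, rem, smul_eq_mul, smul_eq_mul,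
    smul_eq_mul]
  ring

theorem row_potElt (hs : |s| ≤ 4) : row 0 s (potElt δ) = pot δ s := by
  rw [potElt, map_smul, (isRad_one_sub.pow 2).row_mul 0 hs, isRad_one_sub.row_pow hs,
    row_one_sub hs, row_remElt hs, pot, smul_eq_mul]
  ring

theorem row_baseU (hs : |s| ≤ 4) :
    row 0 s (baseU δ) = (1 - s) * Real.exp (logFactor δ s) := by
  rw [baseU, isRad_one_sub.row_mul 0 hs, (isRad_hElt δ).row_exp hs, row_one_sub hs, row_hElt hs]

theorem row_baseW (hs : |s| ≤ 4) :
    row 0 s (baseW δ) = 4 * (rem δ s * Real.exp (-2 * logFactor δ s)) := by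
  rw [baseW, map_smul, (isRad_remElt δ).row_mul 0 hs, ((isRad_hElt δ).smul _).row_exp hs,
    map_smul, row_hElt hs, row_remElt hs, smul_eq_mul, smul_eq_mul]

theorem abs_le_four (hs : s ∈ Set.Icc (0 : ℝ) 1) : |s| ≤ 4 := (abs_lt_four hs).le

theorem baseW_mul_baseU_sq (δ : ℝ) : baseW δ * baseU δ ^ 2 = potElt δ := by
  rw [← sub_eq_zero]
  refine (((isRad_baseW δ).mul ((isRad_baseU δ).pow 2)).sub (isRad_potElt δ)).eq_zero fun s hs => ?_
  have h := abs_le_four hs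
  rw [map_sub, (isRad_baseW δ).row_mul 0 h, (isRad_baseU δ).row_pow h, row_baseW h, row_baseU h,
    row_potElt h, pot, mul_pow, ← Real.exp_nat_mul]
  have : Real.exp (-2 * logFactor δ s) * Real.exp ((2 : ℕ) * logFactor δ s) = 1 := by
    rw [← Real.exp_add]; simp
  linear_combination 4 * rem δ s * (1 - s) ^ 2 * this

theorem hasDerivAt_row_baseU (hs : |s| < 4) : HasDerivAt (fun t => row 0 t (baseU δ))
    ((-1 + (1 - s) * eta δ s) * Real.exp (logFactor δ s)) s := by
  refine hasDerivAt_row_of_eq hs (fun s hs => row_baseU hs.le) ?_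
  refine (((hasDerivAt_id s).const_sub 1).mul (hasDerivAt_logFactor δ s).exp).congr_deriv ?_
  simp
  ring

theorem baseU_ode (hs : |s| < 4) :
    -4 * (s * rowDD 0 s (baseU δ) + rowD 0 s (baseU δ)) = pot δ s * row 0 s (baseU δ) := by
  rw [rowD_eq (fun s hs => hasDerivAt_row_baseU hs) hs,
    rowDD_eq (f'' := fun s => (-2 * eta δ s + (1 - s) * (etaDer δ s + eta δ s ^ 2)) *
      Real.exp (logFactor δ s)) (fun s hs => hasDerivAt_row_baseU hs) (fun s hs => ?_) hs,
    row_baseU hs.le, pot]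
  · linear_combination -4 * Real.exp (logFactor δ s) * riccati_eta δ s
  · refine ((((((hasDerivAt_id s).const_sub 1).mul (hasDerivAt_eta δ s)).const_add (-1)).mul
      (hasDerivAt_logFactor δ s).exp)).congr_deriv ?_
    simp
    ring

theorem baseU_eq_green (δ : ℝ) : baseU δ = green (baseW δ * baseU δ ^ 3) := by
  have e : baseW δ * baseU δ ^ 3 = potElt δ * baseU δ := by
    rw [← baseW_mul_baseU_sq]; ring
  rw [e]
  refine (isRad_baseU δ).eq_green_of_ode ((isRad_potElt δ).mul (isRad_baseU δ)) (fun s hs => ?_) ?_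
  · rw [baseU_ode (abs_lt_four hs), (isRad_potElt δ).row_mul 0 (abs_le_four hs),
      row_potElt (abs_le_four hs)]
  · rw [row_baseU (by norm_num)]; simp

/-- The coordinate function `x`. -/
noncomputable def coordX : Coef := mono (1, 0) + mono (0, 1)

theorem swap_coordX : swap coordX = coordX := by simp [coordX, add_comm]

theorem row_coordX {m : ℕ} (hs : |s| ≤ 4) : row m s coordX = if m = 1 then 1 / 2 else 0 := by
  rcases m with _ | _ | m
  · simp [coordX, row_mono hs]
  · simp [coordX, row_mono hs]
  · simp only [coordX, map_add, row_mono hs]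
    rw [if_neg, if_neg, if_neg] <;> simp

/-- The regular solution of the first angular mode of the linearised equation, normalised at the
origin. -/
noncomputable def phiRad (δ : ℝ) : Coef :=
  Ring.inverse (1 - voltMul ((3 : ℝ) • potElt δ)) 1

theorem phiRad_eq (δ : ℝ) : phiRad δ = 1 + volt ((3 : ℝ) • potElt δ * phiRad δ) := by
  have h := Ring.mul_inverse_cancel _ (isUnit_one_sub_voltMul ((3 : ℝ) • potElt δ))
  have h2 := congrArg (fun f : Coef →L[ℝ] Coef => f 1) h
  change phiRad δ - voltMul ((3 : ℝ) • potElt δ) (phiRad δ) = 1 at h2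
  rw [voltMul_apply] at h2
  exact sub_eq_iff_eq_add.mp h2

theorem isRad_phiRad (δ : ℝ) : IsRad (phiRad δ) := by
  rw [phiRad_eq]; exact isRad_one.add (isRad_volt _)

theorem row_zero_phiRad (δ : ℝ) : row 0 0 (phiRad δ) = 1 := by
  rw [phiRad_eq, map_add, row_zero_volt, row_zero_one (by norm_num), add_zero]

theorem rowD_one (m : ℕ) (hs : |s| < 4) : rowD m s 1 = 0 := by
  rw [one_def, rowD_mono hs]; simp

theorem rowDD_one (m : ℕ) (hs : |s| < 4) : rowDD m s 1 = 0 := by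
  rw [one_def, rowDD_mono hs]; simp

theorem phiRad_ode (hs : |s| < 4) :
    -4 * (s * rowDD 0 s (phiRad δ) + 2 * rowD 0 s (phiRad δ)) =
      3 * pot δ s * row 0 s (phiRad δ) := by
  have h := row_volt_ode hs ((3 : ℝ) • potElt δ * phiRad δ)
  rw [((isRad_potElt δ).smul 3).row_mul 0 hs.le, map_smul, row_potElt hs.le, smul_eq_mul] at h
  rw [← h]
  conv_lhs => rw [phiRad_eq]
  rw [map_add, map_add, rowD_one 0 hs, rowDD_one 0 hs, zero_add, zero_add]

theorem continuous_potElt : Continuous potElt := by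
  unfold potElt remElt; fun_prop

theorem continuous_phiRad : Continuous phiRad := by
  have h0 : Continuous fun δ => (3 : ℝ) • potElt δ := by
    have := continuous_potElt
    fun_prop
  have h1 : Continuous fun δ => 1 - voltMul ((3 : ℝ) • potElt δ) := by
    have : Continuous fun δ => volt.comp (mulBilin ((3 : ℝ) • potElt δ)) :=
      continuous_const.clm_comp (mulBilin.continuous.comp h0)
    exact continuous_const.sub this
  refine continuous_iff_continuousAt.mpr fun δ => ?_
  obtain ⟨u, hu⟩ := isUnit_one_sub_voltMul ((3 : ℝ) • potElt δ)
  have h2 := NormedRing.inverse_continuousAt u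
  rw [hu] at h2
  exact (ContinuousAt.comp (f := fun δ => 1 - voltMul ((3 : ℝ) • potElt δ)) h2
    h1.continuousAt).clm_apply continuousAt_const

theorem continuousOn_row (m : ℕ) : ContinuousOn (row m) (Set.Icc 0 1) := fun _ hs =>
  (analyticAt_row m (abs_lt_four hs)).continuousAt.continuousWithinAt

theorem continuousOn_row_phiRad :
    ContinuousOn (fun q : ℝ × ℝ => row 0 q.2 (phiRad q.1)) (Set.univ ×ˢ Set.Icc 0 1) :=
  ((continuousOn_row 0).comp continuousOn_snd fun _ hq => hq.2).clm_apply
    (continuous_phiRad.comp continuous_fst).continuousOn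

end Coef

namespace Coef

open IntPoly

theorem row_phiRad_wronskian {δ : ℝ} {z z' z'' : ℝ → ℝ} {s : ℝ} (hs : |s| < 4)
    (hz : HasDerivAt z (z' s) s) (hz' : HasDerivAt z' (z'' s) s) :
    HasDerivAt (fun s => 4 * s ^ 2 * (row 0 s (phiRad δ) * z' s - z s * rowD 0 s (phiRad δ)))
      (s * row 0 s (phiRad δ) * (4 * (s * z'' s + 2 * z' s) + 3 * pot δ s * z s)) s := by
  refine (hasDerivAt_wronskian (m := 1) (f'' := fun s => rowDD 0 s (phiRad δ)) (hasDerivAt_row 0 hs (phiRad δ))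
    (hasDerivAt_rowD 0 hs (phiRad δ)) hz hz').congr_deriv ?_
  have := phiRad_ode (δ := δ) hs
  norm_num
  linear_combination (s * z s) * this

theorem ev_subOne (s : ℝ) : ev subOne s = (1 - s) * ev subOneQuot s := by
  rw [subOne, ev_mul]
  congr 1
  simp
  ring

theorem ev_der_subOne : ev (der subOne) 1 < 0 := by
  have h1 := hasDerivAt_ev subOne 1
  have h2 := ((hasDerivAt_id (1 : ℝ)).const_sub 1).mul (hasDerivAt_ev subOneQuot 1)
  have e := h1.unique (h2.congr_of_eventuallyEq (Filter.Eventually.of_forall ev_subOne))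
  have := subOneQuot_pos zero_le_one le_rfl
  rw [e]
  simpa using this

theorem exists_phiRad_one_nonpos : ∃ s ∈ Set.Icc (0 : ℝ) 1, row 0 s (phiRad 1) ≤ 0 := by
  by_contra! h
  have hd := fun s (hs : s ∈ Set.Icc (0 : ℝ) 1) => row_phiRad_wronskian (δ := 1) (abs_lt_four hs)
    (hasDerivAt_ev subOne s) (z'' := ev (der (der subOne))) (hasDerivAt_ev (der subOne) s)
  have hm : MonotoneOn (fun s => 4 * s ^ 2 * (row 0 s (phiRad 1) * ev (der subOne) s -
      ev subOne s * rowD 0 s (phiRad 1))) (Set.Icc 0 1) := by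
    refine monotoneOn_of_hasDerivWithinAt_nonneg (convex_Icc 0 1)
      (fun s hs => (hd s hs).continuousAt.continuousWithinAt)
      (fun s hs => (hd s (interior_subset hs)).hasDerivWithinAt) fun s hs => ?_
    have hs := interior_subset hs
    have h1 := h s hs
    have h2 := subOne_strict hs.1 hs.2
    have h3 : 0 < 4 * (s * ev (der (der subOne)) s + 2 * ev (der subOne) s) +
      3 * pot 1 s * ev subOne s := by linarith
    have := hs.1
    positivity
  have := hm ⟨le_rfl, zero_le_one⟩ ⟨zero_le_one, le_rfl⟩ zero_le_one
  have h1 := h 1 ⟨zero_le_one, le_rfl⟩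
  have h2 := mul_pos h1 (neg_pos.mpr ev_der_subOne)
  simp only [ev_subOne] at this
  norm_num at this
  linarith

theorem phiRad_neg_one_pos {s : ℝ} (hs : s ∈ Set.Icc (0 : ℝ) 1) : 0 < row 0 s (phiRad (-1)) := by
  by_contra! h
  have hc : ContinuousOn (fun t => row 0 t (phiRad (-1))) (Set.Icc 0 s) := fun t ht =>
    (hasDerivAt_row 0 (abs_lt_four ⟨ht.1, ht.2.trans hs.2⟩) _).continuousAt.continuousWithinAt
  obtain ⟨z, hz, hz0⟩ := intermediate_value_Icc' hs.1 hc
    (show (0 : ℝ) ∈ Set.Icc _ _ from ⟨h, by rw [row_zero_phiRad]; exact zero_le_one⟩)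
  have hz1 : 0 < z := by
    rcases hz.1.lt_or_eq with h | h
    · exact h
    · simp only [← h, row_zero_phiRad] at hz0
      exact absurd hz0 one_ne_zero
  have hsub : ∀ t ∈ Set.Icc 0 z, t ∈ Set.Icc (0 : ℝ) 1 := fun t ht =>
    ⟨ht.1, ht.2.trans (hz.2.trans hs.2)⟩
  have := eq_zero_of_supersolution (m := 1) le_rfl hz1 (q := fun s => 3 * pot (-1) s)
    (fun t ht => hasDerivAt_row 0 (abs_lt_four (hsub t ht)) (phiRad (-1)))
    (fun t ht => hasDerivAt_rowD 0 (abs_lt_four (hsub t ht)) (phiRad (-1)))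
    (fun t _ => hasDerivAt_ev superOne t) (fun t _ => hasDerivAt_ev (der superOne) t)
    (fun t ht => superOne_pos (hsub t ht).1 (hsub t ht).2)
    (fun t ht => by
      have := superOne_strict (hsub t ht).1 (hsub t ht).2
      norm_num
      linarith)
    (fun t ht => by
      rw [← phiRad_ode (abs_lt_four (hsub t ht))]
      norm_num)
    (Or.inl rfl) hz0 0 ⟨le_rfl, hz1.le⟩
  rw [row_zero_phiRad] at this
  exact one_ne_zero this

theorem pot_nonneg {δ s : ℝ} (hδ : |δ| ≤ 1) (hs : s ∈ Set.Icc (0 : ℝ) 1) : 0 ≤ pot δ s := by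
  have := rem_pos hδ hs.1 hs.2
  unfold pot
  positivity

theorem eq_one_of_phiRad_eq_zero {δ : ℝ} (hδ : |δ| ≤ 1)
    (h0 : ∀ s ∈ Set.Icc (0 : ℝ) 1, 0 ≤ row 0 s (phiRad δ)) {s : ℝ} (hs : s ∈ Set.Icc (0 : ℝ) 1)
    (hz : row 0 s (phiRad δ) = 0) : s = 1 := by
  by_contra hne
  have hs1 : s < 1 := lt_of_le_of_ne hs.2 hne
  have hs0 : 0 < s := by
    rcases hs.1.lt_or_eq with h | h
    · exact h
    · simp only [← h, row_zero_phiRad] at hz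
      exact absurd hz one_ne_zero
  have hsub : ∀ t ∈ Set.Icc 0 s, t ∈ Set.Icc (0 : ℝ) 1 := fun t ht => ⟨ht.1, ht.2.trans hs.2⟩
  have hmin : IsLocalMin (fun t => row 0 t (phiRad δ)) s := by
    filter_upwards [Icc_mem_nhds hs0 hs1] with t ht
    rw [hz]; exact h0 t ht
  have hD := hmin.hasDerivAt_eq_zero (hasDerivAt_row 0 (abs_lt_four hs) _)
  have hd := fun t (ht : t ∈ Set.Icc (0 : ℝ) s) => row_phiRad_wronskian (δ := δ)
    (abs_lt_four (hsub t ht)) (hasDerivAt_const t (1 : ℝ)) (z' := fun _ => 0) (z'' := fun _ => 0)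
    (hasDerivAt_const t (0 : ℝ))
  simp only [mul_zero, zero_sub, one_mul, zero_add, add_zero, mul_one] at hd
  have hm : MonotoneOn (fun t => 4 * t ^ 2 * -rowD 0 t (phiRad δ)) (Set.Icc 0 s) := by
    refine monotoneOn_of_hasDerivWithinAt_nonneg (convex_Icc 0 s)
      (fun t ht => (hd t ht).continuousAt.continuousWithinAt)
      (fun t ht => (hd t (interior_subset ht)).hasDerivWithinAt) fun t ht => ?_
    have ht := hsub t (interior_subset ht)
    have h1 := h0 t ht
    have h2 := pot_nonneg hδ ht
    have := ht.1
    positivity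
  have hzero : ∀ t ∈ Set.Ioo 0 s, rowD 0 t (phiRad δ) = 0 := by
    intro t ht
    have l := hm ⟨le_rfl, hs0.le⟩ (Set.Ioo_subset_Icc_self ht) ht.1.le
    have u := hm (Set.Ioo_subset_Icc_self ht) ⟨hs0.le, le_rfl⟩ ht.2.le
    simp only [hD] at l u
    norm_num at l u
    have h2 : 0 < 4 * t ^ 2 := by have := ht.1; positivity
    have : 4 * t ^ 2 * rowD 0 t (phiRad δ) = 0 := by linarith
    simpa [h2.ne'] using this
  have hcont : ContinuousOn (fun t => row 0 t (phiRad δ)) (Set.Icc 0 s) := fun t ht =>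
    (hasDerivAt_row 0 (abs_lt_four (hsub t ht)) _).continuousAt.continuousWithinAt
  have hmono : MonotoneOn (fun t => row 0 t (phiRad δ)) (Set.Icc 0 s) := by
    refine monotoneOn_of_hasDerivWithinAt_nonneg (convex_Icc 0 s) hcont
      (fun t ht => (hasDerivAt_row 0 (abs_lt_four (hsub t (interior_subset ht))) _).hasDerivWithinAt)
      fun t ht => ?_
    rw [interior_Icc] at ht
    exact (hzero t ht).ge
  have := hmono ⟨le_rfl, hs0.le⟩ ⟨hs0.le, le_rfl⟩ hs0.le
  simp only [row_zero_phiRad, hz] at this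
  linarith

theorem exists_critical : ∃ δ : ℝ, |δ| ≤ 1 ∧ row 0 1 (phiRad δ) = 0 ∧
    ∀ s ∈ Set.Ico (0 : ℝ) 1, 0 < row 0 s (phiRad δ) := by
  set F := fun q : ℝ × ℝ => row 0 q.2 (phiRad q.1) with hF
  set K : Set (ℝ × ℝ) := (Set.Icc (-1) 1 ×ˢ Set.Icc 0 1) with hK
  have hKc : IsCompact K := isCompact_Icc.prod isCompact_Icc
  have hcl : IsClosed (K ∩ F ⁻¹' Set.Iic 0) :=
    (continuousOn_row_phiRad.mono (Set.prod_mono (Set.subset_univ _)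
      subset_rfl)).preimage_isClosed_of_isClosed hKc.isClosed isClosed_Iic
  have hSc : IsCompact (Prod.fst '' (K ∩ F ⁻¹' Set.Iic 0)) :=
    (hKc.of_isClosed_subset hcl Set.inter_subset_left).image continuous_fst
  set S := Prod.fst '' (K ∩ F ⁻¹' Set.Iic 0)
  have hmem : ∀ δ, δ ∈ S ↔ δ ∈ Set.Icc (-1 : ℝ) 1 ∧ ∃ s ∈ Set.Icc (0 : ℝ) 1,
      row 0 s (phiRad δ) ≤ 0 := by
    intro δ
    constructor
    · rintro ⟨⟨d, s⟩, ⟨⟨hd, hs⟩, h⟩, rfl⟩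
      exact ⟨hd, s, hs, h⟩
    · rintro ⟨hd, s, hs, h⟩
      exact ⟨(δ, s), ⟨⟨hd, hs⟩, h⟩, rfl⟩
  have hne : S.Nonempty := ⟨1, (hmem 1).mpr ⟨by norm_num, exists_phiRad_one_nonpos⟩⟩
  set d := sInf S
  have hd : d ∈ S := hSc.sInf_mem hne
  obtain ⟨hd1, s, hs, hle⟩ := (hmem d).mp hd
  have hdlt : -1 < d := by
    rcases hd1.1.lt_or_eq with h | h
    · exact h
    · rw [← h] at hle
      exact absurd (phiRad_neg_one_pos hs) hle.not_gt
  have habs : |d| ≤ 1 := abs_le.mpr hd1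
  have hnn : ∀ s ∈ Set.Icc (0 : ℝ) 1, 0 ≤ row 0 s (phiRad d) := by
    intro s hs
    have hcont : Continuous fun δ => row 0 s (phiRad δ) :=
      (row 0 s).continuous.comp continuous_phiRad
    have ht : Filter.Tendsto (fun δ => row 0 s (phiRad δ)) (nhdsWithin d (Set.Iio d))
        (nhds (row 0 s (phiRad d))) := hcont.continuousAt.continuousWithinAt
    refine ge_of_tendsto ht ?_
    filter_upwards [Ioo_mem_nhdsLT hdlt] with δ hδ
    by_contra! hneg
    exact (csInf_le hSc.bddBelow ((hmem δ).mpr ⟨⟨hδ.1.le, hδ.2.le.trans hd1.2⟩, s, hs,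
      hneg.le⟩)).not_gt hδ.2
  have hz := le_antisymm hle (hnn s hs)
  obtain rfl := eq_one_of_phiRad_eq_zero habs hnn hs hz
  refine ⟨d, habs, hz, fun t ht => ?_⟩
  have ht' : t ∈ Set.Icc (0 : ℝ) 1 := ⟨ht.1, ht.2.le⟩
  refine lt_of_le_of_ne (hnn t ht') fun h => ?_
  exact ht.2.ne (eq_one_of_phiRad_eq_zero habs hnn ht' h.symm)

end Coef

/-! ### Radial integration -/

namespace Coef

/-- The primitive in the squared radius. -/
noncomputable def prim : Coef →L[ℝ] Coef :=
  lift (fun i => (4 / (i.1 + 1) : ℝ) • mono (i + (1, 1))) 4 fun i => by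
    rw [norm_smul, norm_mono, Real.norm_eq_abs, abs_of_nonneg (by positivity), mul_one]
    exact div_le_self (by norm_num) (by linarith [(Nat.cast_nonneg i.1 : (0 : ℝ) ≤ i.1)])

theorem prim_mono (i : ℕ × ℕ) : prim (mono i) = (4 / (i.1 + 1) : ℝ) • mono (i + (1, 1)) :=
  lift_mono ..

theorem IsRad.prim {a : Coef} (ha : IsRad a) : IsRad (prim a) := by
  have : rad.comp (Coef.prim.comp rad) = Coef.prim.comp rad := ext_mono fun i => by
    rcases i with ⟨j, k⟩
    by_cases h : j = k <;> simp [h, prim_mono]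
  have := congrArg (fun f => f a) this
  simp only [ContinuousLinearMap.comp_apply] at this
  rwa [ha] at this

theorem hasDerivAt_row_prim {s : ℝ} (hs : |s| < 4) (a : Coef) :
    HasDerivAt (fun t => row 0 t (prim a)) (row 0 s a) s := by
  have : (rowD 0 s).comp prim = row 0 s := ext_mono fun i => by
    rw [ContinuousLinearMap.comp_apply, prim_mono, map_smul, rowD_mono hs, row_mono hs.le]
    have : (i.1 : ℝ) + 1 ≠ 0 := by positivity
    by_cases h : i.1 = i.2
    · simp [h]
      rw [h] at this
      field_simp
    · simp [h]
  rw [← this]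
  exact hasDerivAt_row 0 hs (prim a)

theorem row_zero_prim (a : Coef) : row 0 0 (prim a) = 0 := by
  have : (row 0 0).comp prim = 0 := ext_mono fun i => by
    by_cases h : i.1 = i.2 <;> simp [h, prim_mono, row_mono]
  exact congrArg (fun f => f a) this

/-- The integral over `[0, 1]` of the radial part. -/
noncomputable def intRow : Coef →L[ℝ] ℝ := (row 0 1).comp prim

theorem intRow_mono (i : ℕ × ℕ) :
    intRow (mono i) = if i.1 = i.2 then (1 / 4 : ℝ) ^ i.1 / (i.1 + 1) else 0 := by
  rw [intRow, ContinuousLinearMap.comp_apply, prim_mono, map_smul, row_mono (by norm_num)]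
  by_cases h : i.1 = i.2 <;> simp [h]
  field_simp
  ring

theorem intRow_eq_integral (a : Coef) : intRow a = ∫ s in (0 : ℝ)..1, row 0 s a := by
  rw [intervalIntegral.integral_eq_sub_of_hasDerivAt (f := fun s => row 0 s (prim a)),
    row_zero_prim, sub_zero]
  · rfl
  · intro s hs
    rw [Set.uIcc_of_le zero_le_one] at hs
    exact hasDerivAt_row_prim (abs_lt_four hs) a
  · refine ContinuousOn.intervalIntegrable fun s hs => ?_
    rw [Set.uIcc_of_le zero_le_one] at hs
    exact (hasDerivAt_row 0 (abs_lt_four hs) a).continuousAt.continuousWithinAt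

theorem sub_le_intRow {a : Coef} {F F' : ℝ → ℝ}
    (hF : ∀ s ∈ Set.Icc (0 : ℝ) 1, HasDerivAt F (F' s) s)
    (h : ∀ s ∈ Set.Ioo (0 : ℝ) 1, F' s ≤ row 0 s a) : F 1 - F 0 ≤ intRow a := by
  have hd := fun s (hs : s ∈ Set.Icc (0 : ℝ) 1) =>
    (hasDerivAt_row_prim (abs_lt_four hs) a).sub (hF s hs)
  have hm : MonotoneOn (fun s => row 0 s (prim a) - F s) (Set.Icc 0 1) := by
    refine monotoneOn_of_hasDerivWithinAt_nonneg (convex_Icc 0 1)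
      (fun s hs => (hd s hs).continuousAt.continuousWithinAt)
      (fun s hs => (hd s (interior_subset hs)).hasDerivWithinAt) fun s hs => ?_
    rw [interior_Icc] at hs
    exact sub_nonneg.mpr (h s hs)
  have := hm ⟨le_rfl, zero_le_one⟩ ⟨zero_le_one, le_rfl⟩ zero_le_one
  simp only [row_zero_prim] at this
  change _ ≤ intRow a - F 1 at this
  linarith

theorem sub_lt_intRow {a : Coef} {F F' : ℝ → ℝ}
    (hF : ∀ s ∈ Set.Icc (0 : ℝ) 1, HasDerivAt F (F' s) s)
    (h : ∀ s ∈ Set.Ioo (0 : ℝ) 1, F' s < row 0 s a) : F 1 - F 0 < intRow a := by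
  have hd := fun s (hs : s ∈ Set.Icc (0 : ℝ) 1) =>
    (hasDerivAt_row_prim (abs_lt_four hs) a).sub (hF s hs)
  have hm : StrictMonoOn (fun s => row 0 s (prim a) - F s) (Set.Icc 0 1) := by
    refine strictMonoOn_of_hasDerivWithinAt_pos (convex_Icc 0 1)
      (fun s hs => (hd s hs).continuousAt.continuousWithinAt)
      (fun s hs => (hd s (interior_subset hs)).hasDerivWithinAt) fun s hs => ?_
    rw [interior_Icc] at hs
    exact sub_pos.mpr (h s hs)
  have := hm ⟨le_rfl, zero_le_one⟩ ⟨zero_le_one, le_rfl⟩ zero_lt_one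
  simp only [row_zero_prim] at this
  change _ < intRow a - F 1 at this
  linarith

theorem intRow_nonneg {a : Coef} (h : ∀ s ∈ Set.Ioo (0 : ℝ) 1, 0 ≤ row 0 s a) : 0 ≤ intRow a := by
  simpa using sub_le_intRow (F := fun _ => 0) (fun s _ => hasDerivAt_const s (0 : ℝ)) h

theorem intRow_pos {a : Coef} (h : ∀ s ∈ Set.Ioo (0 : ℝ) 1, 0 < row 0 s a) : 0 < intRow a := by
  simpa using sub_lt_intRow (F := fun _ => 0) (fun s _ => hasDerivAt_const s (0 : ℝ)) h

theorem intRow_mono_green_mono (i j : ℕ × ℕ) (h : i.2 ≤ i.1) :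
    intRow (green (mono i) * mono j) = if i.1 + j.1 = i.2 + j.2 then
      (1 / 4 : ℝ) ^ (i.1 + j.1) / (4 * (i.1 + 1) * (j.2 + 1) * (i.1 + j.1 + 2)) else 0 := by
  rw [green_mono, smul_mul_assoc, sub_mul, smul_mul_assoc, smul_mul_assoc, mono_mul_mono,
    mono_mul_mono, map_smul, map_sub, map_smul, map_smul, intRow_mono, intRow_mono,
    min_eq_right h]
  rcases i with ⟨i, i'⟩
  rcases j with ⟨j, j'⟩
  simp only at h ⊢
  obtain ⟨d, rfl⟩ := Nat.exists_eq_add_of_le h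
  by_cases h1 : i' + d + j = i' + j'
  · have h2 : j' = d + j := by omega
    subst h2
    have e1 : i' + d - i' + j = d + j := by omega
    have e2 : i' - (i' + d) + (d + j) = d + j := by omega
    have e3 : i' + d + j = i' + (d + j) := by omega
    simp only [Prod.mk_add_mk, e1, e2, if_true, smul_eq_mul]
    rw [if_pos (by omega), if_pos (by omega)]
    push_cast
    rw [show i' + d + 1 + j = i' + (d + j) + 1 by ring, show i' + d + j = i' + (d + j) by ring,
      pow_succ, pow_add]
    field_simp
    ring
  · simp only [Prod.mk_add_mk]
    rw [if_neg (by omega), if_neg (by omega), if_neg h1]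
    simp

theorem intRow_swap (a : Coef) : intRow (swap a) = intRow a := by
  have : intRow.comp swap = intRow := ext_mono fun i => by
    rw [ContinuousLinearMap.comp_apply, swap_mono, intRow_mono, intRow_mono]
    by_cases h : i.1 = i.2
    · simp [h]
    · simp [h, Ne.symm h]
  exact congrArg (fun f => f a) this

/-- The Green operator is symmetric. -/
theorem intRow_green_mul (a b : Coef) : intRow (green a * b) = intRow (a * green b) := by
  have key : ∀ i j : ℕ × ℕ, i.2 ≤ i.1 →
      intRow (green (mono i) * mono j) = intRow (mono i * green (mono j)) := by
    intro i j h
    rw [mul_comm (mono i)]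
    by_cases h1 : j.1 ≤ j.2
    · rw [intRow_mono_green_mono i j h, ← intRow_swap (green (mono j) * _), swap_mul, swap_green,
        swap_mono, swap_mono, intRow_mono_green_mono j.swap i.swap h1]
      simp only [Prod.fst_swap, Prod.snd_swap]
      by_cases h2 : i.1 + j.1 = i.2 + j.2
      · rw [if_pos h2, if_pos (by omega), h2, add_comm i.2]
        have : (i.1 : ℝ) + j.1 = j.2 + i.2 := by exact_mod_cast h2.trans (add_comm _ _)
        rw [this]
        ring
      · rw [if_neg h2, if_neg (by omega)]
    · rw [intRow_mono_green_mono i j h, intRow_mono_green_mono j i (by omega), if_neg (by omega),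
        if_neg (by omega)]
  have := ext_mono₂ (f := (ContinuousLinearMap.compL ℝ Coef Coef ℝ intRow).comp
      (mulBilin.comp green))
    (g := (ContinuousLinearMap.compL ℝ Coef Coef ℝ intRow).comp
      ((ContinuousLinearMap.compL ℝ Coef Coef Coef).flip green |>.comp mulBilin))
    (fun i j => ?_) a b
  · exact this
  · change intRow (green (mono i) * mono j) = intRow (mono i * green (mono j))
    rcases le_total i.2 i.1 with h | h
    · exact key i j h
    · rw [← intRow_swap, ← intRow_swap (mono i * _), swap_mul, swap_mul, swap_green, swap_green,
        swap_mono, swap_mono]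
      exact key i.swap j.swap h

end Coef

/-! ### The linearised equation at the base solution -/

namespace Coef

open IntPoly

variable {δ : ℝ}

/-- The first angular mode of the linearised equation. -/
noncomputable def phi (δ : ℝ) : Coef := phiRad δ * coordX

theorem swap_phi (δ : ℝ) : swap (phi δ) = phi δ := by
  rw [phi, swap_mul, (isRad_phiRad δ).swap, swap_coordX]

theorem flip_phi (δ : ℝ) : flip (phi δ) = -phi δ := by
  rw [phi, flip_mul, (isRad_phiRad δ).flip, coordX]
  simp
  ring

theorem row_phi {m : ℕ} {s : ℝ} (hs : |s| ≤ 4) :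
    row m s (phi δ) = if m = 1 then row 0 s (phiRad δ) / 2 else 0 := by
  rw [phi, (isRad_phiRad δ).row_mul m hs, row_coordX hs]
  split_ifs <;> ring

theorem phi_eq_green (h1 : row 0 1 (phiRad δ) = 0) :
    phi δ = green ((3 : ℝ) • potElt δ * phi δ) := by
  have hr := (isRad_potElt δ).smul 3
  refine eq_green_of_ode (swap_phi δ) (by rw [swap_mul, hr.swap, swap_phi]) (fun m s hs => ?_)
    fun m => ?_
  · have hs' := abs_lt_four hs
    rw [hr.row_mul m hs'.le, row_phi hs'.le, map_smul, row_potElt hs'.le, smul_eq_mul]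
    by_cases hm : m = 1
    · subst hm
      have hd : ∀ s : ℝ, |s| < 4 → HasDerivAt (fun t => row 1 t (phi δ))
          (rowD 0 s (phiRad δ) / 2) s := fun s hs =>
        hasDerivAt_row_of_eq hs (fun s hs => by rw [row_phi hs.le, if_pos rfl])
          ((hasDerivAt_row 0 hs _).div_const 2)
      rw [rowD_eq hd hs', rowDD_eq hd (fun s hs => (hasDerivAt_rowD 0 hs _).div_const 2) hs']
      norm_num
      linear_combination phiRad_ode (δ := δ) hs' / 2
    · have hd : ∀ s : ℝ, |s| < 4 → HasDerivAt (fun t => row m t (phi δ)) 0 s := fun s hs =>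
        hasDerivAt_row_of_eq hs (fun s hs => by rw [row_phi hs.le, if_neg hm])
          (hasDerivAt_const s 0)
      rw [rowD_eq hd hs', rowDD_eq (f' := fun _ => 0) hd (fun s _ => hasDerivAt_const s 0) hs',
        if_neg hm]
      simp
  · rw [row_phi (by norm_num), h1]
    simp

theorem row_eq_zero_of_subinterval {m : ℕ} {a : Coef} {x y : ℝ} (hxy : x < y) (hx : 0 ≤ x)
    (hy : y ≤ 1) (h : ∀ s ∈ Set.Icc x y, row m s a = 0) :
    ∀ s ∈ Set.Icc (0 : ℝ) 1, row m s a = 0 := by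
  have han : AnalyticOnNhd ℝ (fun s => row m s a) (Set.Icc 0 1) := fun s hs =>
    ((ContinuousLinearMap.apply ℝ ℝ a).analyticAt _).fun_comp (analyticAt_row m (abs_lt_four hs))
  have hmid : (x + y) / 2 ∈ Set.Icc (0 : ℝ) 1 := ⟨by linarith, by linarith⟩
  refine han.eqOn_zero_of_preconnected_of_eventuallyEq_zero isPreconnected_Icc hmid ?_
  filter_upwards [Icc_mem_nhds (show x < (x + y) / 2 by linarith)
    (show (x + y) / 2 < y by linarith)] with t ht using h t ht

section Kernel

variable {a : Coef}

theorem linearised_ode (ha : a = green ((3 : ℝ) • potElt δ * a)) (m : ℕ) {s : ℝ} (hs : |s| < 4) :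
    -4 * (s * rowDD m s a + (m + 1) * rowD m s a) = 3 * pot δ s * row m s a := by
  have h := row_green_ode m hs ((3 : ℝ) • potElt δ * a)
  rw [← ha, ((isRad_potElt δ).smul 3).row_mul m hs.le, map_smul, row_potElt hs.le] at h
  exact h

theorem linearised_row_one (ha : a = green ((3 : ℝ) • potElt δ * a)) (m : ℕ) :
    row m 1 a = 0 := by
  rw [ha, row_one_green]

theorem linearised_row_of_two_le (hδ : |δ| ≤ 1) (ha : a = green ((3 : ℝ) • potElt δ * a)) {m : ℕ}
    (hm : 2 ≤ m) : ∀ s ∈ Set.Icc (0 : ℝ) 1, row m s a = 0 := by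
  refine eq_zero_of_supersolution (m := m) le_rfl one_pos (q := fun s => 3 * pot δ s)
    (fun t ht => hasDerivAt_row m (abs_lt_four ht) a)
    (fun t ht => hasDerivAt_rowD m (abs_lt_four ht) a)
    (fun t _ => hasDerivAt_ev superOne t) (fun t _ => hasDerivAt_ev (der superOne) t)
    (fun t ht => superOne_pos ht.1 ht.2) (fun t ht => ?_)
    (fun t ht => linearised_ode ha m (abs_lt_four ht)) (Or.inl rfl) (linearised_row_one ha m)
  have h1 := superOne_strict_mode hδ ht.1 ht.2
  have h2 := superOne_deriv_neg ht.1 ht.2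
  have h3 := superOne_pos ht.1 ht.2
  have h4 : (2 : ℝ) ≤ m := by exact_mod_cast hm
  nlinarith

theorem linearised_row_one_eq (hpos : ∀ s ∈ Set.Ico (0 : ℝ) 1, 0 < row 0 s (phiRad δ))
    (h1 : row 0 1 (phiRad δ) = 0)
    (ha : a = green ((3 : ℝ) • potElt δ * a)) :
    ∃ c : ℝ, ∀ s ∈ Set.Icc (0 : ℝ) 1, row 1 s a = c * row 0 s (phiRad δ) := by
  have hw : ∀ s ∈ Set.Icc (0 : ℝ) 1, HasDerivAt
      (fun s => 4 * s ^ 2 * (row 0 s (phiRad δ) * rowD 1 s a - row 1 s a * rowD 0 s (phiRad δ)))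
      0 s := fun s hs => by
    refine (row_phiRad_wronskian (abs_lt_four hs) (z'' := fun s => rowDD 1 s a)
      (hasDerivAt_row 1 (abs_lt_four hs) a)
      (hasDerivAt_rowD 1 (abs_lt_four hs) a)).congr_deriv ?_
    have := linearised_ode ha 1 (abs_lt_four hs)
    push_cast at this
    linear_combination (-s * row 0 s (phiRad δ)) * this
  have hw0 : ∀ s ∈ Set.Icc (0 : ℝ) 1,
      4 * s ^ 2 * (row 0 s (phiRad δ) * rowD 1 s a - row 1 s a * rowD 0 s (phiRad δ)) = 0 := by
    intro s hs
    have := constant_of_derivWithin_zero (f := fun s => 4 * s ^ 2 *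
      (row 0 s (phiRad δ) * rowD 1 s a - row 1 s a * rowD 0 s (phiRad δ)))
      (fun s hs => (hw s hs).differentiableAt.differentiableWithinAt)
      (fun s hs => (hw s (Set.Ico_subset_Icc_self hs)).hasDerivWithinAt.derivWithin
        ((uniqueDiffOn_Icc one_pos) s (Set.Ico_subset_Icc_self hs))) s hs
    simpa using this
  have hq : ∀ s ∈ Set.Ico (0 : ℝ) 1, row 1 s a = row 1 0 a * row 0 s (phiRad δ) := by
    intro s hs
    have hsub : ∀ t ∈ Set.Icc 0 s, t ∈ Set.Ico (0 : ℝ) 1 := fun t ht =>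
      ⟨ht.1, ht.2.trans_lt hs.2⟩
    have hsub' : ∀ t ∈ Set.Icc 0 s, |t| < 4 := fun t ht =>
      abs_lt_four (Set.Ico_subset_Icc_self (hsub t ht))
    have hd : ∀ t ∈ Set.Icc 0 s, HasDerivAt (fun t => row 1 t a / row 0 t (phiRad δ)) _ t :=
      fun t ht => (hasDerivAt_row 1 (hsub' t ht) a).div (hasDerivAt_row 0 (hsub' t ht) _)
        (hpos t (hsub t ht)).ne'
    rcases hs.1.eq_or_lt with h | h
    · rw [← h, row_zero_phiRad, mul_one]
    have hmono : MonotoneOn (fun t => row 1 t a / row 0 t (phiRad δ)) (Set.Icc 0 s) ∧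
        AntitoneOn (fun t => row 1 t a / row 0 t (phiRad δ)) (Set.Icc 0 s) := by
      have hz : ∀ t ∈ interior (Set.Icc 0 s), (rowD 1 t a * row 0 t (phiRad δ) -
          row 1 t a * rowD 0 t (phiRad δ)) / row 0 t (phiRad δ) ^ 2 = 0 := by
        intro t ht
        rw [interior_Icc] at ht
        have h2 := hw0 t (Set.Ico_subset_Icc_self (hsub t (Set.Ioo_subset_Icc_self ht)))
        have h3 : 4 * t ^ 2 ≠ 0 := by have := ht.1; positivity
        rw [mul_comm (rowD 1 t a), (mul_eq_zero.mp h2).resolve_left h3, zero_div]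
      exact ⟨monotoneOn_of_hasDerivWithinAt_nonneg (convex_Icc 0 s)
        (fun t ht => (hd t ht).continuousAt.continuousWithinAt)
        (fun t ht => (hd t (interior_subset ht)).hasDerivWithinAt) fun t ht => (hz t ht).ge,
        antitoneOn_of_hasDerivWithinAt_nonpos (convex_Icc 0 s)
        (fun t ht => (hd t ht).continuousAt.continuousWithinAt)
        (fun t ht => (hd t (interior_subset ht)).hasDerivWithinAt) fun t ht => (hz t ht).le⟩
    have l := hmono.1 ⟨le_rfl, hs.1⟩ ⟨hs.1, le_rfl⟩ hs.1
    have u := hmono.2 ⟨le_rfl, hs.1⟩ ⟨hs.1, le_rfl⟩ hs.1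
    have e := le_antisymm u l
    simp only [row_zero_phiRad, div_one] at e
    rw [← e, div_mul_cancel₀ _ (hpos s hs).ne']
  refine ⟨row 1 0 a, fun s hs => ?_⟩
  rcases hs.2.eq_or_lt with rfl | h
  · rw [h1, linearised_row_one ha, mul_zero]
  · exact hq s ⟨hs.1, h⟩

theorem linearised_row_zero (hδ : |δ| ≤ 1) (ha : a = green ((3 : ℝ) • potElt δ * a)) :
    ∀ s ∈ Set.Icc (0 : ℝ) 1, row 0 s a = 0 := by
  have hode : ∀ s ∈ Set.Icc (0 : ℝ) 1, -4 * (s * rowDD 0 s a + ((0 : ℕ) + 1) * rowD 0 s a) =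
      3 * pot δ s * row 0 s a := fun s hs => linearised_ode ha 0 (abs_lt_four hs)
  have hinner : ∀ z, 0 < z → z ≤ 97 / 1024 → row 0 z a = 0 →
      ∀ s ∈ Set.Icc (0 : ℝ) 1, row 0 s a = 0 := by
    intro z hz hz1 h0
    have hsub : ∀ t ∈ Set.Icc 0 z, t ∈ Set.Icc (0 : ℝ) 1 := fun t ht =>
      ⟨ht.1, by linarith [ht.2]⟩
    refine row_eq_zero_of_subinterval hz le_rfl (by linarith)
      (eq_zero_of_supersolution (m := 0) le_rfl hz (q := fun s => 3 * pot δ s)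
      (fun t ht => hasDerivAt_row 0 (abs_lt_four (hsub t ht)) a)
      (fun t ht => hasDerivAt_rowD 0 (abs_lt_four (hsub t ht)) a)
      (fun t _ => hasDerivAt_ev superInner t) (fun t _ => hasDerivAt_ev (der superInner) t)
      (fun t ht => superInner_pos ht.1 (ht.2.trans hz1)) (fun t ht => ?_)
      (fun t ht => hode t (hsub t ht)) (Or.inl rfl) h0)
    have h1 := superInner_strict hδ ht.1 (ht.2.trans hz1)
    have h2 := superInner_pos ht.1 (ht.2.trans hz1)
    push_cast
    linarith
  have houter : ∀ z, z < 1 → 97 / 1024 ≤ z → row 0 z a = 0 →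
      ∀ s ∈ Set.Icc (0 : ℝ) 1, row 0 s a = 0 := by
    intro z hz hz1 h0
    have hz0 : 0 ≤ z := by linarith
    have hsub : ∀ t ∈ Set.Icc z 1, t ∈ Set.Icc (0 : ℝ) 1 := fun t ht =>
      ⟨hz0.trans ht.1, ht.2⟩
    refine row_eq_zero_of_subinterval hz hz0 le_rfl
      (eq_zero_of_supersolution (m := 0) hz0 hz (q := fun s => 3 * pot δ s)
      (fun t ht => hasDerivAt_row 0 (abs_lt_four (hsub t ht)) a)
      (fun t ht => hasDerivAt_rowD 0 (abs_lt_four (hsub t ht)) a)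
      (fun t _ => hasDerivAt_ev superOuter t) (fun t _ => hasDerivAt_ev (der superOuter) t)
      (fun t ht => superOuter_pos (hz1.trans ht.1) ht.2) (fun t ht => ?_)
      (fun t ht => hode t (hsub t ht)) (Or.inr h0) (linearised_row_one ha 0))
    have h1 := superOuter_strict hδ (hz1.trans ht.1) ht.2
    have h2 := superOuter_pos (hz1.trans ht.1) ht.2
    push_cast
    linarith
  have hzero : ∃ z ∈ Set.Ioo (0 : ℝ) 1, row 0 z a = 0 := by
    by_contra! hne
    have hd := fun s (hs : s ∈ Set.Icc (0 : ℝ) 1) => hasDerivAt_wronskian (m := 0)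
      (f'' := fun s => rowDD 0 s a) (g'' := fun s => rowDD 0 s (baseU δ))
      (hasDerivAt_row 0 (abs_lt_four hs) a) (hasDerivAt_rowD 0 (abs_lt_four hs) a)
      (hasDerivAt_row 0 (abs_lt_four hs) (baseU δ)) (hasDerivAt_rowD 0 (abs_lt_four hs) (baseU δ))
    obtain ⟨z, hz, hz0⟩ := exists_hasDerivAt_eq_zero zero_lt_one
      (fun s hs => (hd s hs).continuousAt.continuousWithinAt)
      (by
        have h2 := linearised_row_one ha 0
        have h3 : row 0 1 (baseU δ) = 0 := by rw [row_baseU (by norm_num)]; simp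
        simp [h2, h3])
      (fun s hs => hd s (Set.Ioo_subset_Icc_self hs))
    have hz' := Set.Ioo_subset_Icc_self hz
    have h1 := hode z hz'
    have h2 := baseU_ode (δ := δ) (abs_lt_four hz')
    have h3 : 2 * pot δ z * row 0 z (baseU δ) * row 0 z a = 0 := by
      norm_num at h1 hz0
      linear_combination hz0 - row 0 z (baseU δ) * h1 + row 0 z a * h2
    have h4 : 0 < pot δ z := by
      have := rem_pos hδ hz'.1 hz'.2
      have h5 : 0 < 1 - z := sub_pos.mpr hz.2
      unfold pot
      positivity
    have h5 : 0 < row 0 z (baseU δ) := by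
      rw [row_baseU (abs_le_four hz')]
      have h5 : 0 < 1 - z := sub_pos.mpr hz.2
      positivity
    exact hne z hz ((mul_eq_zero.mp h3).resolve_left (by positivity))
  obtain ⟨z, hz, hz0⟩ := hzero
  rcases le_total z (97 / 1024) with h | h
  · exact hinner z hz.1 h hz0
  · exact houter z hz.2 h hz0

/-- The kernel of the linearised operator is spanned by `phi δ`. -/
theorem eq_smul_phi_of_linearised (hδ : |δ| ≤ 1) (h1 : row 0 1 (phiRad δ) = 0)
    (hpos : ∀ s ∈ Set.Ico (0 : ℝ) 1, 0 < row 0 s (phiRad δ)) (hs : swap a = a)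
    (ha : a = green ((3 : ℝ) • potElt δ * a)) : ∃ c : ℝ, a = c • phi δ := by
  obtain ⟨c, hc⟩ := linearised_row_one_eq hpos h1 ha
  refine ⟨2 * c, sub_eq_zero.mp (eq_zero_of_row ?_ fun m s hs => ?_)⟩
  · rw [map_sub, map_smul, hs, swap_phi]
  · rw [map_sub, map_smul, row_phi (abs_le_four hs), smul_eq_mul]
    rcases m with _ | _ | m
    · rw [linearised_row_zero hδ ha s hs]; simp
    · rw [zero_add, hc s hs, if_pos rfl]; ring
    · rw [linearised_row_of_two_le hδ ha (by omega) s hs]; simp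

end Kernel

end Coef

/-! ### The quartic inequality at the base solution -/

namespace Coef

open IntPoly

variable {δ : ℝ}

theorem row_zero_coordX_sq {s : ℝ} (hs : |s| ≤ 4) : row 0 s (coordX ^ 2) = s / 2 := by
  simp only [coordX, sq, add_mul, mul_add, mono_mul_mono, map_add, row_mono hs]
  norm_num
  ring

theorem row_zero_coordX_pow_four {s : ℝ} (hs : |s| ≤ 4) :
    row 0 s (coordX ^ 4) = 3 / 8 * s ^ 2 := by
  have : coordX ^ 4 = coordX * coordX * (coordX * coordX) := by ring
  rw [this]
  simp only [coordX, add_mul, mul_add, mono_mul_mono, map_add, row_mono hs]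
  norm_num
  ring

theorem IsRad.intRow_mul_coordX_sq {a : Coef} (ha : IsRad a) :
    intRow (a * coordX ^ 2) = intRow (sqRad * a) / 2 := by
  have : intRow (a * coordX ^ 2) = intRow ((1 / 2 : ℝ) • (sqRad * a)) := by
    rw [intRow_eq_integral, intRow_eq_integral]
    refine intervalIntegral.integral_congr fun s hs => ?_
    rw [Set.uIcc_of_le zero_le_one] at hs
    have hs := abs_le_four hs
    simp only [ha.row_mul 0 hs, row_zero_coordX_sq hs, map_smul, isRad_sqRad.row_mul 0 hs,
      row_sqRad hs, smul_eq_mul]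
    ring
  rw [this, map_smul, smul_eq_mul]
  ring

theorem IsRad.intRow_mul_coordX_pow_four {a : Coef} (ha : IsRad a) :
    intRow (a * coordX ^ 4) = 3 / 8 * intRow (sqRad ^ 2 * a) := by
  have : intRow (a * coordX ^ 4) = intRow ((3 / 8 : ℝ) • (sqRad ^ 2 * a)) := by
    rw [intRow_eq_integral, intRow_eq_integral]
    refine intervalIntegral.integral_congr fun s hs => ?_
    rw [Set.uIcc_of_le zero_le_one] at hs
    have hs := abs_le_four hs
    simp only [ha.row_mul 0 hs, row_zero_coordX_pow_four hs, map_smul,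
      (isRad_sqRad.pow 2).row_mul 0 hs, isRad_sqRad.row_pow hs, row_sqRad hs, smul_eq_mul]
    ring
  rw [this, map_smul, smul_eq_mul]

/-- The multiplier in the Cauchy–Schwarz argument. -/
noncomputable def mult : Coef := (119 / 50 : ℝ) • sqRad ^ 2

theorem isRad_mult : IsRad mult := (isRad_sqRad.pow 2).smul _

theorem row_mult {s : ℝ} (hs : |s| ≤ 4) : row 0 s mult = 119 / 50 * s ^ 2 := by
  rw [mult, map_smul, isRad_sqRad.row_pow hs, row_sqRad hs, smul_eq_mul]

theorem intRow_mult_baseU_lt (hδ : |δ| ≤ 1) :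
    6 * intRow (potElt δ * mult ^ 2 * baseU δ ^ 2) < intRow (potElt δ * baseU δ ^ 2) := by
  have h : 0 < intRow ((1 - (6 : ℝ) • mult ^ 2) * (potElt δ * baseU δ ^ 2)) := by
    have := sub_lt_intRow (a := (1 - (6 : ℝ) • mult ^ 2) * (potElt δ * baseU δ ^ 2))
      (F := fun s => (1 - s) ^ 5 * flux δ s * Real.exp (2 * logFactor δ s))
      (F' := fun s => (1 - s) ^ 4 * (-5 * flux δ s + (1 - s) * fluxDer δ s +
        2 * (1 - s) * flux δ s * eta δ s) * Real.exp (2 * logFactor δ s))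
      (fun s _ => by
        refine (((((hasDerivAt_id s).const_sub 1).pow 5).mul (hasDerivAt_flux δ s)).mul
          ((hasDerivAt_logFactor δ s).const_mul 2).exp).congr_deriv ?_
        simp
        ring)
      (fun s hs => by
        have hs' := Set.Ioo_subset_Icc_self hs
        have h4 := abs_le_four hs'
        rw [(isRad_one.sub ((isRad_mult.pow 2).smul 6)).row_mul 0 h4, map_sub, map_smul,
          isRad_mult.row_pow h4, row_mult h4, (isRad_potElt δ).row_mul 0 h4,
          (isRad_baseU δ).row_pow h4, row_baseU h4, row_potElt h4, row_zero_one h4, pot,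
          mul_pow (1 - s) (Real.exp _), ← Real.exp_nat_mul, smul_eq_mul]
        have h1 := flux_ineq hδ hs'.1 hs'.2
        have h2 : 0 < (1 - s) ^ 4 := by have := sub_pos.mpr hs.2; positivity
        have h3 := Real.exp_pos (2 * logFactor δ s)
        have := mul_pos (mul_pos h2 h3) h1
        push_cast
        linarith)
    simpa [flux_zero] using this
  have e : (1 - (6 : ℝ) • mult ^ 2) * (potElt δ * baseU δ ^ 2) =
      potElt δ * baseU δ ^ 2 - (6 : ℝ) • (potElt δ * mult ^ 2 * baseU δ ^ 2) := by
    rw [sub_mul, one_mul, smul_mul_assoc]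
    congr 2
    ring
  rw [e, map_sub, map_smul, smul_eq_mul] at h
  linarith

theorem intRow_phiRad_le (hδ : |δ| ≤ 1) (h1 : row 0 1 (phiRad δ) = 0) :
    intRow (sqRad * potElt δ * phiRad δ ^ 2) ≤
      intRow (sqRad * mult * potElt δ * phiRad δ ^ 2) := by
  have := sub_le_intRow (a := (mult - 1) * (sqRad * potElt δ * phiRad δ ^ 2))
    (F := fun s => -(4 * s ^ 2 * (row 0 s (phiRad δ) * rowD 0 s (phiRad δ) -
      ev (der superQuartic) s / ev superQuartic s * row 0 s (phiRad δ) ^ 2)))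
    (fun s hs => (hasDerivAt_picone (m := 1) (f'' := fun s => rowDD 0 s (phiRad δ))
      (hasDerivAt_row 0 (abs_lt_four hs) _)
      (hasDerivAt_rowD 0 (abs_lt_four hs) _) (hasDerivAt_ev superQuartic s)
      (g'' := ev (der (der superQuartic)))
      (hasDerivAt_ev (der superQuartic) s) (superQuartic_pos hs.1 hs.2).ne').neg)
    (fun s hs => by
      have hs' := Set.Ioo_subset_Icc_self hs
      have h4 := abs_le_four hs'
      rw [(isRad_mult.sub isRad_one).row_mul 0 h4, map_sub, row_mult h4, row_zero_one h4,
        (isRad_sqRad.mul (isRad_potElt δ)).row_mul 0 h4, isRad_sqRad.row_mul 0 h4, row_sqRad h4,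
        row_potElt h4, (isRad_phiRad δ).row_pow h4]
      have h5 := phiRad_ode (δ := δ) (abs_lt_four hs')
      have h6 := superQuartic_pos hs'.1 hs'.2
      have h7 := superQuartic_strict hδ hs'.1 hs'.2
      have h8 : (4 - 119 / 50 * s ^ 2) * pot δ s <
          -4 * (s * ev (der (der superQuartic)) s + 2 * ev (der superQuartic) s) /
            ev superQuartic s := by
        rw [lt_div_iff₀ h6]; exact h7
      have h9 : -4 * (s * ev (der (der superQuartic)) s + 2 * ev (der superQuartic) s) /
            ev superQuartic s = -(4 * (s * ev (der (der superQuartic)) s +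
              2 * ev (der superQuartic) s) / ev superQuartic s) := by ring
      rw [h9] at h8
      have h10 := mul_le_mul_of_nonneg_right h8.le
        (mul_nonneg hs'.1 (sq_nonneg (row 0 s (phiRad δ))))
      have h11 : 0 ≤ s * (4 * s * (rowD 0 s (phiRad δ) -
          ev (der superQuartic) s / ev superQuartic s * row 0 s (phiRad δ)) ^ 2) := by
        have := hs'.1
        positivity
      norm_num
      linear_combination h10 + h11 + s * row 0 s (phiRad δ) * h5)
  have e : (mult - 1) * (sqRad * potElt δ * phiRad δ ^ 2) =
    sqRad * mult * potElt δ * phiRad δ ^ 2 - sqRad * potElt δ * phiRad δ ^ 2 := by ring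
  rw [e, map_sub] at this
  simp [h1] at this
  linarith

theorem baseW_pos (hδ : |δ| ≤ 1) {s : ℝ} (hs : s ∈ Set.Icc (0 : ℝ) 1) : 0 < row 0 s (baseW δ) := by
  rw [row_baseW (abs_le_four hs)]
  have := rem_pos hδ hs.1 hs.2
  positivity

theorem baseU_pos {s : ℝ} (hs : s ∈ Set.Ico (0 : ℝ) 1) : 0 < row 0 s (baseU δ) := by
  rw [row_baseU (abs_le_four (Set.Ico_subset_Icc_self hs))]
  have := sub_pos.mpr hs.2
  positivity

theorem quartic_inequality (hδ : |δ| ≤ 1) (h1 : row 0 1 (phiRad δ) = 0)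
    (hpos : ∀ s ∈ Set.Ico (0 : ℝ) 1, 0 < row 0 s (phiRad δ)) :
    9 * intRow (baseW δ * baseU δ ^ 2 * phi δ ^ 2) ^ 2 <
      intRow (baseW δ * baseU δ ^ 4) * intRow (baseW δ * phi δ ^ 4) := by
  set w := baseW δ
  set U := baseU δ
  set Φ := phiRad δ
  have hw : IsRad w := isRad_baseW δ
  have hU : IsRad U := isRad_baseU δ
  have hΦ : IsRad Φ := isRad_phiRad δ
  have hV : w * U ^ 2 = potElt δ := baseW_mul_baseU_sq δ
  have e1 : intRow (w * U ^ 2 * phi δ ^ 2) = intRow (sqRad * potElt δ * Φ ^ 2) / 2 := by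
    rw [hV, phi, mul_pow, ← mul_assoc, ((isRad_potElt δ).mul (hΦ.pow 2)).intRow_mul_coordX_sq,
      mul_assoc]
  have e2 : intRow (w * phi δ ^ 4) = 3 / 8 * intRow (sqRad ^ 2 * (w * Φ ^ 4)) := by
    rw [phi, mul_pow, ← mul_assoc, (hw.mul (hΦ.pow 4)).intRow_mul_coordX_pow_four]
  have i1 := intRow_phiRad_le hδ h1
  have i2 := intRow_mult_baseU_lt hδ
  rw [← hV] at i1 i2
  rw [← hV] at e1
  have r1 : w * U ^ 2 * U ^ 2 = w * U ^ 4 := by ring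
  have r2 : w * U ^ 2 * mult ^ 2 * U ^ 2 = w * mult ^ 2 * U ^ 4 := by ring
  rw [r1, r2] at i2
  set A := intRow (sqRad * (w * U ^ 2) * Φ ^ 2)
  set B := intRow (sqRad * mult * (w * U ^ 2) * Φ ^ 2)
  set D := intRow (sqRad ^ 2 * (w * Φ ^ 4))
  set E := intRow (w * U ^ 4)
  set F := intRow (w * mult ^ 2 * U ^ 4)
  have hA : 0 ≤ A := intRow_nonneg fun s hs => by
    have hs' := Set.Ioo_subset_Icc_self hs
    have h4 := abs_le_four hs'
    rw [(isRad_sqRad.mul (hw.mul (hU.pow 2))).row_mul 0 h4, isRad_sqRad.row_mul 0 h4,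
      hw.row_mul 0 h4, hU.row_pow h4, hΦ.row_pow h4, row_sqRad h4]
    have := baseW_pos hδ hs'
    have := hs'.1
    positivity
  have hD : 0 < D := intRow_pos fun s hs => by
    have hs' := Set.Ioo_subset_Icc_self hs
    have h4 := abs_le_four hs'
    rw [(isRad_sqRad.pow 2).row_mul 0 h4, isRad_sqRad.row_pow h4, hw.row_mul 0 h4,
      hΦ.row_pow h4, row_sqRad h4]
    have := baseW_pos hδ hs'
    have := hs.1
    have := hpos s (Set.Ioo_subset_Ico_self hs)
    positivity
  have hF : 0 < F := intRow_pos fun s hs => by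
    have hs' := Set.Ioo_subset_Icc_self hs
    have h4 := abs_le_four hs'
    rw [(hw.mul (isRad_mult.pow 2)).row_mul 0 h4, hw.row_mul 0 h4, isRad_mult.row_pow h4,
      hU.row_pow h4, row_mult h4]
    have := baseW_pos hδ hs'
    have := hs.1
    have := baseU_pos (δ := δ) (Set.Ioo_subset_Ico_self hs)
    positivity
  have hCS : ∀ t : ℝ, 0 ≤ D - 2 * t * B + t ^ 2 * F := by
    intro t
    have : 0 ≤ intRow (w * (sqRad * Φ ^ 2 - t • (mult * U ^ 2)) ^ 2) := intRow_nonneg fun s hs => by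
      have hs' := Set.Ioo_subset_Icc_self hs
      have h4 := abs_le_four hs'
      rw [hw.row_mul 0 h4, ((isRad_sqRad.mul (hΦ.pow 2)).sub
        ((isRad_mult.mul (hU.pow 2)).smul t)).row_pow h4]
      have := baseW_pos hδ hs'
      positivity
    have e : w * (sqRad * Φ ^ 2 - t • (mult * U ^ 2)) ^ 2 = sqRad ^ 2 * (w * Φ ^ 4) -
        (2 * t) • (sqRad * mult * (w * U ^ 2) * Φ ^ 2) + t ^ 2 • (w * mult ^ 2 * U ^ 4) := by
      simp only [Algebra.smul_def, map_mul, map_pow, map_ofNat]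
      ring
    rw [e, map_add, map_sub, map_smul, map_smul, smul_eq_mul, smul_eq_mul] at this
    exact this
  have hBF : B ^ 2 ≤ D * F := by
    have := hCS (B / F)
    have h2 : D - 2 * (B / F) * B + (B / F) ^ 2 * F = D - B ^ 2 / F := by field_simp; ring
    rw [h2, sub_nonneg, div_le_iff₀ hF] at this
    exact this
  rw [e1, e2]
  nlinarith [mul_lt_mul_of_pos_left i2 hD, pow_le_pow_left₀ hA i1 2]

end Coef

/-! ### Transversality of the weight perturbation -/

namespace Coef

open IntPoly Polynomial

/-- The relative perturbation of the base solution. -/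
noncomputable def relVar (K : ℝ[X]) : Coef := prim ((1 - sqRad) ^ 3 * ofPoly K)

/-- The logarithmic derivative of the base solution, up to its singular part. -/
noncomputable def etaElt (δ : ℝ) : Coef :=
  (1 / 600 : ℝ) • (ofPoly (toPoly etaZero) + δ • ofPoly (toPoly etaOne))

/-- The perturbation of the weight. -/
noncomputable def weightVar (δ : ℝ) (K : ℝ[X]) : Coef :=
  NormedSpace.exp ((-2 : ℝ) • hElt δ) * ((-8 : ℝ) • (remElt δ * relVar K) -
    (4 : ℝ) • (sqRad * (1 - sqRad) * ofPoly (derivative K) - (5 : ℝ) • (sqRad * ofPoly K) +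
      (2 : ℝ) • (sqRad * (1 - sqRad) * etaElt δ * ofPoly K) + (1 - sqRad) * ofPoly K))

variable {δ s : ℝ} {K : ℝ[X]}

theorem isRad_relVar : IsRad (relVar K) := ((isRad_one_sub.pow 3).mul (isRad_ofPoly K)).prim

theorem isRad_etaElt (δ : ℝ) : IsRad (etaElt δ) :=
  ((isRad_ofPoly _).add ((isRad_ofPoly _).smul _)).smul _

theorem isRad_weightVar : IsRad (weightVar δ K) :=
  ((isRad_hElt δ).smul _).exp.mul ((((isRad_remElt δ).mul isRad_relVar).smul _).sub
    ((((((isRad_sqRad.mul isRad_one_sub).mul (isRad_ofPoly _)).sub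
      ((isRad_sqRad.mul (isRad_ofPoly K)).smul 5)).add
      ((((isRad_sqRad.mul isRad_one_sub).mul (isRad_etaElt δ)).mul (isRad_ofPoly K)).smul 2)).add
      (isRad_one_sub.mul (isRad_ofPoly K))).smul 4))

theorem row_etaElt (hs : |s| ≤ 4) : row 0 s (etaElt δ) = eta δ s := by
  rw [etaElt, map_smul, map_add, map_smul, row_ofPoly hs, row_ofPoly hs, eval_toPoly, eval_toPoly,
    _root_.eta, smul_eq_mul, smul_eq_mul]
  ring

theorem row_weightVar (hs : |s| ≤ 4) : row 0 s (weightVar δ K) =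
    Real.exp (-2 * logFactor δ s) * (-8 * (rem δ s * row 0 s (relVar K)) -
      4 * (s * (1 - s) * (derivative K).eval s - 5 * (s * K.eval s) +
        2 * (s * (1 - s) * eta δ s * K.eval s) + (1 - s) * K.eval s)) := by
  have h1 := isRad_sqRad.mul isRad_one_sub
  rw [weightVar, ((isRad_hElt δ).smul _).exp.row_mul 0 hs, ((isRad_hElt δ).smul _).row_exp hs,
    map_smul, row_hElt hs, map_sub, map_smul, (isRad_remElt δ).row_mul 0 hs, row_remElt hs,
    map_smul, map_add, map_add, map_sub, map_smul, map_smul, h1.row_mul 0 hs,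
    isRad_sqRad.row_mul 0 hs, (h1.mul (isRad_etaElt δ)).row_mul 0 hs, h1.row_mul 0 hs (etaElt δ), isRad_sqRad.row_mul 0 hs (1 - sqRad),
    isRad_one_sub.row_mul 0 hs, isRad_sqRad.row_mul 0 hs, row_sqRad hs, row_one_sub hs,
    row_ofPoly hs, row_ofPoly hs, row_etaElt hs]
  simp only [smul_eq_mul]

theorem hasDerivAt_row_relVar (hs : |s| < 4) :
    HasDerivAt (fun t => row 0 t (relVar K)) ((1 - s) ^ 3 * K.eval s) s := by
  have := hasDerivAt_row_prim hs ((1 - sqRad) ^ 3 * ofPoly K)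
  rwa [(isRad_one_sub.pow 3).row_mul 0 hs.le, isRad_one_sub.row_pow hs.le, row_one_sub hs.le,
    row_ofPoly hs.le] at this

theorem baseU_mul_relVar_eq_green (δ : ℝ) (K : ℝ[X]) :
    baseU δ * relVar K = green ((3 : ℝ) • potElt δ * (baseU δ * relVar K) +
      weightVar δ K * baseU δ ^ 3) := by
  have hr := (isRad_baseU δ).mul (isRad_relVar (K := K))
  refine hr.eq_green_of_ode ((((isRad_potElt δ).smul 3).mul hr).add
    (isRad_weightVar.mul ((isRad_baseU δ).pow 3))) (fun s hs => ?_) ?_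
  · have h4 := abs_lt_four hs
    have hd : ∀ s : ℝ, |s| < 4 → HasDerivAt (fun t => row 0 t (baseU δ * relVar K))
        (rowD 0 s (baseU δ) * row 0 s (relVar K) +
          row 0 s (baseU δ) * ((1 - s) ^ 3 * K.eval s)) s := fun s hs =>
      hasDerivAt_row_of_eq hs (fun s hs => (isRad_baseU δ).row_mul 0 hs.le _)
        ((hasDerivAt_row 0 hs _).mul (hasDerivAt_row_relVar hs))
    have hd2 : ∀ s : ℝ, |s| < 4 → HasDerivAt (fun s => rowD 0 s (baseU δ) * row 0 s (relVar K) +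
          row 0 s (baseU δ) * ((1 - s) ^ 3 * K.eval s))
        (rowDD 0 s (baseU δ) * row 0 s (relVar K) +
          2 * rowD 0 s (baseU δ) * ((1 - s) ^ 3 * K.eval s) +
          row 0 s (baseU δ) * (-3 * (1 - s) ^ 2 * K.eval s +
            (1 - s) ^ 3 * (derivative K).eval s)) s := fun s hs => by
      refine (((hasDerivAt_rowD 0 hs _).mul (hasDerivAt_row_relVar hs)).add
        ((hasDerivAt_row 0 hs _).mul ((((hasDerivAt_id s).const_sub 1).pow 3).mul
          (K.hasDerivAt s)))).congr_deriv ?_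
      simp
      ring
    rw [rowD_eq hd h4, rowDD_eq hd hd2 h4, map_add, ((isRad_potElt δ).smul 3).row_mul 0 h4.le,
      (isRad_baseU δ).row_mul 0 h4.le, isRad_weightVar.row_mul 0 h4.le,
      (isRad_baseU δ).row_pow h4.le, row_weightVar h4.le, map_smul, row_potElt h4.le, smul_eq_mul]
    have h5 := baseU_ode (δ := δ) h4
    have h6 := rowD_eq (fun s hs => hasDerivAt_row_baseU (δ := δ) hs) h4
    rw [h6, row_baseU h4.le] at h5 ⊢
    have h7 : Real.exp (-2 * logFactor δ s) * Real.exp (logFactor δ s) ^ 3 =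
        Real.exp (logFactor δ s) := by
      rw [← Real.exp_nat_mul, ← Real.exp_add]
      congr 1
      push_cast
      ring
    rw [pot] at h5 ⊢
    linear_combination row 0 s (relVar K) * h5 - (1 - s) ^ 3 *
      (-8 * (rem δ s * row 0 s (relVar K)) -
      4 * (s * (1 - s) * (derivative K).eval s - 5 * (s * K.eval s) +
        2 * (s * (1 - s) * eta δ s * K.eval s) + (1 - s) * K.eval s)) * h7
  · rw [(isRad_baseU δ).row_mul 0 (by norm_num), row_baseU (by norm_num)]; simp

/-- The density against which the perturbation is tested. -/
noncomputable def testDensity (δ s : ℝ) : ℝ :=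
  s * (1 - s) ^ 2 * row 0 s (phiRad δ) ^ 2 * (-2 * s - (1 - s) + 2 * s * eta δ s * (1 - s)) -
    2 * s ^ 2 * (1 - s) ^ 3 * row 0 s (phiRad δ) * rowD 0 s (phiRad δ)

theorem continuousOn_testDensity (δ : ℝ) : ContinuousOn (testDensity δ) (Set.Icc 0 1) := by
  have h1 : ContinuousOn (fun s => row 0 s (phiRad δ)) (Set.Icc 0 1) := fun s hs =>
    (hasDerivAt_row 0 (abs_lt_four hs) _).continuousAt.continuousWithinAt
  have h2 : ContinuousOn (fun s => rowD 0 s (phiRad δ)) (Set.Icc 0 1) := fun s hs =>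
    (hasDerivAt_rowD 0 (abs_lt_four hs) _).continuousAt.continuousWithinAt
  have h3 : ContinuousOn (eta δ) (Set.Icc 0 1) := fun s _ =>
    (hasDerivAt_eta δ s).continuousAt.continuousWithinAt
  unfold testDensity
  fun_prop

/-- The second variation of the equation along the perturbation. -/
noncomputable def secondVar (δ : ℝ) (K : ℝ[X]) : Coef :=
  phi δ * ((6 : ℝ) • (baseW δ * baseU δ * (baseU δ * relVar K) * phi δ) +
    (3 : ℝ) • (weightVar δ K * baseU δ ^ 2 * phi δ))

theorem intRow_secondVar (δ : ℝ) (K : ℝ[X]) :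
    intRow (secondVar δ K) = -6 * ∫ s in (0 : ℝ)..1, K.eval s * testDensity δ s := by
  have e : secondVar δ K = phiRad δ ^ 2 * ((6 : ℝ) • (potElt δ * relVar K) +
      (3 : ℝ) • (weightVar δ K * baseU δ ^ 2)) * coordX ^ 2 := by
    rw [secondVar, phi, ← baseW_mul_baseU_sq]
    simp only [mul_add, mul_smul_comm, add_mul, smul_mul_assoc]
    congr 2 <;> ring
  have hr : IsRad (phiRad δ ^ 2 * ((6 : ℝ) • (potElt δ * relVar K) +
      (3 : ℝ) • (weightVar δ K * baseU δ ^ 2))) :=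
    ((isRad_phiRad δ).pow 2).mul ((((isRad_potElt δ).mul isRad_relVar).smul 6).add
      ((isRad_weightVar.mul ((isRad_baseU δ).pow 2)).smul 3))
  have hc : ContinuousOn (fun s => K.eval s * testDensity δ s) (Set.uIcc 0 1) := by
    rw [Set.uIcc_of_le zero_le_one]
    exact K.continuous.continuousOn.mul (continuousOn_testDensity δ)
  have hF : ∀ s ∈ Set.uIcc (0 : ℝ) 1,
      HasDerivAt (fun s => -12 * (s ^ 2 * (1 - s) ^ 3 * row 0 s (phiRad δ) ^ 2 * K.eval s))
        (row 0 s (sqRad * (phiRad δ ^ 2 * ((6 : ℝ) • (potElt δ * relVar K) +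
          (3 : ℝ) • (weightVar δ K * baseU δ ^ 2)))) + 12 * (K.eval s * testDensity δ s)) s := by
    intro s hs
    rw [Set.uIcc_of_le zero_le_one] at hs
    have h4 := abs_lt_four hs
    refine ((((((hasDerivAt_id s).pow 2).mul (((hasDerivAt_id s).const_sub 1).pow 3)).mul
      ((hasDerivAt_row 0 h4 (phiRad δ)).pow 2)).mul (K.hasDerivAt s)).const_mul
        (-12)).congr_deriv ?_
    rw [isRad_sqRad.row_mul 0 h4.le, row_sqRad h4.le, ((isRad_phiRad δ).pow 2).row_mul 0 h4.le,
      (isRad_phiRad δ).row_pow h4.le, map_add, map_smul, map_smul, (isRad_potElt δ).row_mul 0 h4.le,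
      row_potElt h4.le, isRad_weightVar.row_mul 0 h4.le, row_weightVar h4.le,
      (isRad_baseU δ).row_pow h4.le, row_baseU h4.le, pot, testDensity]
    have h7 : Real.exp (-2 * logFactor δ s) * Real.exp (logFactor δ s) ^ 2 = 1 := by
      rw [← Real.exp_nat_mul, ← Real.exp_add]
      simp
    simp only [smul_eq_mul, id_eq, Nat.cast_ofNat, Pi.mul_apply, Pi.pow_apply]
    linear_combination (-3 * s * row 0 s (phiRad δ) ^ 2 * (1 - s) ^ 2 *
      (-8 * (rem δ s * row 0 s (relVar K)) -
      4 * (s * (1 - s) * (derivative K).eval s - 5 * (s * K.eval s) +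
        2 * (s * (1 - s) * eta δ s * K.eval s) + (1 - s) * K.eval s))) * h7
  have hi : IntervalIntegrable (fun s => row 0 s (sqRad * (phiRad δ ^ 2 *
      ((6 : ℝ) • (potElt δ * relVar K) + (3 : ℝ) • (weightVar δ K * baseU δ ^ 2)))))
      volume 0 1 := by
    refine ContinuousOn.intervalIntegrable fun s hs => ?_
    rw [Set.uIcc_of_le zero_le_one] at hs
    exact (hasDerivAt_row 0 (abs_lt_four hs) _).continuousAt.continuousWithinAt
  have h := intervalIntegral.integral_eq_sub_of_hasDerivAt hF
    (hi.add (hc.intervalIntegrable.const_mul 12))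
  rw [intervalIntegral.integral_add hi (hc.intervalIntegrable.const_mul 12),
    intervalIntegral.integral_const_mul, ← intRow_eq_integral] at h
  rw [e, hr.intRow_mul_coordX_sq]
  norm_num at h
  linarith

theorem exists_testDensity_ne_zero (δ : ℝ) : ∃ s ∈ Set.Icc (0 : ℝ) 1, testDensity δ s ≠ 0 := by
  have h0 : (0 : ℝ) ∈ Set.Icc (0 : ℝ) 1 := by simp
  have h4 := abs_lt_four h0
  have hd : ContinuousAt (fun s => (1 - s) ^ 2 * row 0 s (phiRad δ) ^ 2 *
      (-2 * s - (1 - s) + 2 * s * eta δ s * (1 - s)) -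
      2 * s * (1 - s) ^ 3 * row 0 s (phiRad δ) * rowD 0 s (phiRad δ)) 0 := by
    have h1 := (hasDerivAt_row 0 h4 (phiRad δ)).continuousAt
    have h2 := (hasDerivAt_rowD 0 h4 (phiRad δ)).continuousAt
    have h3 := (hasDerivAt_eta δ 0).continuousAt
    fun_prop
  have h5 := hd.eventually_ne (y := 0) (by simp [row_zero_phiRad])
  obtain ⟨s, h6, h7⟩ := ((h5.filter_mono nhdsWithin_le_nhds).and
    (Ioo_mem_nhdsGT (show (0 : ℝ) < 1 by norm_num))).exists
  refine ⟨s, Set.Ioo_subset_Icc_self h7, fun h8 => h6 ?_⟩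
  refine (mul_eq_zero.mp (?_ : s * _ = 0)).resolve_left h7.1.ne'
  rw [← h8, testDensity]
  ring

theorem exists_intRow_secondVar_ne_zero (δ : ℝ) : ∃ K : ℝ[X], intRow (secondVar δ K) ≠ 0 := by
  by_contra! hall
  have hY := continuousOn_testDensity δ
  have hzero : ∀ K : ℝ[X], ∫ s in (0 : ℝ)..1, K.eval s * testDensity δ s = 0 := fun K => by
    have := hall K
    rw [intRow_secondVar] at this
    linarith
  have hpos : 0 < ∫ s in (0 : ℝ)..1, testDensity δ s ^ 2 := by
    obtain ⟨s, hs, hne⟩ := exists_testDensity_ne_zero δ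
    exact intervalIntegral.integral_pos zero_lt_one (hY.pow 2) (fun _ _ => sq_nonneg _)
      ⟨s, hs, by positivity⟩
  obtain ⟨C, hC⟩ := isCompact_Icc.exists_bound_of_continuousOn hY
  have hC0 : 0 ≤ C := (norm_nonneg _).trans (hC 0 (by simp))
  obtain ⟨K, hK⟩ := exists_polynomial_near_of_continuousOn 0 1 (testDensity δ) hY
    ((∫ s in (0 : ℝ)..1, testDensity δ s ^ 2) / (C + 1)) (by positivity)
  have hi1 : IntervalIntegrable (fun s => testDensity δ s ^ 2) volume 0 1 :=
    ContinuousOn.intervalIntegrable (by rw [Set.uIcc_of_le zero_le_one]; exact hY.pow 2)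
  have hi2 : IntervalIntegrable (fun s => K.eval s * testDensity δ s) volume 0 1 :=
    ContinuousOn.intervalIntegrable
      (by rw [Set.uIcc_of_le zero_le_one]; exact K.continuous.continuousOn.mul hY)
  have h1 := intervalIntegral.norm_integral_le_of_norm_le_const (a := 0) (b := 1)
    (f := fun s => testDensity δ s ^ 2 - K.eval s * testDensity δ s)
    (C := (∫ s in (0 : ℝ)..1, testDensity δ s ^ 2) / (C + 1) * C) fun s hs => by
      rw [Set.uIoc_of_le zero_le_one] at hs
      have hs' := Set.Ioc_subset_Icc_self hs
      rw [sq, ← sub_mul, norm_mul, Real.norm_eq_abs, abs_sub_comm]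
      exact mul_le_mul (hK s hs').le (hC s hs') (norm_nonneg _) (by positivity)
  rw [intervalIntegral.integral_sub hi1 hi2, hzero K, sub_zero, Real.norm_eq_abs,
    abs_of_pos hpos, sub_zero, abs_one, mul_one, div_mul_eq_mul_div,
    le_div_iff₀ (by positivity)] at h1
  nlinarith

end Coef

/-! ### The bifurcating branch -/

namespace Coef

open IntPoly Polynomial

variable {δ : ℝ} {K : ℝ[X]}

theorem eq_zero_of_kernel (hδ : |δ| ≤ 1) (h1 : row 0 1 (phiRad δ) = 0)
    (hpos : ∀ s ∈ Set.Ico (0 : ℝ) 1, 0 < row 0 s (phiRad δ)) (hK : intRow (secondVar δ K) ≠ 0)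
    {e o : Coef} {κ : ℝ}
    (he : e = evenProj (green ((3 : ℝ) • potElt δ * e + κ • (weightVar δ K * baseU δ ^ 3))))
    (ho : o = oddProj (green ((3 : ℝ) • potElt δ * o + ((6 : ℝ) • (baseW δ * baseU δ * e * phi δ) +
      (3 * κ) • (weightVar δ K * baseU δ ^ 2 * phi δ)))))
    (hl : row 1 0 o = 0) : e = 0 ∧ o = 0 ∧ κ = 0 := by
  have hV := (isRad_potElt δ).smul 3
  have hw := isRad_weightVar (δ := δ) (K := K)
  have hU := isRad_baseU δ
  have hg := (isRad_baseU δ).mul (isRad_relVar (K := K))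
  have es : swap e = e := by rw [he, swap_evenProj]
  have ef : flip e = e := by rw [he, flip_evenProj]
  have os : swap o = o := by rw [ho, swap_oddProj]
  have of : flip o = -o := by rw [ho, flip_oddProj]
  have hwU := hw.mul (hU.pow 3)
  rw [evenProj_eq (by rw [swap_green, map_add, map_smul, swap_mul, hV.swap, es, hwU.swap])
    (by rw [flip_green, map_add, map_smul, flip_mul, hV.flip, ef, hwU.flip])] at he
  have hwU2 := hw.mul (hU.pow 2)
  have hWU := (isRad_baseW δ).mul hU
  rw [oddProj_eq (by
      simp only [swap_green, map_add, map_smul, swap_mul, hV.swap, es, os, hwU2.swap, hWU.swap,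
        swap_phi])
    (by
      simp only [flip_green, map_add, map_smul, flip_mul, hV.flip, ef, of, hwU2.flip, hWU.flip,
        flip_phi, mul_neg, smul_neg, ← neg_add, map_neg])] at ho
  have hd : e - κ • (baseU δ * relVar K) =
      green ((3 : ℝ) • potElt δ * (e - κ • (baseU δ * relVar K))) := by
    conv_lhs => rw [he, baseU_mul_relVar_eq_green, ← map_smul, ← map_sub]
    congr 1
    rw [mul_sub, smul_add, mul_smul_comm]
    abel
  have hd0 : e - κ • (baseU δ * relVar K) = 0 := by
    obtain ⟨c, hc⟩ := eq_smul_phi_of_linearised hδ h1 hpos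
      (by rw [map_sub, map_smul, es, hg.swap]) hd
    have hf : flip (e - κ • (baseU δ * relVar K)) = e - κ • (baseU δ * relVar K) := by
      rw [map_sub, map_smul, ef, hg.flip]
    rw [hc, map_smul, flip_phi, smul_neg] at hf
    have h2 : (2 : ℝ) • (c • phi δ) = 0 := by
      rw [two_smul]
      nth_rewrite 1 [← hf]
      exact neg_add_cancel _
    rw [hc]
    exact (smul_eq_zero.mp h2).resolve_left two_ne_zero
  have he' := sub_eq_zero.mp hd0
  have hκ : κ * intRow (secondVar δ K) = 0 := by
    have h2 := intRow_green_mul ((3 : ℝ) • potElt δ * o +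
      ((6 : ℝ) • (baseW δ * baseU δ * e * phi δ) +
      (3 * κ) • (weightVar δ K * baseU δ ^ 2 * phi δ))) ((3 : ℝ) • potElt δ * phi δ)
    rw [← ho, ← phi_eq_green h1, add_mul, map_add] at h2
    have h3 : o * ((3 : ℝ) • potElt δ * phi δ) = (3 : ℝ) • potElt δ * o * phi δ := by ring
    rw [h3] at h2
    have h4 : ((6 : ℝ) • (baseW δ * baseU δ * e * phi δ) +
        (3 * κ) • (weightVar δ K * baseU δ ^ 2 * phi δ)) * phi δ = κ • secondVar δ K := by
      rw [secondVar, he', mul_comm _ (phi δ)]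
      simp only [mul_smul_comm, smul_mul_assoc, mul_add, smul_add, smul_smul]
      rw [mul_comm 6 κ, mul_comm 3 κ]
    rw [h4, map_smul, smul_eq_mul] at h2
    linarith
  have hκ0 : κ = 0 := (mul_eq_zero.mp hκ).resolve_right hK
  have he0 : e = 0 := by rw [he', hκ0, zero_smul]
  refine ⟨he0, ?_, hκ0⟩
  rw [he0, hκ0] at ho
  obtain ⟨c, hc⟩ := eq_smul_phi_of_linearised hδ h1 hpos os (a := o) (by simpa using ho)
  have h5 : row 1 0 (phi δ) ≠ 0 := by
    rw [row_phi (by norm_num), if_pos rfl, row_zero_phiRad]; norm_num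
  rw [hc, map_smul, smul_eq_mul] at hl
  rw [hc, (mul_eq_zero.mp hl).resolve_right h5, zero_smul]

end Coef

namespace Coef

open IntPoly Polynomial Filter Topology

/-- The parity-split equation for `e + ε o`, together with the normalisation of `o`; the first
factor holds the parameters. -/
noncomputable def branchMap (p : (Coef × Coef × ℝ) × (Coef × Coef × ℝ)) : Coef × Coef × ℝ :=
  (p.2.1 - evenProj (green ((p.1.1 + p.2.2.2 • p.1.2.1) *
      (p.2.1 ^ 3 + p.1.2.2 ^ 2 • (3 * p.2.1 * p.2.2.1 ^ 2)))),
    p.2.2.1 - oddProj (green ((p.1.1 + p.2.2.2 • p.1.2.1) *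
      (3 * p.2.1 ^ 2 * p.2.2.1 + p.1.2.2 ^ 2 • p.2.2.1 ^ 3))),
    2 * row 1 0 p.2.2.1 - 1)

theorem contDiff_branchMap : ContDiff ℝ 1 branchMap := by
  have h1 : ContDiff ℝ 1 fun p : (Coef × Coef × ℝ) × (Coef × Coef × ℝ) =>
      p.1.1 + p.2.2.2 • p.1.2.1 := by fun_prop
  unfold branchMap
  refine ContDiff.prodMk ?_ (ContDiff.prodMk ?_ ?_)
  · exact contDiff_fst.snd'.sub (evenProj.contDiff.comp (green.contDiff.comp
      (h1.mul (by fun_prop))))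
  · exact ContDiff.sub (by fun_prop) (oddProj.contDiff.comp (green.contDiff.comp
      (h1.mul (by fun_prop))))
  · exact ContDiff.sub (contDiff_const.mul ((row 1 0).contDiff.comp (by fun_prop))) contDiff_const

/-- The even component of the compact part of the linearised branch equation. -/
noncomputable def branchEven (δ : ℝ) (K : ℝ[X]) : Coef × Coef × ℝ →L[ℝ] Coef :=
  (mulBilin ((3 : ℝ) • potElt δ)).comp (.fst ℝ _ _) +
    (ContinuousLinearMap.toSpanSingleton ℝ (weightVar δ K * baseU δ ^ 3)).comp
      ((ContinuousLinearMap.snd ℝ _ _).comp (.snd ℝ _ _))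

/-- The odd component of the compact part of the linearised branch equation. -/
noncomputable def branchOdd (δ : ℝ) (K : ℝ[X]) : Coef × Coef × ℝ →L[ℝ] Coef :=
  (mulBilin ((3 : ℝ) • potElt δ)).comp ((ContinuousLinearMap.fst ℝ _ _).comp (.snd ℝ _ _)) +
    ((mulBilin ((6 : ℝ) • (baseW δ * baseU δ * phi δ))).comp (.fst ℝ _ _) +
      (ContinuousLinearMap.toSpanSingleton ℝ
        ((3 : ℝ) • (weightVar δ K * baseU δ ^ 2 * phi δ))).comp
        ((ContinuousLinearMap.snd ℝ _ _).comp (.snd ℝ _ _)))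

/-- The compact part of the linearised branch equation. -/
noncomputable def branchCompact (δ : ℝ) (K : ℝ[X]) : Coef × Coef × ℝ →L[ℝ] Coef × Coef × ℝ :=
  (evenProj.comp (green.comp (branchEven δ K))).prod ((oddProj.comp (green.comp
    (branchOdd δ K))).prod ((ContinuousLinearMap.snd ℝ _ _).comp (.snd ℝ _ _) -
      (2 : ℝ) • (row 1 0).comp ((ContinuousLinearMap.fst ℝ _ _).comp (.snd ℝ _ _))))

variable {δ : ℝ} {K : ℝ[X]}

theorem branchEven_apply (v : Coef × Coef × ℝ) : branchEven δ K v =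
    (3 : ℝ) • potElt δ * v.1 + v.2.2 • (weightVar δ K * baseU δ ^ 3) := rfl

theorem branchOdd_apply (v : Coef × Coef × ℝ) : branchOdd δ K v =
    (3 : ℝ) • potElt δ * v.2.1 + ((6 : ℝ) • (baseW δ * baseU δ * v.1 * phi δ) +
      (3 * v.2.2) • (weightVar δ K * baseU δ ^ 2 * phi δ)) := by
  have : branchOdd δ K v = (3 : ℝ) • potElt δ * v.2.1 +
    ((6 : ℝ) • (baseW δ * baseU δ * phi δ) * v.1 +
      v.2.2 • ((3 : ℝ) • (weightVar δ K * baseU δ ^ 2 * phi δ))) := rfl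
  rw [this]
  congr 1
  algebra

theorem isCompactOperator_branchCompact : IsCompactOperator (branchCompact δ K) := by
  have hR : IsCompactOperator (id : ℝ → ℝ) :=
    (isCompactOperator_id_iff_finiteDimensional (𝕜 := ℝ)).2 inferInstance
  have h1 : IsCompactOperator fun v => (ContinuousLinearMap.inl ℝ Coef (Coef × ℝ))
      (evenProj (green (branchEven δ K v))) :=
    ((isCompactOperator_green.comp_clm (branchEven δ K)).clm_comp evenProj).clm_comp _
  have h2 : IsCompactOperator fun v => (ContinuousLinearMap.inr ℝ Coef (Coef × ℝ))
      ((ContinuousLinearMap.inl ℝ Coef ℝ) (oddProj (green (branchOdd δ K v)))) :=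
    (((isCompactOperator_green.comp_clm (branchOdd δ K)).clm_comp oddProj).clm_comp _).clm_comp _
  set l : Coef × Coef × ℝ →L[ℝ] ℝ := (ContinuousLinearMap.snd ℝ _ _).comp (.snd ℝ _ _) -
      (2 : ℝ) • (row 1 0).comp ((ContinuousLinearMap.fst ℝ _ _).comp (.snd ℝ _ _)) with hl
  have h3 : IsCompactOperator fun v => (ContinuousLinearMap.inr ℝ Coef (Coef × ℝ))
      ((ContinuousLinearMap.inr ℝ Coef ℝ) (id (l v))) :=
    ((hR.comp_clm l).clm_comp _).clm_comp _
  refine (congrArg IsCompactOperator (funext fun v => ?_)).mp ((h1.add h2).add h3)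
  simp [branchCompact, hl]

theorem isInvertible_one_sub_branchCompact (hδ : |δ| ≤ 1) (h1 : row 0 1 (phiRad δ) = 0)
    (hpos : ∀ s ∈ Set.Ico (0 : ℝ) 1, 0 < row 0 s (phiRad δ))
    (hK : intRow (secondVar δ K) ≠ 0) : (1 - branchCompact δ K).IsInvertible := by
  rcases (isCompactOperator_branchCompact (δ := δ) (K := K)).hasEigenvalue_or_mem_resolventSet
    (one_ne_zero (α := ℝ)) with h | h
  · obtain ⟨v, hv⟩ := h.exists_hasEigenvector
    have h2 : branchCompact δ K v = v := by simpa using hv.apply_eq_smul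
    refine absurd ?_ hv.2
    have e1 := (congrArg (fun v => v.1) h2).symm
    have e2 := (congrArg (fun v => v.2.1) h2).symm
    have e3 := (congrArg (fun v => v.2.2) h2).symm
    change v.1 = evenProj (green (branchEven δ K v)) at e1
    change v.2.1 = oddProj (green (branchOdd δ K v)) at e2
    change v.2.2 = v.2.2 - 2 * row 1 0 v.2.1 at e3
    rw [branchEven_apply] at e1
    rw [branchOdd_apply] at e2
    obtain ⟨a, b, c⟩ := eq_zero_of_kernel hδ h1 hpos hK e1 e2 (by linarith)
    exact Prod.ext a (Prod.ext b c)
  · have h2 := spectrum.mem_resolventSet_iff.1 h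
    obtain ⟨u, hu⟩ : IsUnit (1 - branchCompact δ K) := by simpa using h2
    exact ⟨ContinuousLinearEquiv.ofUnit u, hu⟩

theorem fderiv_branchMap (δ : ℝ) (K : ℝ[X]) :
    (fderiv ℝ branchMap ((baseW δ, weightVar δ K, 0), (baseU δ, phi δ, 0))).comp
      (.inr ℝ _ _) = 1 - branchCompact δ K := by
  refine ContinuousLinearMap.ext fun v => ?_
  have hl : HasDerivAt (fun t : ℝ => (((baseW δ, weightVar δ K, 0), (baseU δ, phi δ, 0)) :
      (Coef × Coef × ℝ) × (Coef × Coef × ℝ)) + t • (0, v)) (0, v) 0 := by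
    simpa using ((hasDerivAt_id (0 : ℝ)).smul_const
      ((0, v) : (Coef × Coef × ℝ) × (Coef × Coef × ℝ))).const_add
        ((baseW δ, weightVar δ K, 0), (baseU δ, phi δ, 0))
  have h1 := ((contDiff_branchMap.differentiable one_ne_zero)
    ((baseW δ, weightVar δ K, 0), (baseU δ, phi δ, 0))).hasFDerivAt
  have h2 := HasFDerivAt.comp_hasDerivAt_of_eq (0 : ℝ) h1 hl (by simp)
  rw [ContinuousLinearMap.comp_apply, ContinuousLinearMap.inr_apply]
  refine h2.unique ?_
  have he : HasDerivAt (fun t : ℝ => baseU δ + t • v.1) v.1 0 := by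
    simpa using ((hasDerivAt_id (0 : ℝ)).smul_const v.1).const_add (baseU δ)
  have ho : HasDerivAt (fun t : ℝ => phi δ + t • v.2.1) v.2.1 0 := by
    simpa using ((hasDerivAt_id (0 : ℝ)).smul_const v.2.1).const_add (phi δ)
  have hw : HasDerivAt (fun t : ℝ => baseW δ + (t * v.2.2) • weightVar δ K)
      (v.2.2 • weightVar δ K) 0 := by
    simpa using (((hasDerivAt_id (0 : ℝ)).mul_const v.2.2).smul_const
      (weightVar δ K)).const_add (baseW δ)
  have e1 : HasDerivAt (fun t : ℝ => (baseU δ + t • v.1) - evenProj (green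
      ((baseW δ + (t * v.2.2) • weightVar δ K) * (baseU δ + t • v.1) ^ 3)))
      (v.1 - evenProj (green (branchEven δ K v))) 0 := by
    refine (he.sub (evenProj.hasFDerivAt.comp_hasDerivAt 0 (green.hasFDerivAt.comp_hasDerivAt 0
      (hw.mul (he.pow 3))))).congr_deriv ?_
    rw [branchEven_apply, ← baseW_mul_baseU_sq]
    congr 3
    simp
    algebra
  have e2 : HasDerivAt (fun t : ℝ => (phi δ + t • v.2.1) - oddProj (green
      ((baseW δ + (t * v.2.2) • weightVar δ K) *
        (3 * (baseU δ + t • v.1) ^ 2 * (phi δ + t • v.2.1)))))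
      (v.2.1 - oddProj (green (branchOdd δ K v))) 0 := by
    refine (ho.sub (oddProj.hasFDerivAt.comp_hasDerivAt 0 (green.hasFDerivAt.comp_hasDerivAt 0
      (hw.mul (((he.pow 2).const_mul 3).mul ho))))).congr_deriv ?_
    rw [branchOdd_apply, ← baseW_mul_baseU_sq]
    congr 3
    simp
    algebra
  have e3 : HasDerivAt (fun t : ℝ => 2 * row 1 0 (phi δ + t • v.2.1) - 1)
      (v.2.2 - (v.2.2 - 2 * row 1 0 v.2.1)) 0 := by
    refine ((((row 1 0).hasFDerivAt.comp_hasDerivAt 0 ho).const_mul 2).sub_const 1).congr_deriv ?_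
    simp
  refine (e1.prodMk (e2.prodMk e3)).congr_of_eventuallyEq (Eventually.of_forall fun t => ?_)
  simp [branchMap]

/-- Solutions near the base solution which are neither even nor odd. -/
theorem exists_branch (hδ : |δ| ≤ 1) (h1 : row 0 1 (phiRad δ) = 0)
    (hpos : ∀ s ∈ Set.Ico (0 : ℝ) 1, 0 < row 0 s (phiRad δ))
    {S : Set (Coef × Coef × Coef × ℝ)} (hS : S ∈ 𝓝 (baseW δ, baseU δ, phi δ, (0 : ℝ))) :
    ∃ (P : ℝ[X]) (e o : Coef) (ε : ℝ), (ofPoly P, e, o, ε) ∈ S ∧ ε ≠ 0 ∧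
      swap e = e ∧ flip e = e ∧ swap o = o ∧ flip o = -o ∧
      e + ε • o = green (ofPoly P * (e + ε • o) ^ 3) := by
  obtain ⟨K, hK⟩ := exists_intRow_secondVar_ne_zero δ
  set z₀ : Coef × Coef × ℝ := (baseW δ, weightVar δ K, 0) with hz
  set y₀ : Coef × Coef × ℝ := (baseU δ, phi δ, 0) with hy
  have hd : HasStrictFDerivAt branchMap (fderiv ℝ branchMap (z₀, y₀)) (z₀, y₀) :=
    contDiff_branchMap.contDiffAt.hasStrictFDerivAt one_ne_zero
  have hi : ((fderiv ℝ branchMap (z₀, y₀)).comp (.inr ℝ _ _)).IsInvertible := by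
    rw [fderiv_branchMap]
    exact isInvertible_one_sub_branchCompact hδ h1 hpos hK
  have h0 : branchMap (z₀, y₀) = 0 := by
    have hU := isRad_baseU δ
    have hX := (isRad_baseW δ).mul (hU.pow 3)
    have hY := (isRad_baseW δ).mul (hU.pow 2)
    have e1 : evenProj (baseU δ) = baseU δ := evenProj_eq hU.swap hU.flip
    have e2 : oddProj (phi δ) = phi δ := oddProj_eq (swap_phi δ) (flip_phi δ)
    have e3 : green (baseW δ * (3 * baseU δ ^ 2 * phi δ)) = phi δ := by
      conv_rhs => rw [phi_eq_green h1, ← baseW_mul_baseU_sq]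
      congr 1
      algebra
    refine Prod.ext ?_ (Prod.ext ?_ ?_)
    · simp [branchMap, hz, hy, ← baseU_eq_green, e1]
    · simp [branchMap, hz, hy, e3, e2]
    · simp [branchMap, hy, row_phi, row_zero_phiRad]
  set ψ := hd.implicitFunctionOfProdDomain hi with hψ
  have ht : Tendsto ψ (𝓝 z₀) (𝓝 y₀) := hd.tendsto_implicitFunctionOfProdDomain hi
  have hs : ∀ᶠ z in 𝓝 z₀, branchMap (z, ψ z) = 0 := by
    simpa only [h0] using hd.eventually_apply_implicitFunctionOfProdDomain hi
  have hc : Tendsto (fun z : Coef × Coef × ℝ =>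
      (z.1 + (ψ z).2.2 • z.2.1, (ψ z).1, (ψ z).2.1, z.2.2)) (𝓝 z₀)
      (𝓝 (baseW δ, baseU δ, phi δ, (0 : ℝ))) := by
    have hψ1 : Tendsto (fun z => (ψ z).1) (𝓝 z₀) (𝓝 (baseU δ)) :=
      (continuous_fst.tendsto y₀).comp ht
    have hψ2 : Tendsto (fun z => (ψ z).2.1) (𝓝 z₀) (𝓝 (phi δ)) :=
      ((continuous_fst.comp continuous_snd).tendsto y₀).comp ht
    have hψ3 : Tendsto (fun z => (ψ z).2.2) (𝓝 z₀) (𝓝 0) :=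
      ((continuous_snd.comp continuous_snd).tendsto y₀).comp ht
    have hz1 : Tendsto (fun z : Coef × Coef × ℝ => z.1) (𝓝 z₀) (𝓝 (baseW δ)) :=
      continuous_fst.tendsto z₀
    have hz2 : Tendsto (fun z : Coef × Coef × ℝ => z.2.1) (𝓝 z₀) (𝓝 (weightVar δ K)) :=
      (continuous_fst.comp continuous_snd).tendsto z₀
    have hz3 : Tendsto (fun z : Coef × Coef × ℝ => z.2.2) (𝓝 z₀) (𝓝 0) :=
      (continuous_snd.comp continuous_snd).tendsto z₀
    have := hz1.add (hψ3.smul hz2)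
    rw [zero_smul, add_zero] at this
    exact this.prodMk_nhds (hψ1.prodMk_nhds (hψ2.prodMk_nhds hz3))
  obtain ⟨r, hr, hball⟩ := Metric.mem_nhds_iff.mp ((hc.eventually hS).and hs)
  obtain ⟨P, hP⟩ := (isRad_baseW δ).exists_ofPoly hr
  obtain ⟨Q, hQ⟩ := (isRad_weightVar (δ := δ) (K := K)).exists_ofPoly hr
  have hm : (ofPoly P, ofPoly Q, r / 2) ∈ Metric.ball z₀ r := by
    rw [Metric.mem_ball, Prod.dist_eq, Prod.dist_eq, hz, dist_eq_norm, dist_eq_norm, dist_eq_norm]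
    refine max_lt hP (max_lt hQ ?_)
    simp only [sub_zero, Real.norm_eq_abs, abs_of_pos (half_pos hr)]
    exact half_lt_self hr
  obtain ⟨hmS, hms⟩ := hball hm
  set y := ψ (ofPoly P, ofPoly Q, r / 2) with hyy
  have eW : ofPoly (P + C y.2.2 * Q) = ofPoly P + y.2.2 • ofPoly Q := by
    simp [ofPoly, Algebra.smul_def]
  have g1 := sub_eq_zero.mp (congrArg (fun v => v.1) hms)
  have g2 := sub_eq_zero.mp (congrArg (fun v => v.2.1) hms)
  change y.1 = evenProj (green ((ofPoly P + y.2.2 • ofPoly Q) *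
      (y.1 ^ 3 + (r / 2) ^ 2 • (3 * y.1 * y.2.1 ^ 2)))) at g1
  change y.2.1 = oddProj (green ((ofPoly P + y.2.2 • ofPoly Q) *
      (3 * y.1 ^ 2 * y.2.1 + (r / 2) ^ 2 • y.2.1 ^ 3))) at g2
  rw [← eW] at g1 g2
  have hR := isRad_ofPoly (P + C y.2.2 * Q)
  have es : swap y.1 = y.1 := by rw [g1, swap_evenProj]
  have ef : flip y.1 = y.1 := by rw [g1, flip_evenProj]
  have os : swap y.2.1 = y.2.1 := by rw [g2, swap_oddProj]
  have of : flip y.2.1 = -y.2.1 := by rw [g2, flip_oddProj]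
  have h3 : (3 : Coef) = (3 : ℝ) • 1 := by rw [Algebra.smul_def, mul_one, map_ofNat]
  have s3 : swap 3 = 3 := by
    rw [h3]
    exact (isRad_one.smul 3).swap
  have f3 : flip 3 = 3 := by
    rw [h3]
    exact (isRad_one.smul 3).flip
  refine ⟨P + C y.2.2 * Q, y.1, y.2.1, r / 2, by rw [eW]; exact hmS, (half_pos hr).ne', es, ef, os,
    of, ?_⟩
  rw [evenProj_eq (by simp only [swap_green, map_add, map_smul, swap_mul, pow_succ, pow_zero,
        hR.swap, es, os, s3, one_mul])
    (by simp only [flip_green, map_add, map_smul, flip_mul, pow_succ, pow_zero,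
        hR.flip, ef, of, f3, one_mul, mul_neg, neg_mul, neg_neg])] at g1
  rw [oddProj_eq (by simp only [swap_green, map_add, map_smul, swap_mul, pow_succ, pow_zero,
        hR.swap, es, os, s3, one_mul])
    (by simp only [flip_green, map_add, map_smul, flip_mul, pow_succ, pow_zero,
        hR.flip, ef, of, f3, one_mul, mul_neg, neg_mul, neg_neg, smul_neg, ← neg_add, map_neg])] at g2
  refine (congrArg₂ (fun a b => a + (r / 2) • b) g1 g2).trans ?_
  rw [← map_smul, ← map_add]
  congr 1
  algebra

end Coef

section SectorEnergy
open Real Set intervalIntegral Filter Topology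

theorem hasDerivAt_intervalIntegral_of_continuous {F R : ℝ → ℝ → ℝ}
    (hF : Continuous (Function.uncurry F)) (hR : Continuous (Function.uncurry R))
    (hd : ∀ r θ, HasDerivAt (fun r => F r θ) (R r θ) r) (a b r : ℝ) :
    HasDerivAt (fun r => ∫ θ in a..b, F r θ) (∫ θ in a..b, R r θ) r := by
  obtain ⟨C, hC⟩ := ((isCompact_closedBall r 1).prod (isCompact_uIcc (a := a) (b := b))).exists_bound_of_continuousOn
    hR.continuousOn
  refine (intervalIntegral.hasDerivAt_integral_of_dominated_loc_of_deriv_le (bound := fun _ => C)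
    (Metric.closedBall_mem_nhds r one_pos) (Eventually.of_forall fun x => ?_) ?_ ?_ ?_ ?_ ?_).2
  · exact (hF.uncurry_left x).aestronglyMeasurable
  · exact (hF.uncurry_left r).intervalIntegrable _ _
  · exact (hR.uncurry_left r).aestronglyMeasurable
  · exact ae_of_all _ fun θ hθ x hx => hC (x, θ) ⟨hx, uIoc_subset_uIcc hθ⟩
  · exact intervalIntegrable_const
  · exact ae_of_all _ fun θ _ x _ => hd x θ

theorem sq_intervalIntegral_le {f : ℝ → ℝ} (hf : Continuous f) {a b : ℝ} (hab : a < b) :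
    (∫ x in a..b, f x) ^ 2 / (b - a) ≤ ∫ x in a..b, f x ^ 2 := by
  set c := (∫ x in a..b, f x) / (b - a) with hc
  have h0 : 0 ≤ ∫ x in a..b, (f x - c) ^ 2 := integral_nonneg hab.le fun x _ => sq_nonneg _
  have h1 : ∫ x in a..b, (f x - c) ^ 2 =
      (∫ x in a..b, f x ^ 2) - 2 * c * (∫ x in a..b, f x) + (b - a) * c ^ 2 := by
    have : ∀ x, (f x - c) ^ 2 = f x ^ 2 - 2 * c * f x + c ^ 2 := fun x => by ring
    simp only [this]
    rw [intervalIntegral.integral_add, intervalIntegral.integral_sub,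
      intervalIntegral.integral_const_mul, intervalIntegral.integral_const, smul_eq_mul]
    all_goals exact Continuous.intervalIntegrable (by fun_prop) _ _
  have hb : b - a ≠ 0 := (sub_pos.mpr hab).ne'
  have h2 : (∫ x in a..b, f x) = c * (b - a) := by rw [hc]; field_simp
  rw [h1, h2] at h0
  rw [h2, mul_pow, sq (b - a), ← mul_assoc, mul_div_assoc, div_self hb]
  linarith

/-- Poincaré's inequality on an interval for functions vanishing at both endpoints. -/
theorem poincare_dirichlet {h g : ℝ → ℝ} (hh : ∀ x, HasDerivAt h (g x) x) (hg : Continuous g)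
    {a b μ : ℝ} (hab : a ≤ b) (hμ : 0 ≤ μ) (hπ : μ * (b - a) < π) (ha : h a = 0) (hb : h b = 0) :
    μ ^ 2 * ∫ x in a..b, h x ^ 2 ≤ ∫ x in a..b, g x ^ 2 := by
  have hc : Continuous h := continuous_iff_continuousAt.2 fun x => (hh x).continuousAt
  set y : ℝ → ℝ := fun x => μ * (x - (a + b) / 2) with hy
  have hcos : ∀ x ∈ Icc a b, 0 < cos (y x) := fun x hx => by
    refine cos_pos_of_mem_Ioo ⟨?_, ?_⟩ <;> simp only [hy] <;>
    nlinarith [mul_nonneg hμ (sub_nonneg.2 hx.1), mul_nonneg hμ (sub_nonneg.2 hx.2)]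
  have hd : ∀ x ∈ Icc a b, HasDerivAt (fun x => -(μ * tan (y x)) * h x ^ 2)
      (-(μ * (1 / cos (y x) ^ 2 * μ)) * h x ^ 2 + -(μ * tan (y x)) * (2 * h x * g x)) x := by
    intro x hx
    have e : HasDerivAt y μ x := by
      simpa using ((hasDerivAt_id x).sub_const ((a + b) / 2)).const_mul μ
    refine ((((hasDerivAt_tan (hcos x hx).ne').comp x e).const_mul μ).neg.mul
      ((hh x).pow 2)).congr_deriv ?_
    simp [Function.comp]
  have key := sub_le_integral_of_hasDeriv_right_of_le (φ := fun x => g x ^ 2 - μ ^ 2 * h x ^ 2) hab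
    (fun x hx => (hd x hx).continuousAt.continuousWithinAt)
    (fun x hx => (hd x (Ioo_subset_Icc_self hx)).hasDerivWithinAt)
    (Continuous.integrableOn_Icc (by fun_prop)) fun x hx => by
      have h1 := (hcos x (Ioo_subset_Icc_self hx)).ne'
      have h2 : 1 / cos (y x) ^ 2 = 1 + tan (y x) ^ 2 := by
        rw [tan_eq_sin_div_cos]
        field_simp
        linarith [sin_sq_add_cos_sq (y x)]
      rw [h2]
      nlinarith [sq_nonneg (g x + μ * tan (y x) * h x)]
  rw [ha, hb, intervalIntegral.integral_sub, intervalIntegral.integral_const_mul] at key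
  · linarith
  all_goals exact Continuous.intervalIntegrable (by fun_prop) _ _

/-- The Poincaré–Wirtinger inequality on an interval. -/
theorem poincare_wirtinger {f f' : ℝ → ℝ} (hf : ∀ x, HasDerivAt f (f' x) x) (hf' : Continuous f')
    {a b μ : ℝ} (hab : a < b) (hμ : 0 ≤ μ) (hπ : μ * (b - a) < π) :
    μ ^ 2 * ((∫ x in a..b, f x ^ 2) - (∫ x in a..b, f x) ^ 2 / (b - a)) ≤
      ∫ x in a..b, f' x ^ 2 := by
  have hc : Continuous f := continuous_iff_continuousAt.2 fun x => (hf x).continuousAt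
  set c := (∫ x in a..b, f x) / (b - a) with hcc
  have hb : b - a ≠ 0 := (sub_pos.mpr hab).ne'
  have hm : (∫ x in a..b, f x) = c * (b - a) := by rw [hcc]; field_simp
  set h : ℝ → ℝ := fun x => ∫ t in a..x, (f t - c) with hh
  have hg : Continuous fun x => f x - c := by fun_prop
  have hd : ∀ x, HasDerivAt h (f x - c) x := fun x =>
    integral_hasDerivAt_right (hg.intervalIntegrable _ _)
      (hg.stronglyMeasurableAtFilter _ _) hg.continuousAt
  have hch : Continuous h := continuous_iff_continuousAt.2 fun x => (hd x).continuousAt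
  have ha0 : h a = 0 := integral_same
  have hb0 : h b = 0 := by
    simp only [hh]
    rw [intervalIntegral.integral_sub (hc.intervalIntegrable _ _) intervalIntegrable_const, hm,
      intervalIntegral.integral_const, smul_eq_mul]
    ring
  have hD := poincare_dirichlet hd hg hab.le hμ hπ ha0 hb0
  have hpart : ∫ x in a..b, ((f x - c) * (f x - c) + h x * f' x) = 0 := by
    rw [integral_eq_sub_of_hasDerivAt (f := fun x => h x * (f x - c))
      (fun x _ => (hd x).mul ((hf x).sub_const c))
      (Continuous.intervalIntegrable (by fun_prop) _ _), ha0, hb0]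
    ring
  have hsq : 0 ≤ ∫ x in a..b, (f' x + μ ^ 2 * h x) ^ 2 :=
    integral_nonneg hab.le fun x _ => sq_nonneg _
  have e1 : ∫ x in a..b, (f' x + μ ^ 2 * h x) ^ 2 = (∫ x in a..b, f' x ^ 2) +
      2 * μ ^ 2 * ((∫ x in a..b, ((f x - c) * (f x - c) + h x * f' x)) -
        ∫ x in a..b, (f x - c) ^ 2) + μ ^ 2 * (μ ^ 2 * ∫ x in a..b, h x ^ 2) := by
    rw [← intervalIntegral.integral_sub, ← intervalIntegral.integral_const_mul,
      ← intervalIntegral.integral_add, ← intervalIntegral.integral_const_mul,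
      ← intervalIntegral.integral_const_mul, ← intervalIntegral.integral_add]
    · congr 1
      ext x
      ring
    all_goals exact Continuous.intervalIntegrable (by fun_prop) _ _
  have e2 : ∫ x in a..b, (f x - c) ^ 2 =
      (∫ x in a..b, f x ^ 2) - (∫ x in a..b, f x) ^ 2 / (b - a) := by
    have : ∀ x, (f x - c) ^ 2 = f x ^ 2 - 2 * c * f x + c ^ 2 := fun x => by ring
    simp only [this]
    rw [intervalIntegral.integral_add, intervalIntegral.integral_sub,
      intervalIntegral.integral_const_mul, intervalIntegral.integral_const, smul_eq_mul, hm]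
    · field_simp
      ring
    all_goals exact Continuous.intervalIntegrable (by fun_prop) _ _
  rw [hpart] at e1
  rw [← e2]
  have hD' := mul_le_mul_of_nonneg_left hD (sq_nonneg μ)
  linarith

/-- The energy of a function on a circular sector is bounded below by means of two solutions of
Riccati inequalities: one for the angular mean and one for the remainder. -/
theorem sector_energy {F R S : ℝ → ℝ → ℝ} (hF : Continuous (Function.uncurry F))
    (hR : Continuous (Function.uncurry R)) (hS : Continuous (Function.uncurry S))
    (hd : ∀ r θ, HasDerivAt (fun r => F r θ) (R r θ) r)
    (hθ : ∀ r θ, HasDerivAt (F r) (r * S r θ) θ) {g p q p' q' : ℝ → ℝ} (hg : Continuous g)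
    {a b μ r₁ r₂ : ℝ} (hab : a < b) (hμ : 0 ≤ μ) (hπ : μ * (b - a) < π) (h0 : 0 ≤ r₁)
    (hr : r₁ ≤ r₂) (hp : ∀ r ∈ Icc r₁ r₂, HasDerivAt p (p' r) r)
    (hq : ∀ r ∈ Icc r₁ r₂, HasDerivAt q (q' r) r)
    (hp' : ∀ r ∈ Icc r₁ r₂, r * p' r + p r ^ 2 + r ^ 2 * g r ≤ μ ^ 2)
    (hq' : ∀ r ∈ Icc r₁ r₂, r * q' r + q r ^ 2 + r ^ 2 * g r ≤ 0) :
    (p r₂ * ((∫ θ in a..b, F r₂ θ ^ 2) - (∫ θ in a..b, F r₂ θ) ^ 2 / (b - a)) +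
        q r₂ * ((∫ θ in a..b, F r₂ θ) ^ 2 / (b - a))) -
      (p r₁ * ((∫ θ in a..b, F r₁ θ ^ 2) - (∫ θ in a..b, F r₁ θ) ^ 2 / (b - a)) +
        q r₁ * ((∫ θ in a..b, F r₁ θ) ^ 2 / (b - a))) ≤
      ∫ r in r₁..r₂, ∫ θ in a..b, r * (R r θ ^ 2 + S r θ ^ 2 - g r * F r θ ^ 2) := by
  set m : ℝ → ℝ := fun r => ∫ θ in a..b, F r θ with hm
  set n : ℝ → ℝ := fun r => ∫ θ in a..b, F r θ ^ 2 with hn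
  have dm : ∀ r, HasDerivAt m (∫ θ in a..b, R r θ) r :=
    hasDerivAt_intervalIntegral_of_continuous hF hR hd a b
  have dn : ∀ r, HasDerivAt n (∫ θ in a..b, 2 * F r θ * R r θ) r :=
    hasDerivAt_intervalIntegral_of_continuous (F := fun r θ => F r θ ^ 2)
      (R := fun r θ => 2 * F r θ * R r θ) ((continuous_pow 2).comp hF)
      (((continuous_const_mul (2 : ℝ)).comp hF).mul hR)
      (fun r θ => ((hd r θ).pow 2).congr_deriv (by simp)) a b
  have hb : 0 < b - a := sub_pos.mpr hab
  have dH := fun r (hr : r ∈ Icc r₁ r₂) =>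
    ((hp r hr).mul ((dn r).sub (((dm r).pow 2).div_const (b - a)))).add
      ((hq r hr).mul (((dm r).pow 2).div_const (b - a)))
  have hG : Continuous (Function.uncurry fun r θ =>
      r * (R r θ ^ 2 + S r θ ^ 2 - g r * F r θ ^ 2)) :=
    continuous_fst.mul (((hR.pow 2).add (hS.pow 2)).sub ((hg.comp continuous_fst).mul (hF.pow 2)))
  refine sub_le_integral_of_hasDeriv_right_of_le hr
    (fun r hr => (dH r hr).continuousAt.continuousWithinAt)
    (fun r hr => (dH r (Ioo_subset_Icc_self hr)).hasDerivWithinAt)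
    (continuous_parametric_intervalIntegral_of_continuous' hG a b).integrableOn_Icc fun r hr => ?_
  have hr0 : 0 < r := h0.trans_lt hr.1
  have cF := hF.uncurry_left r
  have cR := hR.uncurry_left r
  have cS := hS.uncurry_left r
  have i1 : ∫ θ in a..b, r * (R r θ ^ 2 + S r θ ^ 2 - g r * F r θ ^ 2) =
      r * ((∫ θ in a..b, R r θ ^ 2) + (∫ θ in a..b, S r θ ^ 2) - g r * n r) := by
    rw [intervalIntegral.integral_const_mul, intervalIntegral.integral_sub,
      intervalIntegral.integral_add, intervalIntegral.integral_const_mul]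
    all_goals exact Continuous.intervalIntegrable (by fun_prop) _ _
  have i2 : ∫ θ in a..b, 2 * F r θ * R r θ = 2 * ∫ θ in a..b, F r θ * R r θ := by
    simp only [mul_assoc, intervalIntegral.integral_const_mul]
  have i3 : ∫ θ in a..b, (r * S r θ) ^ 2 = r ^ 2 * ∫ θ in a..b, S r θ ^ 2 := by
    simp only [mul_pow, intervalIntegral.integral_const_mul]
  have i4 : ∫ θ in a..b, (r * R r θ - p r * F r θ) = r * (∫ θ in a..b, R r θ) - p r * m r := by
    rw [intervalIntegral.integral_sub, intervalIntegral.integral_const_mul,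
      intervalIntegral.integral_const_mul]
    all_goals exact Continuous.intervalIntegrable (by fun_prop) _ _
  have i5 : ∫ θ in a..b, (r * R r θ - p r * F r θ) ^ 2 = r ^ 2 * (∫ θ in a..b, R r θ ^ 2) -
      2 * r * p r * (∫ θ in a..b, F r θ * R r θ) + p r ^ 2 * n r := by
    have : ∀ θ, (r * R r θ - p r * F r θ) ^ 2 =
        r ^ 2 * R r θ ^ 2 - 2 * r * p r * (F r θ * R r θ) + p r ^ 2 * F r θ ^ 2 := fun θ => by ring
    simp only [this]
    rw [intervalIntegral.integral_add, intervalIntegral.integral_sub,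
      intervalIntegral.integral_const_mul, intervalIntegral.integral_const_mul,
      intervalIntegral.integral_const_mul]
    all_goals exact Continuous.intervalIntegrable (by fun_prop) _ _
  have k1 := sq_intervalIntegral_le (f := fun θ => r * R r θ - p r * F r θ) (by fun_prop) hab
  have k2 := poincare_wirtinger (hθ r) (by fun_prop) hab hμ hπ
  have k3 := sq_intervalIntegral_le cF hab
  rw [i4, i5] at k1
  rw [i3] at k2
  rw [i1, i2]
  change μ ^ 2 * (n r - m r ^ 2 / (b - a)) ≤ _ at k2
  change m r ^ 2 / (b - a) ≤ n r at k3
  have k4 := mul_le_mul_of_nonneg_right (hp' r (Ioo_subset_Icc_self hr)) (sub_nonneg.2 k3)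
  have k5 := mul_le_mul_of_nonneg_right (hq' r (Ioo_subset_Icc_self hr))
    (div_nonneg (sq_nonneg (m r)) hb.le)
  have k6 : 0 ≤ (r * (∫ θ in a..b, R r θ) - q r * m r) ^ 2 / (b - a) :=
    div_nonneg (sq_nonneg _) hb.le
  refine le_of_mul_le_mul_left ?_ hr0
  simp only [Nat.cast_ofNat, Nat.add_one_sub_one, pow_one, Pi.sub_apply, Pi.pow_apply] at *
  generalize (∫ θ in a..b, R r θ) = M at *
  generalize (∫ θ in a..b, R r θ ^ 2) = A at *
  generalize (∫ θ in a..b, F r θ * R r θ) = B at *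
  generalize (∫ θ in a..b, S r θ ^ 2) = W at *
  generalize n r = N at *
  generalize m r = m' at *
  simp only [div_eq_mul_inv] at *
  generalize (b - a)⁻¹ = c at *
  linear_combination k1 + k2 + k4 + k5 + k6

end SectorEnergy

section Coercivity

open Real Set IntPoly intervalIntegral

namespace IntPoly

/-- The logarithmic derivative of `r ^ k * f (r ^ 2)` with respect to `log r`. -/
noncomputable def logSlope (k : ℝ) (f : List ℤ) (r : ℝ) : ℝ :=
  k + 2 * r ^ 2 * (ev (der f) (r ^ 2) / ev f (r ^ 2))

theorem hasDerivAt_logSlope (k : ℝ) {f : List ℤ} {r : ℝ} (h : ev f (r ^ 2) ≠ 0) :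
    HasDerivAt (logSlope k f) (4 * r * (ev (der f) (r ^ 2) / ev f (r ^ 2)) +
      4 * r ^ 3 * (ev (der (der f)) (r ^ 2) / ev f (r ^ 2) -
        (ev (der f) (r ^ 2) / ev f (r ^ 2)) ^ 2)) r := by
  have h0 : HasDerivAt (fun r : ℝ => r ^ 2) (2 * r) r := by simpa using hasDerivAt_pow 2 r
  have h1 := (hasDerivAt_ev f (r ^ 2)).comp r h0
  have h2 := (hasDerivAt_ev (der f) (r ^ 2)).comp r h0
  refine (((h0.const_mul 2).mul (h2.div h1 h)).const_add k).congr_deriv ?_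
  simp only [Function.comp, Pi.div_apply]
  field_simp
  ring

theorem logSlope_riccati {k c : ℝ} {f : List ℤ} {r : ℝ} (h : 0 < ev f (r ^ 2))
    (hs : c * ev f (r ^ 2) <
      -4 * (r ^ 2 * ev (der (der f)) (r ^ 2) + (k + 1) * ev (der f) (r ^ 2))) :
    r * (4 * r * (ev (der f) (r ^ 2) / ev f (r ^ 2)) +
      4 * r ^ 3 * (ev (der (der f)) (r ^ 2) / ev f (r ^ 2) -
        (ev (der f) (r ^ 2) / ev f (r ^ 2)) ^ 2)) + logSlope k f r ^ 2 + r ^ 2 * c ≤ k ^ 2 := by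
  have e : r * (4 * r * (ev (der f) (r ^ 2) / ev f (r ^ 2)) +
      4 * r ^ 3 * (ev (der (der f)) (r ^ 2) / ev f (r ^ 2) -
        (ev (der f) (r ^ 2) / ev f (r ^ 2)) ^ 2)) + logSlope k f r ^ 2 + r ^ 2 * c = k ^ 2 +
      r ^ 2 * ((c * ev f (r ^ 2) +
        4 * (r ^ 2 * ev (der (der f)) (r ^ 2) + (k + 1) * ev (der f) (r ^ 2))) / ev f (r ^ 2)) := by
    rw [logSlope]
    field_simp
    ring
  rw [e]
  have := div_nonpos_of_nonpos_of_nonneg (a := c * ev f (r ^ 2) +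
    4 * (r ^ 2 * ev (der (der f)) (r ^ 2) + (k + 1) * ev (der f) (r ^ 2))) (by linarith) h.le
  nlinarith [mul_nonneg (sq_nonneg r) (neg_nonneg.2 this)]

end IntPoly

/-- The radius of the circle on which the angular means are required to vanish. -/
noncomputable def meanRadius : ℝ := √(97 / 1024)

theorem meanRadius_sq : meanRadius ^ 2 = 97 / 1024 := sq_sqrt (by norm_num)

theorem meanRadius_nonneg : 0 ≤ meanRadius := sqrt_nonneg _

theorem meanRadius_le_one : meanRadius ≤ 1 := by
  nlinarith [meanRadius_sq, meanRadius_nonneg]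

theorem sector_energy_nonneg {F R S : ℝ → ℝ → ℝ} (hF : Continuous (Function.uncurry F))
    (hR : Continuous (Function.uncurry R)) (hS : Continuous (Function.uncurry S))
    (hd : ∀ r θ, HasDerivAt (fun r => F r θ) (R r θ) r)
    (hθ : ∀ r θ, HasDerivAt (F r) (r * S r θ) θ) {δ : ℝ} (hδ : |δ| ≤ 1)
    (hg : Continuous (pot δ)) {a b : ℝ} (hab : b - a = 2 * π / 3)
    (h0 : ∀ θ, F 0 θ = F 0 0) (h1 : ∀ θ, F 1 θ = 0)
    (hm : ∫ θ in a..b, F meanRadius θ = 0) :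
    0 ≤ ∫ r in (0 : ℝ)..1, ∫ θ in a..b,
      r * (R r θ ^ 2 + S r θ ^ 2 - (3 * pot δ (r ^ 2) + 1 / 1000) * F r θ ^ 2) := by
  have hL : a < b := by linarith [pi_pos]
  have hμ : 7 / 5 * (b - a) < π := by rw [hab]; linarith [pi_pos]
  have hg' : Continuous fun r : ℝ => 3 * pot δ (r ^ 2) + 1 / 1000 := by fun_prop
  have sqI : ∀ {r x y : ℝ}, 0 ≤ x → r ∈ Icc x y → x ^ 2 ≤ r ^ 2 ∧ r ^ 2 ≤ y ^ 2 :=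
    fun hx hr => ⟨pow_le_pow_left₀ hx hr.1 2, pow_le_pow_left₀ (hx.trans hr.1) hr.2 2⟩
  have I := sector_energy hF hR hS hd hθ hg' hL (by norm_num) hμ le_rfl meanRadius_nonneg
    (p := logSlope (7 / 5) superOne) (q := logSlope 0 superInner)
    (fun r hr => by
      have := sqI le_rfl hr
      rw [meanRadius_sq] at this
      exact hasDerivAt_logSlope _ (superOne_pos (by linarith) (by linarith)).ne')
    (fun r hr => by
      have := sqI le_rfl hr
      rw [meanRadius_sq] at this
      exact hasDerivAt_logSlope _ (superInner_pos (by linarith) (by linarith)).ne')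
    (fun r hr => by
      have := sqI le_rfl hr
      rw [meanRadius_sq] at this
      refine logSlope_riccati (superOne_pos (by linarith) (by linarith)) ?_
      have := superOne_strict_mode hδ (s := r ^ 2) (by linarith) (by linarith)
      norm_num at this ⊢
      exact this)
    (fun r hr => by
      have := sqI le_rfl hr
      rw [meanRadius_sq] at this
      refine (logSlope_riccati (superInner_pos (by linarith) (by linarith)) ?_).trans (by norm_num)
      have := superInner_strict hδ (s := r ^ 2) (by linarith) (by linarith)
      norm_num at this ⊢
      exact this)
  have O := sector_energy hF hR hS hd hθ hg' hL (by norm_num) hμ meanRadius_nonneg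
    meanRadius_le_one (p := logSlope (7 / 5) superOne) (q := logSlope 0 superOuter)
    (fun r hr => by
      have := sqI meanRadius_nonneg hr
      rw [meanRadius_sq] at this
      exact hasDerivAt_logSlope _ (superOne_pos (by linarith) (by linarith)).ne')
    (fun r hr => by
      have := sqI meanRadius_nonneg hr
      rw [meanRadius_sq] at this
      exact hasDerivAt_logSlope _ (superOuter_pos (by linarith) (by linarith)).ne')
    (fun r hr => by
      have := sqI meanRadius_nonneg hr
      rw [meanRadius_sq] at this
      refine logSlope_riccati (superOne_pos (by linarith) (by linarith)) ?_
      have := superOne_strict_mode hδ (s := r ^ 2) (by linarith) (by linarith)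
      norm_num at this ⊢
      exact this)
    (fun r hr => by
      have := sqI meanRadius_nonneg hr
      rw [meanRadius_sq] at this
      refine (logSlope_riccati (superOuter_pos (by linarith) (by linarith)) ?_).trans (by norm_num)
      have := superOuter_strict hδ (s := r ^ 2) (by linarith) (by linarith)
      norm_num at this ⊢
      exact this)
  have hG : Continuous (Function.uncurry fun r θ =>
      r * (R r θ ^ 2 + S r θ ^ 2 - (3 * pot δ (r ^ 2) + 1 / 1000) * F r θ ^ 2)) :=
    continuous_fst.mul (((hR.pow 2).add (hS.pow 2)).sub ((hg'.comp continuous_fst).mul (hF.pow 2)))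
  have hi := continuous_parametric_intervalIntegral_of_continuous' (μ := volume) hG a b
  rw [← integral_add_adjacent_intervals (hi.intervalIntegrable 0 meanRadius)
    (hi.intervalIntegrable meanRadius 1)]
  have hL' : b - a ≠ 0 := (sub_pos.2 hL).ne'
  have e0 : logSlope 0 superInner 0 = 0 := by simp [logSlope]
  have z : (b - a) * F 0 0 ^ 2 - ((b - a) * F 0 0) ^ 2 / (b - a) = 0 := by
    field_simp
    ring
  simp only [h0, h1, hm, e0, intervalIntegral.integral_const, smul_eq_mul, z] at I O
  simp only [ne_eq, OfNat.ofNat_ne_zero, not_false_eq_true, zero_pow, mul_zero, zero_div,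
    sub_zero, add_zero, zero_mul] at I O
  linarith

theorem isCompact_closedDisk : IsCompact {q : ℝ × ℝ | q.1 ^ 2 + q.2 ^ 2 ≤ 1} := by
  refine ((isCompact_Icc (a := (-1 : ℝ)) (b := 1)).prod
    (isCompact_Icc (a := (-1 : ℝ)) (b := 1))).of_isClosed_subset
    (isClosed_le (by fun_prop) (by fun_prop)) fun q hq => ?_
  rw [Set.mem_ofPred_eq] at hq
  exact ⟨⟨by nlinarith [sq_nonneg q.2], by nlinarith [sq_nonneg q.2]⟩,
    ⟨by nlinarith [sq_nonneg q.1], by nlinarith [sq_nonneg q.1]⟩⟩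

theorem isOpen_unitDisk : IsOpen unitDisk := isOpen_lt (by fun_prop) (by fun_prop)

theorem unitDisk_subset_closedDisk : unitDisk ⊆ {q : ℝ × ℝ | q.1 ^ 2 + q.2 ^ 2 ≤ 1} :=
  fun q (hq : q.1 ^ 2 + q.2 ^ 2 < 1) => hq.le

theorem ContinuousOn.integrableOn_unitDisk {f : ℝ × ℝ → ℝ}
    (hf : ContinuousOn f {q | q.1 ^ 2 + q.2 ^ 2 ≤ 1}) : IntegrableOn f unitDisk :=
  (hf.integrableOn_compact isCompact_closedDisk).mono_set unitDisk_subset_closedDisk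

theorem polar_sq_add_sq (r θ : ℝ) : (r * cos θ) ^ 2 + (r * sin θ) ^ 2 = r ^ 2 := by
  nlinarith [sin_sq_add_cos_sq θ]

theorem setIntegral_unitDisk_eq {f : ℝ × ℝ → ℝ}
    (hf : ContinuousOn f {q | q.1 ^ 2 + q.2 ^ 2 ≤ 1}) :
    ∫ q in unitDisk, f q =
      ∫ r in (0 : ℝ)..1, ∫ θ in -π..π, r * f (r * cos θ, r * sin θ) := by
  have hc : ContinuousOn (fun p : ℝ × ℝ => p.1 * f (p.1 * cos p.2, p.1 * sin p.2))
      (Icc 0 1 ×ˢ Icc (-π) π) := by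
    refine continuousOn_fst.mul (hf.comp (by fun_prop) fun p hp => ?_)
    rw [Set.mem_ofPred_eq, polar_sq_add_sq]
    exact pow_le_one₀ hp.1.1 hp.1.2
  have hi : IntegrableOn (fun p : ℝ × ℝ => p.1 * f (p.1 * cos p.2, p.1 * sin p.2))
      (Ioc 0 1 ×ˢ Ioc (-π) π) (volume.prod volume) :=
    (hc.integrableOn_compact (isCompact_Icc.prod isCompact_Icc)).mono_set
      (prod_mono Ioc_subset_Icc_self Ioc_subset_Icc_self)
  rw [integral_of_le zero_le_one]
  simp_rw [integral_of_le (neg_le_self pi_pos.le)]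
  rw [← setIntegral_prod _ hi, ← MeasureTheory.integral_indicator isOpen_unitDisk.measurableSet,
    ← integral_comp_polarCoord_symm, ← Measure.volume_eq_prod]
  rw [← MeasureTheory.integral_indicator polarCoord.open_target.measurableSet,
    ← MeasureTheory.integral_indicator (measurableSet_Ioc.prod measurableSet_Ioc)]
  have hne : ∀ᵐ p : ℝ × ℝ, p.1 ≠ 1 ∧ p.2 ≠ π :=
    (Measure.quasiMeasurePreserving_fst.ae (Measure.ae_ne volume 1)).and
      (Measure.quasiMeasurePreserving_snd.ae (Measure.ae_ne volume π))
  refine integral_congr_ae ?_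
  filter_upwards [hne] with p hp
  by_cases h : p ∈ polarCoord.target
  · rw [indicator_of_mem h]
    have h2 : 0 < p.1 ∧ -π < p.2 ∧ p.2 < π := by simpa [polarCoord_target] using h
    have hu : polarCoord.symm p ∈ unitDisk ↔ p.1 < 1 := by
      rw [polarCoord_symm_apply, unitDisk, Set.mem_ofPred_eq, polar_sq_add_sq]
      exact pow_lt_one_iff_of_nonneg h2.1.le two_ne_zero
    have hm : p ∈ Ioc (0 : ℝ) 1 ×ˢ Ioc (-π) π ↔ p.1 ≤ 1 :=
      ⟨fun h => h.1.2, fun h => ⟨⟨h2.1, h⟩, h2.2.1, h2.2.2.le⟩⟩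
    by_cases h3 : p.1 < 1
    · rw [indicator_of_mem (hu.2 h3), indicator_of_mem (hm.2 h3.le)]
      rfl
    · rw [indicator_of_notMem (mt hu.1 h3), smul_zero, indicator_of_notMem]
      exact fun h4 => h3 (lt_of_le_of_ne h4.1.2 hp.1)
  · rw [indicator_of_notMem h, indicator_of_notMem]
    rintro ⟨h2, h3⟩
    exact h ⟨h2.1, h3.1, lt_of_le_of_ne h3.2 hp.2⟩

end Coercivity

section Coercivity

open Real Set IntPoly intervalIntegral

/-- The integral of a function over the `i`-th of three arcs of the circle of radius
`meanRadius`. -/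
noncomputable def arcIntegral (i : Fin 3) (v : ℝ × ℝ → ℝ) : ℝ :=
  ∫ θ in (-π + i * (2 * π / 3))..(-π + (i + 1) * (2 * π / 3)),
    v (meanRadius * cos θ, meanRadius * sin θ)

theorem clm_apply_prod (l : ℝ × ℝ →L[ℝ] ℝ) (x y : ℝ) : l (x, y) = x * l (1, 0) + y * l (0, 1) := by
  rw [← smul_eq_mul, ← smul_eq_mul, ← map_smul, ← map_smul, ← map_add]
  simp

theorem gradSq_eq {v : ℝ × ℝ → ℝ} {q : ℝ × ℝ} (hv : DifferentiableAt ℝ v q) :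
    gradSq v q = fderiv ℝ v q (1, 0) ^ 2 + fderiv ℝ v q (0, 1) ^ 2 := by
  rw [gradSq, deriv_fst_eq hv, deriv_snd_eq hv]

theorem continuous_gradSq {v : ℝ × ℝ → ℝ} (hv : ContDiff ℝ 1 v) : Continuous (gradSq v) := by
  have h : gradSq v = fun q => fderiv ℝ v q (1, 0) ^ 2 + fderiv ℝ v q (0, 1) ^ 2 :=
    funext fun q => gradSq_eq (hv.differentiable one_ne_zero q)
  have := hv.continuous_fderiv one_ne_zero
  rw [h]
  fun_prop

/-- The second variation of the unperturbed problem is coercive on functions whose integrals over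
three arcs vanish. -/
theorem energy_nonneg_of_arcIntegral_eq_zero {v : ℝ × ℝ → ℝ} (hv : ContDiff ℝ 1 v) {δ : ℝ}
    (hδ : |δ| ≤ 1) (hg : Continuous (pot δ)) (h1 : ∀ q : ℝ × ℝ, q.1 ^ 2 + q.2 ^ 2 = 1 → v q = 0)
    (hm : ∀ i, arcIntegral i v = 0) :
    0 ≤ ∫ q in unitDisk,
      (gradSq v q - (3 * pot δ (q.1 ^ 2 + q.2 ^ 2) + 1 / 1000) * v q ^ 2) := by
  have hvd := hv.differentiable one_ne_zero
  have hvc := hv.continuous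
  have hv' := hv.continuous_fderiv one_ne_zero
  have hG := continuous_gradSq hv
  rw [setIntegral_unitDisk_eq (Continuous.continuousOn (by fun_prop))]
  set F : ℝ → ℝ → ℝ := fun r θ => v (r * cos θ, r * sin θ) with hF
  set R : ℝ → ℝ → ℝ := fun r θ => fderiv ℝ v (r * cos θ, r * sin θ) (cos θ, sin θ) with hR
  set S : ℝ → ℝ → ℝ := fun r θ => fderiv ℝ v (r * cos θ, r * sin θ) (-sin θ, cos θ) with hS
  have cF : Continuous (Function.uncurry F) := by
    change Continuous fun p : ℝ × ℝ => v (p.1 * cos p.2, p.1 * sin p.2)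
    fun_prop
  have cR : Continuous (Function.uncurry R) := by
    change Continuous fun p : ℝ × ℝ =>
      fderiv ℝ v (p.1 * cos p.2, p.1 * sin p.2) (cos p.2, sin p.2)
    exact (hv'.comp (by fun_prop)).clm_apply (by fun_prop)
  have cS : Continuous (Function.uncurry S) := by
    change Continuous fun p : ℝ × ℝ =>
      fderiv ℝ v (p.1 * cos p.2, p.1 * sin p.2) (-sin p.2, cos p.2)
    exact (hv'.comp (by fun_prop)).clm_apply (by fun_prop)
  have dR : ∀ r θ, HasDerivAt (fun r => F r θ) (R r θ) r := fun r θ => by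
    have h := (hasDerivAt_mul_const (x := r) (cos θ)).prodMk (hasDerivAt_mul_const (sin θ))
    exact (hvd (r * cos θ, r * sin θ)).hasFDerivAt.comp_hasDerivAt r h
  have dS : ∀ r θ, HasDerivAt (F r) (r * S r θ) θ := fun r θ => by
    have h := ((hasDerivAt_cos θ).const_mul r).prodMk ((hasDerivAt_sin θ).const_mul r)
    refine ((hvd (r * cos θ, r * sin θ)).hasFDerivAt.comp_hasDerivAt θ h).congr_deriv ?_
    simp only [hS]
    rw [clm_apply_prod, clm_apply_prod _ (-sin θ)]
    ring
  have e : ∀ r θ : ℝ, r * (gradSq v (r * cos θ, r * sin θ) -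
      (3 * pot δ ((r * cos θ) ^ 2 + (r * sin θ) ^ 2) + 1 / 1000) *
        v (r * cos θ, r * sin θ) ^ 2) =
      r * (R r θ ^ 2 + S r θ ^ 2 - (3 * pot δ (r ^ 2) + 1 / 1000) * F r θ ^ 2) := by
    intro r θ
    have e1 : R r θ = cos θ * fderiv ℝ v (r * cos θ, r * sin θ) (1, 0) +
        sin θ * fderiv ℝ v (r * cos θ, r * sin θ) (0, 1) := by
      exact clm_apply_prod _ _ _
    have e2 : S r θ = -sin θ * fderiv ℝ v (r * cos θ, r * sin θ) (1, 0) +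
        cos θ * fderiv ℝ v (r * cos θ, r * sin θ) (0, 1) := by
      exact clm_apply_prod _ _ _
    rw [polar_sq_add_sq, gradSq_eq (hvd _), e1, e2]
    simp only [hF]
    have := sin_sq_add_cos_sq θ
    generalize fderiv ℝ v (r * cos θ, r * sin θ) (1, 0) = x
    generalize fderiv ℝ v (r * cos θ, r * sin θ) (0, 1) = y
    linear_combination -r * (x ^ 2 + y ^ 2) * this
  simp only [e]
  have hg' : Continuous fun r : ℝ => 3 * pot δ (r ^ 2) + 1 / 1000 := by fun_prop
  have hc : Continuous (Function.uncurry fun r θ =>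
      r * (R r θ ^ 2 + S r θ ^ 2 - (3 * pot δ (r ^ 2) + 1 / 1000) * F r θ ^ 2)) :=
    continuous_fst.mul (((cR.pow 2).add (cS.pow 2)).sub ((hg'.comp continuous_fst).mul (cF.pow 2)))
  have hs : ∀ i : Fin 3, 0 ≤ ∫ r in (0 : ℝ)..1,
      ∫ θ in (-π + i * (2 * π / 3))..(-π + (i + 1) * (2 * π / 3)),
      r * (R r θ ^ 2 + S r θ ^ 2 - (3 * pot δ (r ^ 2) + 1 / 1000) * F r θ ^ 2) := fun i =>
    sector_energy_nonneg cF cR cS dR dS hδ hg (by ring) (fun θ => by simp [hF])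
      (fun θ => h1 _ (by rw [polar_sq_add_sq, one_pow])) (hm i)
  have ci := fun a b => (continuous_parametric_intervalIntegral_of_continuous' (μ := volume)
    hc a b).intervalIntegrable (μ := volume) 0 1
  have key := Finset.sum_nonneg fun i (_ : i ∈ Finset.univ) => hs i
  rw [Fin.sum_univ_three, ← intervalIntegral.integral_add (ci _ _) (ci _ _),
    ← intervalIntegral.integral_add ((ci _ _).add (ci _ _)) (ci _ _)] at key
  refine key.trans_eq (intervalIntegral.integral_congr fun r _ => ?_)
  have cr := fun a b => (hc.uncurry_left r).intervalIntegrable (μ := volume) a b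
  simp only [Fin.val_zero, Fin.val_one, Fin.val_two, Nat.cast_zero, Nat.cast_one, Nat.cast_ofNat,
    zero_add, zero_mul, add_zero]
  rw [one_add_one_eq_two, integral_add_adjacent_intervals (cr _ _) (cr _ _),
    integral_add_adjacent_intervals (cr _ _) (cr _ _)]
  congr 1
  ring

end Coercivity

section Cutoff

open Real Set

theorem continuous_mul_of_tsupport_subset_unitDisk {φ f : ℝ × ℝ → ℝ} (hφ : Continuous φ)
    (hs : tsupport φ ⊆ unitDisk) (hf : ContinuousOn f unitDisk) :
    Continuous fun q => φ q * f q := by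
  refine continuous_of_tsupport fun q hq => ?_
  have hq' : q ∈ unitDisk := hs (tsupport_mul_subset_left hq)
  exact hφ.continuousAt.mul (hf.continuousAt (isOpen_unitDisk.mem_nhds hq'))

theorem setIntegral_unitDisk_of_tsupport_subset {φ : ℝ × ℝ → ℝ} (hs : tsupport φ ⊆ unitDisk) :
    ∫ q in unitDisk, φ q = ∫ q, φ q :=
  setIntegral_eq_integral_of_forall_compl_eq_zero fun _ hq =>
    image_eq_zero_of_notMem_tsupport fun h => hq (hs h)

theorem integral_fderiv_mul_fderiv {φ f : ℝ × ℝ → ℝ} (hφ : ContDiff ℝ 1 φ)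
    (hc : HasCompactSupport φ) (hs : tsupport φ ⊆ unitDisk)
    (hf : ∀ q ∈ unitDisk, AnalyticAt ℝ f q) (v : ℝ × ℝ) :
    IntegrableOn (fun q => fderiv ℝ φ q v * fderiv ℝ f q v) unitDisk ∧
    IntegrableOn (fun q => φ q * fderiv ℝ (fun q => fderiv ℝ f q v) q v) unitDisk ∧
    ∫ q in unitDisk, fderiv ℝ φ q v * fderiv ℝ f q v =
      -∫ q in unitDisk, φ q * fderiv ℝ (fun q => fderiv ℝ f q v) q v := by
  have hf1 := fun q hq => (hf q hq).fderiv_apply_vec v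
  have hf2 := fun q hq => (hf1 q hq).fderiv_apply_vec v
  have hs' : tsupport (fun q => fderiv ℝ φ q v) ⊆ unitDisk :=
    (tsupport_fderiv_apply_subset ℝ v).trans hs
  have cφ' : Continuous fun q => fderiv ℝ φ q v :=
    (hφ.continuous_fderiv one_ne_zero).clm_apply continuous_const
  have c1 := continuous_mul_of_tsupport_subset_unitDisk cφ' hs'
    fun q hq => (hf1 q hq).continuousAt.continuousWithinAt
  have c2 := continuous_mul_of_tsupport_subset_unitDisk hφ.continuous hs
    fun q hq => (hf2 q hq).continuousAt.continuousWithinAt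
  have c3 := continuous_mul_of_tsupport_subset_unitDisk hφ.continuous hs
    fun q hq => (hf1 q hq).continuousAt.continuousWithinAt
  have i1 : Integrable fun q => fderiv ℝ φ q v * fderiv ℝ f q v :=
    c1.integrable_of_hasCompactSupport (hc.fderiv_apply ℝ v).mul_right
  have i2 : Integrable fun q => φ q * fderiv ℝ (fun q => fderiv ℝ f q v) q v :=
    c2.integrable_of_hasCompactSupport hc.mul_right
  have i3 : Integrable fun q => φ q * fderiv ℝ f q v :=
    c3.integrable_of_hasCompactSupport hc.mul_right
  refine ⟨i1.integrableOn, i2.integrableOn, ?_⟩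
  rw [setIntegral_unitDisk_of_tsupport_subset (tsupport_mul_subset_left.trans hs'),
    setIntegral_unitDisk_of_tsupport_subset (tsupport_mul_subset_left.trans hs),
    integral_mul_fderiv_eq_neg_fderiv_mul_of_integrable i1 i2 i3
    (fun q _ => hφ.differentiable one_ne_zero q) (fun q hq => (hf1 q (hs hq)).differentiableAt),
    neg_neg]

theorem contDiff_mul_of_tsupport_subset_unitDisk {χ f : ℝ × ℝ → ℝ} {n : ℕ∞}
    (hχ : ContDiff ℝ n χ) (hs : tsupport χ ⊆ unitDisk) (hf : ∀ q ∈ unitDisk, AnalyticAt ℝ f q) :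
    ContDiff ℝ n fun q => χ q * f q := by
  refine contDiff_iff_contDiffAt.2 fun q => ?_
  by_cases hq : q ∈ tsupport χ
  · exact hχ.contDiffAt.mul (hf q (hs hq)).contDiffAt
  · refine (contDiffAt_const (c := (0 : ℝ))).congr_of_eventuallyEq ?_
    filter_upwards [notMem_tsupport_iff_eventuallyEq.1 hq] with p hp
    simp [hp]

/-- The Dirichlet energy of the sum of a test function and a truncated analytic function. -/
theorem integral_gradSq_add_mul {v χ f : ℝ × ℝ → ℝ} (hv : ContDiff ℝ 1 v)
    (hvs : tsupport v ⊆ unitDisk) (hvc : HasCompactSupport v) (hχ : ContDiff ℝ 1 χ)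
    (hχs : tsupport χ ⊆ unitDisk) (hχc : HasCompactSupport χ)
    (hf : ∀ q ∈ unitDisk, AnalyticAt ℝ f q) (h1 : ∀ q ∈ tsupport v, χ =ᶠ[nhds q] 1) :
    ∫ q in unitDisk, gradSq (fun q => v q + χ q * f q) q =
      (∫ q in unitDisk, gradSq v q) + (∫ q in unitDisk, gradSq χ q * f q ^ 2) -
      ∫ q in unitDisk, (2 * v q + χ q ^ 2 * f q) * lapF f q := by
  set φ : ℝ × ℝ → ℝ := fun q => 2 * v q + χ q ^ 2 * f q with hφ
  have cχ2 : ContDiff ℝ 1 fun q => χ q ^ 2 * f q := by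
    have := contDiff_mul_of_tsupport_subset_unitDisk (n := 1) hχ hχs hf
    have h2 := hχ.mul this
    simpa only [pow_two, mul_assoc] using h2
  have sφ : tsupport φ ⊆ tsupport v ∪ tsupport χ := by
    refine closure_minimal (fun q hq => ?_) ((isClosed_tsupport v).union (isClosed_tsupport χ))
    by_contra hn
    rw [mem_union, not_or] at hn
    refine hq ?_
    simp [hφ, image_eq_zero_of_notMem_tsupport hn.1, image_eq_zero_of_notMem_tsupport hn.2]
  have dφ : ContDiff ℝ 1 φ := (contDiff_const.mul hv).add cχ2
  have hφs : tsupport φ ⊆ unitDisk := sφ.trans (union_subset hvs hχs)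
  have hφc : HasCompactSupport φ :=
    (hvc.isCompact.union hχc.isCompact).of_isClosed_subset (isClosed_tsupport φ) sφ
  obtain ⟨i1, j1, k1⟩ := integral_fderiv_mul_fderiv dφ hφc hφs hf (1, 0)
  obtain ⟨i2, j2, k2⟩ := integral_fderiv_mul_fderiv dφ hφc hφs hf (0, 1)
  have dv := hv.differentiable one_ne_zero
  have dχ := hχ.differentiable one_ne_zero
  have e : ∀ q ∈ unitDisk, gradSq (fun q => v q + χ q * f q) q = gradSq v q +
      gradSq χ q * f q ^ 2 + (fderiv ℝ φ q (1, 0) * fderiv ℝ f q (1, 0) +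
        fderiv ℝ φ q (0, 1) * fderiv ℝ f q (0, 1)) := by
    intro q hq
    have df := (hf q hq).differentiableAt
    have e1 : ∀ w, fderiv ℝ (fun q => v q + χ q * f q) q w =
        fderiv ℝ v q w + (χ q * fderiv ℝ f q w + f q * fderiv ℝ χ q w) := fun w => by
      have := ((dv q).hasFDerivAt.add ((dχ q).hasFDerivAt.mul df.hasFDerivAt)).fderiv
      have e0 : (fun q => v q + χ q * f q) = v + χ * f := rfl
      rw [e0, this]
      simp
    have e2 : ∀ w, fderiv ℝ φ q w = 2 * fderiv ℝ v q w +
        (χ q ^ 2 * fderiv ℝ f q w + 2 * f q * χ q * fderiv ℝ χ q w) := fun w => by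
      have := (((dv q).hasFDerivAt.const_mul 2).add
        (((dχ q).hasFDerivAt.pow 2).mul df.hasFDerivAt)).fderiv
      have e0 : φ = (fun q => 2 * v q) + (fun q => χ q ^ 2) * f := rfl
      rw [e0, this]
      simp
      ring
    have dz : DifferentiableAt ℝ (fun q => v q + χ q * f q) q := (dv q).add ((dχ q).mul df)
    rw [gradSq_eq dz, gradSq_eq (dv q), gradSq_eq (dχ q), e1, e1, e2, e2]
    by_cases hq' : q ∈ tsupport v
    · have h0 : fderiv ℝ χ q = 0 := by
        rw [(h1 q hq').fderiv_eq]
        exact fderiv_const_apply 1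
      have h2 : χ q = 1 := (h1 q hq').eq_of_nhds
      rw [h0, h2]
      simp
      ring
    · have h0 : fderiv ℝ v q = 0 := image_eq_zero_of_notMem_tsupport fun h =>
        hq' (tsupport_fderiv_subset ℝ h)
      rw [h0]
      simp
      ring
  have cG1 : IntegrableOn (gradSq v) unitDisk :=
    (continuous_gradSq hv).continuousOn.integrableOn_unitDisk
  have cG2 : IntegrableOn (fun q => gradSq χ q * f q ^ 2) unitDisk := by
    have hs' : tsupport (gradSq χ) ⊆ tsupport χ := by
      refine closure_minimal (fun q hq => ?_) (isClosed_tsupport χ)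
      by_contra hn
      refine hq ?_
      have h0 : fderiv ℝ χ q = 0 := image_eq_zero_of_notMem_tsupport fun h =>
        hn (tsupport_fderiv_subset ℝ h)
      rw [gradSq_eq (dχ q), h0]
      simp
    have := continuous_mul_of_tsupport_subset_unitDisk (continuous_gradSq hχ) (hs'.trans hχs)
      (f := fun q => f q ^ 2) fun q hq => ((hf q hq).continuousAt.pow 2).continuousWithinAt
    exact this.continuousOn.integrableOn_unitDisk
  have e3 := integral_add (cG1.add cG2) (i1.add i2)
  have e4 := integral_add i1 i2
  have e5 := integral_add cG1 cG2
  have e6 := integral_add j1 j2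
  simp only [Pi.add_apply, ← mul_add] at e3 e4 e5 e6
  rw [setIntegral_congr_fun isOpen_unitDisk.measurableSet e, e3, e4, e5, k1, k2, sub_eq_add_neg,
    ← neg_add, ← e6]
  rfl

end Cutoff

section CutoffSequence

open Real Set Filter Topology

theorem convex_closedDisk : Convex ℝ {q : ℝ × ℝ | q.1 ^ 2 + q.2 ^ 2 ≤ 1} := by
  intro p (hp : p.1 ^ 2 + p.2 ^ 2 ≤ 1) q (hq : q.1 ^ 2 + q.2 ^ 2 ≤ 1) a b ha hb hab
  have h : b = 1 - a := by linarith
  subst h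
  change (a * p.1 + (1 - a) * q.1) ^ 2 + (a * p.2 + (1 - a) * q.2) ^ 2 ≤ 1
  nlinarith [mul_nonneg (mul_nonneg ha hb) (add_nonneg (sq_nonneg (p.1 - q.1))
    (sq_nonneg (p.2 - q.2))), mul_nonneg ha (sub_nonneg.2 hp), mul_nonneg hb (sub_nonneg.2 hq)]

theorem exists_polar (q : ℝ × ℝ) :
    ∃ r θ : ℝ, 0 ≤ r ∧ q = (r * cos θ, r * sin θ) :=
  ⟨‖(⟨q.1, q.2⟩ : ℂ)‖, Complex.arg ⟨q.1, q.2⟩, norm_nonneg _, by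
    rw [Complex.norm_mul_cos_arg, Complex.norm_mul_sin_arg]⟩

/-- An analytic function vanishing on the unit circle is bounded by the distance to it. -/
theorem exists_abs_le_mul_one_sub {f : ℝ × ℝ → ℝ}
    (hf : ∀ q : ℝ × ℝ, q.1 ^ 2 + q.2 ^ 2 ≤ 1 → AnalyticAt ℝ f q)
    (h1 : ∀ q : ℝ × ℝ, q.1 ^ 2 + q.2 ^ 2 = 1 → f q = 0) :
    ∃ C, 0 ≤ C ∧ ∀ q : ℝ × ℝ, q.1 ^ 2 + q.2 ^ 2 ≤ 1 → |f q| ≤ C * (1 - (q.1 ^ 2 + q.2 ^ 2)) := by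
  have hc : ContinuousOn (fderiv ℝ f) {q : ℝ × ℝ | q.1 ^ 2 + q.2 ^ 2 ≤ 1} := fun q hq =>
    (hf q hq).fderiv.continuousAt.continuousWithinAt
  obtain ⟨C, hC⟩ := isCompact_closedDisk.exists_bound_of_continuousOn hc
  have hC0 : 0 ≤ C := (norm_nonneg _).trans (hC (0, 0) (by simp))
  refine ⟨C, hC0, fun q hq => ?_⟩
  obtain ⟨r, θ, hr, rfl⟩ := exists_polar q
  have hm : ((cos θ, sin θ) : ℝ × ℝ) ∈ {q : ℝ × ℝ | q.1 ^ 2 + q.2 ^ 2 ≤ 1} :=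
    (cos_sq_add_sin_sq θ).le
  have key := convex_closedDisk.norm_image_sub_le_of_norm_fderiv_le
    (fun x hx => (hf x hx).differentiableAt) hC hm hq
  rw [h1 (cos θ, sin θ) (cos_sq_add_sin_sq θ), sub_zero, Real.norm_eq_abs] at key
  refine key.trans (mul_le_mul_of_nonneg_left ?_ hC0)
  simp only [polar_sq_add_sq] at hq ⊢
  have hr1 : r ≤ 1 := by nlinarith
  have h2 : 1 - r ≤ 1 - r ^ 2 := by nlinarith
  refine le_trans ?_ h2
  rw [Prod.mk_sub_mk, Prod.norm_def, max_le_iff]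
  have h3 : ∀ x : ℝ, |x| ≤ 1 → |r * x - x| ≤ 1 - r := fun x hx => by
    have : r * x - x = -(1 - r) * x := by ring
    rw [this, abs_mul, abs_neg, abs_of_nonneg (by linarith : 0 ≤ 1 - r)]
    exact mul_le_of_le_one_right (by linarith) hx
  exact ⟨h3 _ (abs_cos_le_one θ), h3 _ (abs_sin_le_one θ)⟩

/-- Radial cutoff functions exhausting the unit disk. -/
noncomputable def cutoff (n : ℕ) (q : ℝ × ℝ) : ℝ :=
  smoothTransition (n * (1 - (q.1 ^ 2 + q.2 ^ 2)) - 1)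

theorem contDiff_cutoff (n : ℕ) (k : ℕ∞) : ContDiff ℝ k (cutoff n) :=
  smoothTransition.contDiff.comp (by fun_prop)

theorem cutoff_nonneg (n : ℕ) (q : ℝ × ℝ) : 0 ≤ cutoff n q := smoothTransition.nonneg _

theorem cutoff_le_one (n : ℕ) (q : ℝ × ℝ) : cutoff n q ≤ 1 := smoothTransition.le_one _

theorem cutoff_congr (n : ℕ) {p q : ℝ × ℝ} (h : p.1 ^ 2 + p.2 ^ 2 = q.1 ^ 2 + q.2 ^ 2) :
    cutoff n p = cutoff n q := by
  rw [cutoff, cutoff, h]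

theorem tsupport_cutoff_subset (n : ℕ) : tsupport (cutoff n) ⊆ unitDisk := by
  have h : tsupport (cutoff n) ⊆ {q : ℝ × ℝ | 1 ≤ n * (1 - (q.1 ^ 2 + q.2 ^ 2))} := by
    refine closure_minimal (fun q hq => ?_) (isClosed_le (by fun_prop) (by fun_prop))
    rw [Set.mem_ofPred_eq]
    by_contra hn
    exact hq (smoothTransition.zero_of_nonpos (by linarith))
  refine h.trans fun q (hq : 1 ≤ n * (1 - (q.1 ^ 2 + q.2 ^ 2))) => ?_
  change q.1 ^ 2 + q.2 ^ 2 < 1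
  by_contra hn
  have := mul_nonpos_of_nonneg_of_nonpos n.cast_nonneg (by linarith : 1 - (q.1 ^ 2 + q.2 ^ 2) ≤ 0)
  linarith

theorem hasCompactSupport_of_tsupport_subset_unitDisk {χ : ℝ × ℝ → ℝ} (h : tsupport χ ⊆ unitDisk) :
    HasCompactSupport χ :=
  isCompact_closedDisk.of_isClosed_subset (isClosed_tsupport χ)
    (h.trans unitDisk_subset_closedDisk)

theorem cutoff_eventuallyEq_one {n : ℕ} {q : ℝ × ℝ} (h : 2 < n * (1 - (q.1 ^ 2 + q.2 ^ 2))) :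
    cutoff n =ᶠ[𝓝 q] 1 := by
  have ho : IsOpen {q : ℝ × ℝ | 2 < n * (1 - (q.1 ^ 2 + q.2 ^ 2))} :=
    isOpen_lt (by fun_prop) (by fun_prop)
  filter_upwards [ho.mem_nhds h] with p hp
  exact smoothTransition.one_of_one_le (by linarith)

theorem eventually_cutoff_eventuallyEq_one {K : Set (ℝ × ℝ)} (hK : IsCompact K)
    (hs : K ⊆ unitDisk) : ∀ᶠ n in atTop, ∀ q ∈ K, cutoff n =ᶠ[𝓝 q] 1 := by
  rcases K.eq_empty_or_nonempty with rfl | hne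
  · simp
  obtain ⟨p, hp, hpm⟩ := hK.exists_isMaxOn hne (f := fun q : ℝ × ℝ => q.1 ^ 2 + q.2 ^ 2)
    (Continuous.continuousOn (by fun_prop))
  have hp1 : 0 < 1 - (p.1 ^ 2 + p.2 ^ 2) := sub_pos.2 (hs hp)
  filter_upwards [(tendsto_natCast_atTop_atTop (R := ℝ)).eventually_gt_atTop
    (2 / (1 - (p.1 ^ 2 + p.2 ^ 2)))] with n hn q hq
  rw [div_lt_iff₀ hp1] at hn
  have : q.1 ^ 2 + q.2 ^ 2 ≤ p.1 ^ 2 + p.2 ^ 2 := hpm hq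
  exact cutoff_eventuallyEq_one (hn.trans_le (by gcongr))

theorem deriv_smoothTransition_eq_zero {t : ℝ} (ht : t ∉ Icc (0 : ℝ) 1) :
    deriv smoothTransition t = 0 := by
  rw [mem_Icc, not_and_or, not_le, not_le] at ht
  rcases ht with h | h
  · have : smoothTransition =ᶠ[𝓝 t] fun _ => 0 := by
      filter_upwards [Iio_mem_nhds h] with s hs
      exact smoothTransition.zero_of_nonpos (le_of_lt hs)
    rw [this.deriv_eq, deriv_const]
  · have : smoothTransition =ᶠ[𝓝 t] fun _ => 1 := by
      filter_upwards [Ioi_mem_nhds h] with s hs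
      exact smoothTransition.one_of_one_le (le_of_lt hs)
    rw [this.deriv_eq, deriv_const]

theorem gradSq_cutoff (n : ℕ) (q : ℝ × ℝ) : gradSq (cutoff n) q =
    (deriv smoothTransition (n * (1 - (q.1 ^ 2 + q.2 ^ 2)) - 1) * n) ^ 2 *
      (4 * (q.1 ^ 2 + q.2 ^ 2)) := by
  have hd : ∀ t, HasDerivAt smoothTransition (deriv smoothTransition t) t := fun t =>
    ((smoothTransition.contDiff (n := 1)).differentiable one_ne_zero t).hasDerivAt
  have hx : HasDerivAt (fun x => cutoff n (x, q.2))
      (deriv smoothTransition (n * (1 - (q.1 ^ 2 + q.2 ^ 2)) - 1) * (n * -(2 * q.1))) q.1 := by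
    have h1 : HasDerivAt (fun x : ℝ => (n : ℝ) * (1 - (x ^ 2 + q.2 ^ 2)) - 1)
        (n * -(2 * q.1)) q.1 := by
      have := ((((hasDerivAt_pow 2 q.1).add_const (q.2 ^ 2)).const_sub 1).const_mul
        (n : ℝ)).sub_const 1
      simpa using this
    exact (hd _).comp q.1 h1
  have hy : HasDerivAt (fun y => cutoff n (q.1, y))
      (deriv smoothTransition (n * (1 - (q.1 ^ 2 + q.2 ^ 2)) - 1) * (n * -(2 * q.2))) q.2 := by
    have h1 : HasDerivAt (fun y : ℝ => (n : ℝ) * (1 - (q.1 ^ 2 + y ^ 2)) - 1)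
        (n * -(2 * q.2)) q.2 := by
      have := ((((hasDerivAt_pow 2 q.2).const_add (q.1 ^ 2)).const_sub 1).const_mul
        (n : ℝ)).sub_const 1
      simpa using this
    exact (hd _).comp q.2 h1
  rw [gradSq, hx.deriv, hy.deriv]
  ring

theorem tendsto_integral_gradSq_cutoff {f : ℝ × ℝ → ℝ}
    (hf : ∀ q : ℝ × ℝ, q.1 ^ 2 + q.2 ^ 2 ≤ 1 → AnalyticAt ℝ f q)
    (h1 : ∀ q : ℝ × ℝ, q.1 ^ 2 + q.2 ^ 2 = 1 → f q = 0) :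
    Tendsto (fun n => ∫ q in unitDisk, gradSq (cutoff n) q * f q ^ 2) atTop (𝓝 0) := by
  obtain ⟨C, hC0, hC⟩ := exists_abs_le_mul_one_sub hf h1
  have hcd : Continuous (deriv smoothTransition) :=
    (smoothTransition.contDiff (n := 1)).continuous_deriv_one
  obtain ⟨M, hM⟩ := (isCompact_Icc (a := (0 : ℝ)) (b := 1)).exists_bound_of_continuousOn
    hcd.continuousOn
  have hM0 : 0 ≤ M := (norm_nonneg _).trans (hM 0 (by simp))
  have hcf : ContinuousOn f {q : ℝ × ℝ | q.1 ^ 2 + q.2 ^ 2 ≤ 1} := fun q hq =>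
    (hf q hq).continuousAt.continuousWithinAt
  have key := tendsto_integral_of_dominated_convergence (μ := volume.restrict unitDisk)
    (F := fun n q => gradSq (cutoff n) q * f q ^ 2) (f := fun _ => 0)
    (fun _ => (M * C * 2) ^ 2 * 4) (fun n => ?_) ?_ (fun n => ?_) ?_
  · simpa using key
  · exact (((continuous_gradSq (contDiff_cutoff n 1)).continuousOn.mul
      (hcf.pow 2)).integrableOn_unitDisk).aestronglyMeasurable
  · exact (continuousOn_const).integrableOn_unitDisk
  · refine (ae_restrict_iff' isOpen_unitDisk.measurableSet).2 (Eventually.of_forall fun q hq => ?_)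
    have hq : q.1 ^ 2 + q.2 ^ 2 < 1 := hq
    rw [gradSq_cutoff]
    by_cases ht : (n * (1 - (q.1 ^ 2 + q.2 ^ 2)) - 1 : ℝ) ∈ Icc (0 : ℝ) 1
    · have b1 := hM _ ht
      rw [Real.norm_eq_abs] at b1
      have b2 := hC q hq.le
      have e : (deriv smoothTransition (n * (1 - (q.1 ^ 2 + q.2 ^ 2)) - 1) * n) ^ 2 *
          (4 * (q.1 ^ 2 + q.2 ^ 2)) * f q ^ 2 =
          (deriv smoothTransition (n * (1 - (q.1 ^ 2 + q.2 ^ 2)) - 1) * (n * f q)) ^ 2 *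
          (4 * (q.1 ^ 2 + q.2 ^ 2)) := by ring
      rw [e, Real.norm_eq_abs, abs_mul, abs_pow, abs_mul, abs_mul, Nat.abs_cast,
        abs_of_nonneg (by positivity : 0 ≤ 4 * (q.1 ^ 2 + q.2 ^ 2))]
      have b3 : n * |f q| ≤ C * 2 := by
        calc n * |f q| ≤ n * (C * (1 - (q.1 ^ 2 + q.2 ^ 2))) := by gcongr
          _ = C * (n * (1 - (q.1 ^ 2 + q.2 ^ 2))) := by ring
          _ ≤ C * 2 := by
            gcongr
            linarith [ht.2]
      rw [mul_assoc M]
      gcongr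
      linarith
    · rw [deriv_smoothTransition_eq_zero ht]
      simp only [zero_mul, ne_eq, OfNat.ofNat_ne_zero, not_false_eq_true, zero_pow, norm_zero]
      positivity
  · refine (ae_restrict_iff' isOpen_unitDisk.measurableSet).2 (Eventually.of_forall fun q hq => ?_)
    refine tendsto_const_nhds.congr' ?_
    filter_upwards [eventually_cutoff_eventuallyEq_one (isCompact_singleton (x := q))
      (singleton_subset_iff.2 hq)] with n hn
    have h0 : fderiv ℝ (cutoff n) q = 0 := by
      rw [(hn q rfl).fderiv_eq]
      exact fderiv_const_apply 1
    rw [gradSq_eq ((contDiff_cutoff n 1).differentiable one_ne_zero q), h0]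
    simp

theorem tendsto_integral_cutoff_sq {g : ℝ × ℝ → ℝ}
    (hg : ContinuousOn g {q : ℝ × ℝ | q.1 ^ 2 + q.2 ^ 2 ≤ 1}) :
    Tendsto (fun n => ∫ q in unitDisk, cutoff n q ^ 2 * g q) atTop (𝓝 (∫ q in unitDisk, g q)) := by
  refine tendsto_integral_of_dominated_convergence (fun q => |g q|) (fun n => ?_) ?_
    (fun n => ?_) ?_
  · exact ((((contDiff_cutoff n 1).continuous.pow 2).continuousOn.mul
      hg).integrableOn_unitDisk).aestronglyMeasurable
  · exact hg.abs.integrableOn_unitDisk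
  · refine Eventually.of_forall fun q => ?_
    rw [Real.norm_eq_abs, abs_mul, abs_pow, abs_of_nonneg (cutoff_nonneg n q)]
    exact mul_le_of_le_one_left (abs_nonneg _) (pow_le_one₀ (cutoff_nonneg n q) (cutoff_le_one n q))
  · refine (ae_restrict_iff' isOpen_unitDisk.measurableSet).2 (Eventually.of_forall fun q hq => ?_)
    refine tendsto_const_nhds.congr' ?_
    filter_upwards [eventually_cutoff_eventuallyEq_one (isCompact_singleton (x := q))
      (singleton_subset_iff.2 hq)] with n hn
    rw [(hn q rfl).eq_of_nhds]
    simp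

end CutoffSequence

section LowerIndex

open Real Set Filter Topology

theorem lapF_linear_comb {e o : ℝ × ℝ → ℝ} {q : ℝ × ℝ} (he : AnalyticAt ℝ e q)
    (ho : AnalyticAt ℝ o q) (α β : ℝ) :
    lapF (fun q => α * e q + β * o q) q = α * lapF e q + β * lapF o q := by
  have hF : AnalyticAt ℝ (fun q => (e q, o q)) q := he.prod ho
  have h1 := lapF_clm_comp hF (ContinuousLinearMap.fst ℝ ℝ ℝ)
  have h2 := lapF_clm_comp hF (ContinuousLinearMap.snd ℝ ℝ ℝ)
  have h3 := lapF_clm_comp hF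
    (α • ContinuousLinearMap.fst ℝ ℝ ℝ + β • ContinuousLinearMap.snd ℝ ℝ ℝ)
  simp only [ContinuousLinearMap.coe_fst', ContinuousLinearMap.coe_snd',
    add_apply, smul_apply, smul_eq_mul] at h1 h2 h3
  rw [h3, h1, h2]

theorem setIntegral_unitDisk_eq_zero_of_odd {h : ℝ × ℝ → ℝ} (ho : ∀ q, h (-q) = -h q) :
    ∫ q in unitDisk, h q = 0 := by
  rw [← MeasureTheory.integral_indicator isOpen_unitDisk.measurableSet]
  have e : ∀ q, unitDisk.indicator h (-q) = -unitDisk.indicator h q := fun q => by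
    have hm : -q ∈ unitDisk ↔ q ∈ unitDisk := by simp [unitDisk]
    by_cases hq : q ∈ unitDisk
    · rw [indicator_of_mem hq, indicator_of_mem (hm.2 hq), ho]
    · rw [indicator_of_notMem hq, indicator_of_notMem (fun h => hq (hm.1 h)), neg_zero]
  have key := integral_neg_eq_self (unitDisk.indicator h) (volume : Measure (ℝ × ℝ))
  simp only [e, MeasureTheory.integral_neg] at key
  linarith

variable {w e o : ℝ × ℝ → ℝ}

theorem qform_cutoff_mul (hw : ContinuousOn w {q | q.1 ^ 2 + q.2 ^ 2 ≤ 1})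
    (he : ∀ q : ℝ × ℝ, q.1 ^ 2 + q.2 ^ 2 ≤ 1 → AnalyticAt ℝ e q)
    (ho : ∀ q : ℝ × ℝ, q.1 ^ 2 + q.2 ^ 2 ≤ 1 → AnalyticAt ℝ o q)
    (hle : ∀ q ∈ unitDisk, lapF e q = -(w q * (e q ^ 3 + 3 * e q * o q ^ 2)))
    (hlo : ∀ q ∈ unitDisk, lapF o q = -(w q * (3 * e q ^ 2 * o q + o q ^ 3)))
    (pw : ∀ q, w (-q) = w q) (pe : ∀ q, e (-q) = e q) (po : ∀ q, o (-q) = -o q) (n : ℕ)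
    (α β : ℝ) :
    qform w (fun q => e q + o q) (fun q => cutoff n q * (α * e q + β * o q)) =
      (∫ q in unitDisk, gradSq (cutoff n) q * (α * e q + β * o q) ^ 2) -
      (2 * α ^ 2 * (∫ q in unitDisk, cutoff n q ^ 2 * (w q * e q ^ 4)) +
        12 * α * β * (∫ q in unitDisk, cutoff n q ^ 2 * (w q * e q ^ 2 * o q ^ 2)) +
        2 * β ^ 2 * (∫ q in unitDisk, cutoff n q ^ 2 * (w q * o q ^ 4))) := by
  have hce : ContinuousOn e {q : ℝ × ℝ | q.1 ^ 2 + q.2 ^ 2 ≤ 1} := fun q hq =>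
    (he q hq).continuousAt.continuousWithinAt
  have hco : ContinuousOn o {q : ℝ × ℝ | q.1 ^ 2 + q.2 ^ 2 ≤ 1} := fun q hq =>
    (ho q hq).continuousAt.continuousWithinAt
  have hcχ : ContinuousOn (cutoff n) {q : ℝ × ℝ | q.1 ^ 2 + q.2 ^ 2 ≤ 1} :=
    (contDiff_cutoff n 1).continuous.continuousOn
  have hf : ∀ q ∈ unitDisk, AnalyticAt ℝ (fun q => α * e q + β * o q) q := fun q hq =>
    (analyticAt_const.mul (he q (unitDisk_subset_closedDisk hq))).add
      (analyticAt_const.mul (ho q (unitDisk_subset_closedDisk hq)))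
  have hs := tsupport_cutoff_subset n
  have hz : ContDiff ℝ 1 fun q => cutoff n q * (α * e q + β * o q) :=
    contDiff_mul_of_tsupport_subset_unitDisk (n := 1) (contDiff_cutoff n 1) hs hf
  have key := integral_gradSq_add_mul (v := fun _ => 0) contDiff_const
    (by simp [tsupport, Function.support]) (by simp [HasCompactSupport, tsupport, Function.support])
    (contDiff_cutoff n 1) hs
    (hasCompactSupport_of_tsupport_subset_unitDisk hs) hf
    (by simp [tsupport, Function.support])
  have g0 : ∀ q, gradSq (fun _ => (0 : ℝ)) q = 0 := fun q => by simp [gradSq]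
  simp only [g0, zero_add, mul_zero, MeasureTheory.integral_zero] at key
  have iG : IntegrableOn (gradSq fun q => cutoff n q * (α * e q + β * o q)) unitDisk :=
    (continuous_gradSq hz).continuousOn.integrableOn_unitDisk
  have iP : IntegrableOn (fun q => 3 * w q * (e q + o q) ^ 2 *
      (cutoff n q * (α * e q + β * o q)) ^ 2) unitDisk :=
    ContinuousOn.integrableOn_unitDisk (by fun_prop)
  have iA : IntegrableOn (fun q => cutoff n q ^ 2 * (w q * e q ^ 4)) unitDisk :=
    ContinuousOn.integrableOn_unitDisk (by fun_prop)
  have iB : IntegrableOn (fun q => cutoff n q ^ 2 * (w q * e q ^ 2 * o q ^ 2)) unitDisk :=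
    ContinuousOn.integrableOn_unitDisk (by fun_prop)
  have iD : IntegrableOn (fun q => cutoff n q ^ 2 * (w q * o q ^ 4)) unitDisk :=
    ContinuousOn.integrableOn_unitDisk (by fun_prop)
  have iO : IntegrableOn (fun q => cutoff n q ^ 2 * w q * (e q * o q) *
      ((6 * α ^ 2 + 2 * α * β) * e q ^ 2 + (6 * β ^ 2 + 2 * α * β) * o q ^ 2)) unitDisk :=
    ContinuousOn.integrableOn_unitDisk (by fun_prop)
  have hO : ∫ q in unitDisk, cutoff n q ^ 2 * w q * (e q * o q) *
      ((6 * α ^ 2 + 2 * α * β) * e q ^ 2 + (6 * β ^ 2 + 2 * α * β) * o q ^ 2) = 0 := by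
    refine setIntegral_unitDisk_eq_zero_of_odd fun q => ?_
    rw [cutoff_congr n (p := -q) (q := q) (by simp), pw, pe, po]
    ring
  have e1 : ∫ q in unitDisk, cutoff n q ^ 2 * (α * e q + β * o q) *
      lapF (fun q => α * e q + β * o q) q = ∫ q in unitDisk,
      (3 * w q * (e q + o q) ^ 2 * (-1) * (cutoff n q * (α * e q + β * o q)) ^ 2 +
      (2 * α ^ 2 * (cutoff n q ^ 2 * (w q * e q ^ 4)) +
      (12 * α * β * (cutoff n q ^ 2 * (w q * e q ^ 2 * o q ^ 2)) +
      (2 * β ^ 2 * (cutoff n q ^ 2 * (w q * o q ^ 4)) +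
      cutoff n q ^ 2 * w q * (e q * o q) * ((6 * α ^ 2 + 2 * α * β) * e q ^ 2 +
      (6 * β ^ 2 + 2 * α * β) * o q ^ 2))))) := by
    refine setIntegral_congr_fun isOpen_unitDisk.measurableSet fun q hq => ?_
    rw [lapF_linear_comb (he q (unitDisk_subset_closedDisk hq))
      (ho q (unitDisk_subset_closedDisk hq)), hle q hq, hlo q hq]
    ring
  have iP' : IntegrableOn (fun q => 3 * w q * (e q + o q) ^ 2 * (-1) *
      (cutoff n q * (α * e q + β * o q)) ^ 2) unitDisk :=
    ContinuousOn.integrableOn_unitDisk (by fun_prop)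
  have eP : ∫ q in unitDisk, 3 * w q * (e q + o q) ^ 2 * (-1) *
      (cutoff n q * (α * e q + β * o q)) ^ 2 =
      -∫ q in unitDisk, 3 * w q * (e q + o q) ^ 2 * (cutoff n q * (α * e q + β * o q)) ^ 2 := by
    rw [← MeasureTheory.integral_neg]
    congr 1
    ext q
    ring
  have s1 := MeasureTheory.integral_add iP' ((iA.const_mul (2 * α ^ 2)).add
    ((iB.const_mul (12 * α * β)).add ((iD.const_mul (2 * β ^ 2)).add iO)))
  have s2 := MeasureTheory.integral_add (iA.const_mul (2 * α ^ 2))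
    ((iB.const_mul (12 * α * β)).add ((iD.const_mul (2 * β ^ 2)).add iO))
  have s3 := MeasureTheory.integral_add (iB.const_mul (12 * α * β))
    ((iD.const_mul (2 * β ^ 2)).add iO)
  have s4 := MeasureTheory.integral_add (iD.const_mul (2 * β ^ 2)) iO
  simp only [Pi.add_apply, MeasureTheory.integral_const_mul] at s1 s2 s3 s4
  rw [s1, s2, s3, s4, hO, eP] at e1
  rw [qform, MeasureTheory.integral_sub iG iP, key, e1]
  ring

/-- A decomposition of a solution into even and odd parts yields a two dimensional space on which
the second variation is negative definite. -/
theorem exists_negDefSubspace_rank_two (hw : ContinuousOn w {q | q.1 ^ 2 + q.2 ^ 2 ≤ 1})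
    (he : ∀ q : ℝ × ℝ, q.1 ^ 2 + q.2 ^ 2 ≤ 1 → AnalyticAt ℝ e q)
    (ho : ∀ q : ℝ × ℝ, q.1 ^ 2 + q.2 ^ 2 ≤ 1 → AnalyticAt ℝ o q)
    (he1 : ∀ q : ℝ × ℝ, q.1 ^ 2 + q.2 ^ 2 = 1 → e q = 0)
    (ho1 : ∀ q : ℝ × ℝ, q.1 ^ 2 + q.2 ^ 2 = 1 → o q = 0)
    (hle : ∀ q ∈ unitDisk, lapF e q = -(w q * (e q ^ 3 + 3 * e q * o q ^ 2)))
    (hlo : ∀ q ∈ unitDisk, lapF o q = -(w q * (3 * e q ^ 2 * o q + o q ^ 3)))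
    (pw : ∀ q, w (-q) = w q) (pe : ∀ q, e (-q) = e q) (po : ∀ q, o (-q) = -o q)
    (hA : 0 < ∫ q in unitDisk, w q * e q ^ 4)
    (hB : 9 * (∫ q in unitDisk, w q * e q ^ 2 * o q ^ 2) ^ 2 <
      (∫ q in unitDisk, w q * e q ^ 4) * ∫ q in unitDisk, w q * o q ^ 4) :
    ∃ V : Submodule ℝ (ℝ × ℝ → ℝ),
      NegDefSubspace w (fun q => e q + o q) V ∧ Module.rank ℝ V = 2 := by
  have hce : ContinuousOn e {q : ℝ × ℝ | q.1 ^ 2 + q.2 ^ 2 ≤ 1} := fun q hq =>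
    (he q hq).continuousAt.continuousWithinAt
  have hco : ContinuousOn o {q : ℝ × ℝ | q.1 ^ 2 + q.2 ^ 2 ≤ 1} := fun q hq =>
    (ho q hq).continuousAt.continuousWithinAt
  have tA := tendsto_integral_cutoff_sq (g := fun q => w q * e q ^ 4) (by fun_prop)
  have tB := tendsto_integral_cutoff_sq (g := fun q => w q * e q ^ 2 * o q ^ 2) (by fun_prop)
  have tD := tendsto_integral_cutoff_sq (g := fun q => w q * o q ^ 4) (by fun_prop)
  have tE := tendsto_integral_gradSq_cutoff he he1
  have tO := tendsto_integral_gradSq_cutoff ho ho1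
  have tA' := tA.sub tE
  have tD' := tD.sub tO
  rw [sub_zero] at tA' tD'
  obtain ⟨n, hn1, hn2⟩ := ((tA'.eventually_const_lt hA).and
    (((tB.pow 2).const_mul 9).eventually_lt (tA'.mul tD') hB)).exists
  have hn : ∀ α β : ℝ, ¬(α = 0 ∧ β = 0) → qform w (fun q => e q + o q)
      (fun q => cutoff n q * (α * e q + β * o q)) < 0 := fun α β hαβ => by
    rw [qform_cutoff_mul hw he ho hle hlo pw pe po]
    have hcG : ContinuousOn (gradSq (cutoff n)) {q : ℝ × ℝ | q.1 ^ 2 + q.2 ^ 2 ≤ 1} :=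
      (continuous_gradSq (contDiff_cutoff n 1)).continuousOn
    have i1 : IntegrableOn (fun q => gradSq (cutoff n) q * e q ^ 2) unitDisk :=
      ContinuousOn.integrableOn_unitDisk (by fun_prop)
    have i2 : IntegrableOn (fun q => gradSq (cutoff n) q * o q ^ 2) unitDisk :=
      ContinuousOn.integrableOn_unitDisk (by fun_prop)
    have i3 : IntegrableOn (fun q => gradSq (cutoff n) q * (α * e q + β * o q) ^ 2) unitDisk :=
      ContinuousOn.integrableOn_unitDisk (by fun_prop)
    have hle : ∫ q in unitDisk, gradSq (cutoff n) q * (α * e q + β * o q) ^ 2 ≤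
        2 * α ^ 2 * (∫ q in unitDisk, gradSq (cutoff n) q * e q ^ 2) +
        2 * β ^ 2 * ∫ q in unitDisk, gradSq (cutoff n) q * o q ^ 2 := by
      rw [← MeasureTheory.integral_const_mul, ← MeasureTheory.integral_const_mul,
        ← MeasureTheory.integral_add (i1.const_mul _) (i2.const_mul _)]
      refine integral_mono i3 ((i1.const_mul _).add (i2.const_mul _)) fun q => ?_
      have hg : 0 ≤ gradSq (cutoff n) q := add_nonneg (sq_nonneg _) (sq_nonneg _)
      simp only
      nlinarith [mul_nonneg hg (sq_nonneg (α * e q - β * o q))]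
    generalize (∫ q in unitDisk, gradSq (cutoff n) q * (α * e q + β * o q) ^ 2) = I at *
    generalize (∫ q in unitDisk, gradSq (cutoff n) q * e q ^ 2) = I1 at *
    generalize (∫ q in unitDisk, gradSq (cutoff n) q * o q ^ 2) = I2 at *
    generalize (∫ q in unitDisk, cutoff n q ^ 2 * (w q * e q ^ 4)) = A at *
    generalize (∫ q in unitDisk, cutoff n q ^ 2 * (w q * e q ^ 2 * o q ^ 2)) = B at *
    generalize (∫ q in unitDisk, cutoff n q ^ 2 * (w q * o q ^ 4)) = D at *
    have hpos : 0 < (A - I1) * (α ^ 2 * (A - I1) + 6 * α * β * B + β ^ 2 * (D - I2)) := by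
      have e0 : (A - I1) * (α ^ 2 * (A - I1) + 6 * α * β * B + β ^ 2 * (D - I2)) =
        ((A - I1) * α + 3 * β * B) ^ 2 + β ^ 2 * ((A - I1) * (D - I2) - 9 * B ^ 2) := by ring
      rw [e0]
      by_cases hβ : β = 0
      · have hα : α ≠ 0 := fun h => hαβ ⟨h, hβ⟩
        subst hβ
        have : (A - I1) * α ≠ 0 := mul_ne_zero hn1.ne' hα
        have := pow_pos (abs_pos.2 this) 2
        rw [sq_abs] at this
        simpa using this
      · exact add_pos_of_nonneg_of_pos (sq_nonneg _)
          (mul_pos (by positivity) (by linarith))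
    have := pos_of_mul_pos_right hpos hn1.le
    nlinarith
  set x : ℝ × ℝ → ℝ := fun q => cutoff n q * e q with hx
  set y : ℝ × ℝ → ℝ := fun q => cutoff n q * o q with hy
  have hxy : ∀ α β : ℝ, α • x + β • y = fun q => cutoff n q * (α * e q + β * o q) := fun α β => by
    ext q
    simp only [hx, hy, Pi.add_apply, Pi.smul_apply, smul_eq_mul]
    ring
  have hli : LinearIndependent ℝ ![x, y] := by
    refine LinearIndependent.pair_iff.2 fun α β h => ?_
    by_contra hc
    have := hn α β hc
    rw [← hxy, h] at this
    simp [qform, gradSq] at this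
  refine ⟨Submodule.span ℝ (Set.range ![x, y]), ⟨fun v hv => ?_, fun v hv hv0 => ?_⟩, ?_⟩
  · rw [Matrix.range_cons, Matrix.range_cons, Matrix.range_empty, union_empty,
      singleton_union, Submodule.mem_span_pair] at hv
    obtain ⟨α, β, rfl⟩ := hv
    rw [hxy]
    have hs : tsupport (fun q => cutoff n q * (α * e q + β * o q)) ⊆ unitDisk :=
      tsupport_mul_subset_left.trans (tsupport_cutoff_subset n)
    refine ⟨contDiff_mul_of_tsupport_subset_unitDisk (contDiff_cutoff n _)
      (tsupport_cutoff_subset n) fun q hq => ?_,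
      hasCompactSupport_of_tsupport_subset_unitDisk hs, hs⟩
    exact (analyticAt_const.mul (he q (unitDisk_subset_closedDisk hq))).add
      (analyticAt_const.mul (ho q (unitDisk_subset_closedDisk hq)))
  · rw [Matrix.range_cons, Matrix.range_cons, Matrix.range_empty, union_empty,
      singleton_union, Submodule.mem_span_pair] at hv
    obtain ⟨α, β, rfl⟩ := hv
    rw [hxy]
    refine hn α β fun h => hv0 ?_
    rw [h.1, h.2]
    simp
  · have hr := finrank_span_eq_card hli
    rw [Fintype.card_fin] at hr
    have : Module.Finite ℝ (Submodule.span ℝ (Set.range ![x, y])) :=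
      Module.Finite.span_of_finite ℝ (Set.finite_range _)
    rw [← Module.finrank_eq_rank, hr]
    norm_num

end LowerIndex

section UpperIndex

open Real Set Filter Topology IntPoly

theorem continuous_pot (δ : ℝ) : Continuous (pot δ) := by
  have h : ∀ p : List ℤ, Continuous (ev p) := fun p =>
    continuous_iff_continuousAt.2 fun x => (hasDerivAt_ev p x).continuousAt
  have e : pot δ = fun s => (ev potZero s + δ * ev potOne s + δ ^ 2 * ev potTwo s) / 360000 :=
    funext (pot_eq δ)
  have h0 := h potZero
  have h1 := h potOne
  have h2 := h potTwo
  rw [e]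
  fun_prop

variable {w u f : ℝ × ℝ → ℝ}

theorem qform_add_cutoff_mul {v : ℝ × ℝ → ℝ} (hv : ContDiff ℝ 1 v) (hvs : tsupport v ⊆ unitDisk)
    (hw : ContinuousOn w {q | q.1 ^ 2 + q.2 ^ 2 ≤ 1})
    (hu : ContinuousOn u {q | q.1 ^ 2 + q.2 ^ 2 ≤ 1})
    (hf : ∀ q : ℝ × ℝ, q.1 ^ 2 + q.2 ^ 2 ≤ 1 → AnalyticAt ℝ f q)
    (hlf : ∀ q ∈ unitDisk, lapF f q = -(3 * w q * u q ^ 2 * f q)) {n : ℕ}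
    (hn : ∀ q ∈ tsupport v, cutoff n =ᶠ[𝓝 q] 1) :
    qform w u (fun q => v q + cutoff n q * f q) =
      qform w u v + ∫ q in unitDisk, gradSq (cutoff n) q * f q ^ 2 := by
  have hcf : ContinuousOn f {q : ℝ × ℝ | q.1 ^ 2 + q.2 ^ 2 ≤ 1} := fun q hq =>
    (hf q hq).continuousAt.continuousWithinAt
  have hcχ : ContinuousOn (cutoff n) {q : ℝ × ℝ | q.1 ^ 2 + q.2 ^ 2 ≤ 1} :=
    (contDiff_cutoff n 1).continuous.continuousOn
  have hcv : ContinuousOn v {q : ℝ × ℝ | q.1 ^ 2 + q.2 ^ 2 ≤ 1} := hv.continuous.continuousOn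
  have hf' : ∀ q ∈ unitDisk, AnalyticAt ℝ f q := fun q hq => hf q (unitDisk_subset_closedDisk hq)
  have hs := tsupport_cutoff_subset n
  have hz : ContDiff ℝ 1 fun q => v q + cutoff n q * f q :=
    hv.add (contDiff_mul_of_tsupport_subset_unitDisk (n := 1) (contDiff_cutoff n 1) hs hf')
  have key := integral_gradSq_add_mul hv hvs
    (hasCompactSupport_of_tsupport_subset_unitDisk hvs) (contDiff_cutoff n 1) hs
    (hasCompactSupport_of_tsupport_subset_unitDisk hs) hf' hn
  have hχv : ∀ q, v q = v q * cutoff n q := fun q => by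
    by_cases hq : q ∈ tsupport v
    · simp [(hn q hq).eq_of_nhds]
    · simp [image_eq_zero_of_notMem_tsupport hq]
  have iG : IntegrableOn (gradSq fun q => v q + cutoff n q * f q) unitDisk :=
    (continuous_gradSq hz).continuousOn.integrableOn_unitDisk
  have iGv : IntegrableOn (gradSq v) unitDisk :=
    (continuous_gradSq hv).continuousOn.integrableOn_unitDisk
  have iP : IntegrableOn (fun q => 3 * w q * u q ^ 2 * (v q + cutoff n q * f q) ^ 2) unitDisk :=
    ContinuousOn.integrableOn_unitDisk (by fun_prop)
  have iPv : IntegrableOn (fun q => 3 * w q * u q ^ 2 * v q ^ 2) unitDisk :=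
    ContinuousOn.integrableOn_unitDisk (by fun_prop)
  have e1 : ∫ q in unitDisk, (2 * v q + cutoff n q ^ 2 * f q) * lapF f q = ∫ q in unitDisk,
      (3 * w q * u q ^ 2 * v q ^ 2 - 3 * w q * u q ^ 2 * (v q + cutoff n q * f q) ^ 2) := by
    refine setIntegral_congr_fun isOpen_unitDisk.measurableSet fun q hq => ?_
    rw [hlf q hq]
    linear_combination -6 * w q * u q ^ 2 * f q * hχv q
  rw [MeasureTheory.integral_sub iPv iP] at e1
  rw [qform, qform, MeasureTheory.integral_sub iG iP, MeasureTheory.integral_sub iGv iPv, key, e1]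
  ring

theorem integral_sq_le_qform {z : ℝ × ℝ → ℝ} (hz : ContDiff ℝ 1 z)
    (hw : ContinuousOn w {q | q.1 ^ 2 + q.2 ^ 2 ≤ 1})
    (hu : ContinuousOn u {q | q.1 ^ 2 + q.2 ^ 2 ≤ 1}) {δ : ℝ} (hδ : |δ| ≤ 1)
    (hp : ∀ q ∈ unitDisk, |3 * w q * u q ^ 2 - 3 * pot δ (q.1 ^ 2 + q.2 ^ 2)| ≤ 1 / 2000)
    (h1 : ∀ q : ℝ × ℝ, q.1 ^ 2 + q.2 ^ 2 = 1 → z q = 0) (hm : ∀ i, arcIntegral i z = 0) :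
    1 / 2000 * ∫ q in unitDisk, z q ^ 2 ≤ qform w u z := by
  have key := energy_nonneg_of_arcIntegral_eq_zero hz hδ (continuous_pot δ) h1 hm
  have hcp := continuous_pot δ
  have hcz := hz.continuous
  have hcz' := hz.continuous.continuousOn (s := {q : ℝ × ℝ | q.1 ^ 2 + q.2 ^ 2 ≤ 1})
  have hcG := (continuous_gradSq hz)
  have hcG' := hcG.continuousOn (s := {q : ℝ × ℝ | q.1 ^ 2 + q.2 ^ 2 ≤ 1})
  have i1 : IntegrableOn (fun q => gradSq z q - (3 * pot δ (q.1 ^ 2 + q.2 ^ 2) + 1 / 1000) *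
      z q ^ 2) unitDisk := ContinuousOn.integrableOn_unitDisk (by fun_prop)
  have i2 : IntegrableOn (fun q => 1 / 2000 * z q ^ 2) unitDisk :=
    ContinuousOn.integrableOn_unitDisk (by fun_prop)
  have i3 : IntegrableOn (fun q => gradSq z q - 3 * w q * u q ^ 2 * z q ^ 2) unitDisk :=
    ContinuousOn.integrableOn_unitDisk (by fun_prop)
  have h : ∫ q in unitDisk, (gradSq z q - (3 * pot δ (q.1 ^ 2 + q.2 ^ 2) + 1 / 1000) * z q ^ 2) +
      1 / 2000 * z q ^ 2 ≤ qform w u z := by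
    refine setIntegral_mono_on (i1.add i2) i3 isOpen_unitDisk.measurableSet fun q hq => ?_
    have := (abs_le.1 (hp q hq)).2
    nlinarith [mul_nonneg (sub_nonneg.2 this) (sq_nonneg (z q))]
  have e := MeasureTheory.integral_add i1 i2
  rw [MeasureTheory.integral_const_mul] at e
  linarith

theorem mem_unitDisk_arc (θ : ℝ) :
    ((meanRadius * cos θ, meanRadius * sin θ) : ℝ × ℝ) ∈ unitDisk := by
  change (meanRadius * cos θ) ^ 2 + (meanRadius * sin θ) ^ 2 < 1
  rw [polar_sq_add_sq, meanRadius_sq]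
  norm_num

theorem arcIntegral_add_mul {v g : ℝ × ℝ → ℝ}
    (hv : ContinuousOn v unitDisk) (hg : ContinuousOn g unitDisk) (d : ℝ) (i : Fin 3) :
    arcIntegral i (fun q => v q + d * g q) = arcIntegral i v + d * arcIntegral i g := by
  have hc : ∀ {h : ℝ × ℝ → ℝ}, ContinuousOn h unitDisk →
      Continuous fun θ => h (meanRadius * cos θ, meanRadius * sin θ) := fun hh =>
    hh.comp_continuous (by fun_prop) mem_unitDisk_arc
  rw [arcIntegral, intervalIntegral.integral_add ((hc hv).intervalIntegrable _ _)
    (((hc hg).const_mul d).intervalIntegrable _ _), intervalIntegral.integral_const_mul]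
  rfl

/-- The Morse index is at most two for solutions close to the radial one. -/
theorem rank_le_two_of_negDefSubspace (hw : ContinuousOn w {q | q.1 ^ 2 + q.2 ^ 2 ≤ 1})
    (hu : ContinuousOn u {q | q.1 ^ 2 + q.2 ^ 2 ≤ 1}) {δ : ℝ} (hδ : |δ| ≤ 1)
    (hp : ∀ q ∈ unitDisk, |3 * w q * u q ^ 2 - 3 * pot δ (q.1 ^ 2 + q.2 ^ 2)| ≤ 1 / 2000)
    (hf : ∀ q : ℝ × ℝ, q.1 ^ 2 + q.2 ^ 2 ≤ 1 → AnalyticAt ℝ f q)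
    (hf1 : ∀ q : ℝ × ℝ, q.1 ^ 2 + q.2 ^ 2 = 1 → f q = 0)
    (hlf : ∀ q ∈ unitDisk, lapF f q = -(3 * w q * u q ^ 2 * f q))
    (hf0 : 0 < ∫ q in unitDisk, f q ^ 2) {V : Submodule ℝ (ℝ × ℝ → ℝ)}
    (hV : NegDefSubspace w u V) : Module.rank ℝ V ≤ 2 := by
  by_contra hr
  rw [not_le] at hr
  have hr3 : ((3 : ℕ) : Cardinal) ≤ Module.rank ℝ V := by
    rw [show 3 = 2 + 1 from rfl, Nat.cast_succ, Cardinal.natCast_add_one_le_iff]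
    exact_mod_cast hr
  obtain ⟨b, hb⟩ := exists_linearIndependent_of_le_rank hr3
  have cV : ∀ v ∈ V, ContinuousOn v unitDisk := fun v hv => (hV.1 v hv).1.continuous.continuousOn
  have cf : ContinuousOn f unitDisk := fun q hq =>
    (hf q (unitDisk_subset_closedDisk hq)).continuousAt.continuousWithinAt
  let T : (Fin 3 → ℝ) × ℝ →ₗ[ℝ] Fin 3 → ℝ :=
    { toFun := fun a i => (∑ j, a.1 j * arcIntegral i (b j)) + a.2 * arcIntegral i f
      map_add' := fun a a' => by
        ext i
        simp only [Prod.fst_add, Prod.snd_add, Pi.add_apply, add_mul, Finset.sum_add_distrib]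
        ring
      map_smul' := fun c a => by
        ext i
        simp only [Prod.smul_fst, Prod.smul_snd, Pi.smul_apply, smul_eq_mul, RingHom.id_apply,
          mul_add, Finset.mul_sum, mul_assoc] }
  obtain ⟨⟨c, d⟩, hT, hcd⟩ := (Submodule.ne_bot_iff _).1
    (T.ker_ne_bot_of_finrank_lt (by simp))
  set v : ℝ × ℝ → ℝ := ((∑ j, c j • b j : V) : ℝ × ℝ → ℝ) with hv
  have hvV : v ∈ V := (∑ j, c j • b j : V).2
  obtain ⟨dv, -, sv⟩ := hV.1 v hvV
  have dv1 : ContDiff ℝ 1 v := dv.of_le (by exact_mod_cast le_top)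
  have av : ∀ i, arcIntegral i v = ∑ j, c j * arcIntegral i (b j) := fun i => by
    have e : v = fun q => (0 + c 0 * (b 0 : ℝ × ℝ → ℝ) q + c 1 * (b 1 : ℝ × ℝ → ℝ) q) +
        c 2 * (b 2 : ℝ × ℝ → ℝ) q := by
      ext q
      simp [hv, Fin.sum_univ_three]
    have b0 := cV _ (b 0).2
    have b1 := cV _ (b 1).2
    have b2 := cV _ (b 2).2
    rw [e, arcIntegral_add_mul (by fun_prop) b2, arcIntegral_add_mul (by fun_prop) b1,
      arcIntegral_add_mul continuousOn_const b0, Fin.sum_univ_three]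
    simp [arcIntegral]
  have hf' : ∀ q : ℝ × ℝ, q.1 ^ 2 + q.2 ^ 2 ≤ 1 → AnalyticAt ℝ (fun q => d * f q) q := fun q hq =>
    analyticAt_const.mul (hf q hq)
  have hlf' : ∀ q ∈ unitDisk, lapF (fun q => d * f q) q =
      -(3 * w q * u q ^ 2 * (d * f q)) := fun q hq => by
    have := lapF_linear_comb (hf q (unitDisk_subset_closedDisk hq))
      (hf q (unitDisk_subset_closedDisk hq)) d 0
    simp only [zero_mul, add_zero] at this
    rw [this, hlf q hq]
    ring
  have hI := tendsto_integral_gradSq_cutoff hf' (fun q hq => by rw [hf1 q hq, mul_zero])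
  have hQ := hI.const_add (qform w u v)
  rw [add_zero] at hQ
  have hK : IsCompact (tsupport v) := hasCompactSupport_of_tsupport_subset_unitDisk sv
  have hC : IsCompact (range fun θ : ℝ => ((meanRadius * cos θ, meanRadius * sin θ) : ℝ × ℝ)) := by
    have hp : Function.Periodic (fun θ : ℝ =>
        ((meanRadius * cos θ, meanRadius * sin θ) : ℝ × ℝ)) (2 * π) := fun θ => by simp
    exact hp.compact_of_continuous (by positivity) (by fun_prop)
  have hev := (eventually_cutoff_eventuallyEq_one hK sv).and
    (eventually_cutoff_eventuallyEq_one hC (range_subset_iff.2 mem_unitDisk_arc))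
  have hle : ∀ᶠ n in atTop, 1 / 2000 * ∫ q in unitDisk, (v q + cutoff n q * (d * f q)) ^ 2 ≤
      qform w u v + ∫ q in unitDisk, gradSq (cutoff n) q * (d * f q) ^ 2 := by
    filter_upwards [hev] with n hn
    rw [← qform_add_cutoff_mul dv1 sv hw hu hf' hlf' hn.1]
    refine integral_sq_le_qform (dv1.add (contDiff_mul_of_tsupport_subset_unitDisk (n := 1)
      (contDiff_cutoff n 1) (tsupport_cutoff_subset n)
      fun q hq => hf' q (unitDisk_subset_closedDisk hq))) hw hu hδ hp (fun q hq => ?_) fun i => ?_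
    · have hq' : q ∉ unitDisk := fun h => (show q.1 ^ 2 + q.2 ^ 2 < 1 from h).ne hq
      rw [image_eq_zero_of_notMem_tsupport fun h => hq' (sv h), hf1 q hq]
      simp
    · have e : arcIntegral i (fun q => v q + cutoff n q * (d * f q)) =
          arcIntegral i fun q => v q + d * f q := by
        rw [arcIntegral, arcIntegral]
        congr 1
        ext θ
        rw [(hn.2 _ (mem_range_self θ)).eq_of_nhds]
        simp
      rw [e, arcIntegral_add_mul (cV v hvV) cf, av]
      exact congrFun hT i
  by_cases hv0 : v = 0
  · have hd : d ≠ 0 := fun hd => hcd <| by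
      have h0 : (∑ j, c j • b j : V) = 0 := Subtype.ext hv0
      have := Fintype.linearIndependent_iff.1 hb c h0
      exact Prod.ext (funext this) hd
    have cf2 : ContinuousOn (fun q => (d * f q) ^ 2) {q : ℝ × ℝ | q.1 ^ 2 + q.2 ^ 2 ≤ 1} :=
      fun q hq => ((hf' q hq).continuousAt.pow 2).continuousWithinAt
    have hlim := (tendsto_integral_cutoff_sq cf2).const_mul (1 / 2000)
    have key := le_of_tendsto_of_tendsto hlim hQ (hle.mono fun n hn => by
      simpa [hv0, mul_pow] using hn)
    have q0 : qform w u v = 0 := by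
      rw [hv0]
      simp [qform, gradSq]
    simp only [mul_pow] at key
    rw [q0, MeasureTheory.integral_const_mul] at key
    have : 0 < d ^ 2 * ∫ q in unitDisk, f q ^ 2 := mul_pos (by positivity) hf0
    linarith
  · have hneg := hV.2 v hvV hv0
    obtain ⟨n, h1, h2⟩ := ((hQ.eventually_lt_const hneg).and hle).exists
    have : 0 ≤ ∫ q in unitDisk, (v q + cutoff n q * (d * f q)) ^ 2 :=
      MeasureTheory.integral_nonneg fun q => sq_nonneg _
    linarith

end UpperIndex

section RealValue

open Real Set Filter Topology

namespace Coef

theorem val_eq_zero {p : ℝ × ℝ} (hp : 4 < p.1 ^ 2 + p.2 ^ 2) : val p = 0 :=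
  ext_mono fun i => by rw [val, lift_mono, if_neg (not_le.2 hp), zero_apply]

/-- The real part of the evaluation of a power series. -/
noncomputable def reVal (a : Coef) (q : ℝ × ℝ) : ℝ := (val q a).re

/-- The real part of the angular derivative of a power series. -/
noncomputable def reDth (a : Coef) (q : ℝ × ℝ) : ℝ := (dth q a).re

theorem val_eq_reVal {q : ℝ × ℝ} (hq : q.1 ^ 2 + q.2 ^ 2 ≤ 4) {a : Coef} (ha : swap a = a) :
    val q a = reVal a q :=
  Complex.ext (by simp [reVal]) (by simpa using val_im_eq_zero hq ha)

theorem dth_eq_reDth {q : ℝ × ℝ} (hq : q.1 ^ 2 + q.2 ^ 2 < 4) {a : Coef} (ha : swap a = a) :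
    dth q a = reDth a q := by
  have h := dth_swap hq a
  rw [ha] at h
  exact Complex.ext (by simp [reDth]) (by simpa using Complex.conj_eq_iff_im.1 h.symm)

theorem reVal_neg (a : Coef) (q : ℝ × ℝ) : reVal a (-q) = reVal (flip a) q := by
  rcases le_or_gt (q.1 ^ 2 + q.2 ^ 2) 4 with h | h
  · rw [reVal, val_neg h, reVal]
  · rw [reVal, reVal, val_eq_zero h, val_eq_zero (by simpa using h), zero_apply, zero_apply]

theorem reVal_add (a b : Coef) (q : ℝ × ℝ) : reVal (a + b) q = reVal a q + reVal b q := by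
  simp [reVal]

theorem reVal_smul (c : ℝ) (a : Coef) (q : ℝ × ℝ) : reVal (c • a) q = c * reVal a q := by
  simp [reVal]

theorem reVal_mul {q : ℝ × ℝ} (hq : q.1 ^ 2 + q.2 ^ 2 ≤ 4) {a b : Coef} (ha : swap a = a)
    (hb : swap b = b) : reVal (a * b) q = reVal a q * reVal b q := by
  rw [reVal, val_mul hq, val_eq_reVal hq ha, val_eq_reVal hq hb, ← Complex.ofReal_mul,
    Complex.ofReal_re]

theorem reVal_pow {q : ℝ × ℝ} (hq : q.1 ^ 2 + q.2 ^ 2 ≤ 4) {a : Coef} (ha : swap a = a) (n : ℕ) :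
    reVal (a ^ n) q = reVal a q ^ n := by
  rw [reVal, val_pow hq, val_eq_reVal hq ha, ← Complex.ofReal_pow, Complex.ofReal_re]

theorem swap_one : swap 1 = 1 := by simp [one_def]

theorem swap_pow {a : Coef} (ha : swap a = a) (n : ℕ) : swap (a ^ n) = a ^ n := by
  induction n with
  | zero => simp [swap_one]
  | succ n ih => rw [pow_succ, swap_mul, ih, ha]

theorem IsRad.reVal {a : Coef} (ha : IsRad a) {q : ℝ × ℝ} (hq : q.1 ^ 2 + q.2 ^ 2 ≤ 4) :
    reVal a q = row 0 (q.1 ^ 2 + q.2 ^ 2) a := by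
  rw [Coef.reVal, ha.val hq, Complex.ofReal_re]

theorem reVal_ofPoly {q : ℝ × ℝ} (hq : q.1 ^ 2 + q.2 ^ 2 ≤ 4) (P : Polynomial ℝ) :
    reVal (ofPoly P) q = P.eval (q.1 ^ 2 + q.2 ^ 2) := by
  rw [reVal, val_ofPoly hq, Complex.ofReal_re]

theorem abs_reVal_le (a : Coef) (q : ℝ × ℝ) : |reVal a q| ≤ ‖a‖ :=
  (Complex.abs_re_le_norm _).trans <| by
    simpa using (val q).le_of_opNorm_le (norm_val_le q) a

theorem analyticAt_reVal (a : Coef) {q : ℝ × ℝ} (hq : q.1 ^ 2 + q.2 ^ 2 < 4) :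
    AnalyticAt ℝ (reVal a) q :=
  (Complex.reCLM.analyticAt _).comp (analyticAt_val_apply hq a)

theorem lapF_reVal (a : Coef) {q : ℝ × ℝ} (hq : q.1 ^ 2 + q.2 ^ 2 < 4) :
    lapF (reVal a) q = (lapF val q a).re := by
  rw [← lapF_val_apply hq a]
  exact lapF_clm_comp (analyticAt_val_apply hq a) Complex.reCLM

theorem lapF_reVal_green (a : Coef) {q : ℝ × ℝ} (hq : q.1 ^ 2 + q.2 ^ 2 < 4) :
    lapF (reVal (green a)) q = -reVal a q := by
  rw [lapF_reVal _ hq, lapF_val_green hq, Complex.neg_re, reVal]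

theorem reVal_green_of_eq_one (a : Coef) {q : ℝ × ℝ} (hq : q.1 ^ 2 + q.2 ^ 2 = 1) :
    reVal (green a) q = 0 := by
  rw [reVal, val_green_of_eq_one hq, Complex.zero_re]

theorem analyticAt_reDth (a : Coef) {q : ℝ × ℝ} (hq : q.1 ^ 2 + q.2 ^ 2 < 4) :
    AnalyticAt ℝ (reDth a) q :=
  (Complex.reCLM.analyticAt _).comp (analyticAt_dth_apply hq a)

theorem lapF_reDth_green (a : Coef) {q : ℝ × ℝ} (hq : q.1 ^ 2 + q.2 ^ 2 < 4) :
    lapF (reDth (green a)) q = -reDth a q := by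
  have h : lapF (reDth (green a)) q = (lapF dth q (green a)).re := by
    rw [← lapF_dth_apply hq]
    exact lapF_clm_comp (analyticAt_dth_apply hq _) Complex.reCLM
  rw [h, lapF_dth_green hq, Complex.neg_re, reDth]

theorem reDth_green_of_eq_one (a : Coef) {q : ℝ × ℝ} (hq : q.1 ^ 2 + q.2 ^ 2 = 1) :
    reDth (green a) q = 0 := by
  rw [reDth, dth_green_of_eq_one hq, Complex.zero_re]

theorem reDth_radial_mul_cube {w a : Coef} (hw : IsRad w) (ha : swap a = a) {q : ℝ × ℝ}
    (hq : q.1 ^ 2 + q.2 ^ 2 < 4) :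
    reDth (w * a ^ 3) q = 3 * reVal w q * reVal a q ^ 2 * reDth a q := by
  have e : dth q (w * a ^ 3) =
      ((3 * reVal w q * reVal a q ^ 2 * reDth a q : ℝ) : ℂ) := by
    rw [dth_mul hq, hw.dth hq, show a ^ 3 = a * (a * a) by ring, dth_mul hq, dth_mul hq,
      val_mul hq.le, val_mul hq.le, dth_eq_reDth hq ha, val_eq_reVal hq.le ha, val_eq_reVal hq.le hw.swap]
    push_cast
    ring
  rw [reDth, e, Complex.ofReal_re]

theorem reDth_apply (a : Coef) {q : ℝ × ℝ} (hq : q.1 ^ 2 + q.2 ^ 2 < 4) :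
    reDth a q = fderiv ℝ (reVal a) q (-q.2, q.1) := by
  have h := (Complex.reCLM.hasFDerivAt.comp q
    (analyticAt_val_apply hq a).differentiableAt.hasFDerivAt).fderiv
  have e : reVal a = (Complex.reCLM : ℂ → ℝ) ∘ fun q => val q a := rfl
  rw [reDth, dth_apply hq, e, h]
  rfl

/-- The angular integrals over circles around the origin. -/
theorem integral_reVal_polar (a : Coef) {r : ℝ} (hr : r ∈ Icc (0 : ℝ) 1) :
    ∫ θ in -π..π, reVal a (r * cos θ, r * sin θ) = 2 * π * row 0 (r ^ 2) a := by
  have hle : ∀ θ : ℝ, (r * cos θ, r * sin θ).1 ^ 2 + (r * cos θ, r * sin θ).2 ^ 2 < 4 := fun θ => by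
    rw [polar_sq_add_sq]; nlinarith [hr.1, hr.2]
  have hc : Continuous fun θ => val (r * cos θ, r * sin θ) :=
    continuous_iff_continuousAt.2 fun θ => ContinuousAt.comp (g := val)
      (f := fun θ => (r * cos θ, r * sin θ)) (analyticAt_val (hle θ)).continuousAt (by fun_prop)
  have hi : IntervalIntegrable (fun θ => val (r * cos θ, r * sin θ)) volume (-π) π :=
    hc.intervalIntegrable _ _
  have hs : |r ^ 2| ≤ 4 := by rw [abs_of_nonneg (by positivity)]; nlinarith [hr.1, hr.2]
  have key : (∫ θ in -π..π, val (r * cos θ, r * sin θ)) =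
      (2 * π) • Complex.ofRealCLM.comp (row 0 (r ^ 2)) := ext_mono fun i => by
    rw [ContinuousLinearMap.intervalIntegral_apply hi]
    have e : ∀ θ : ℝ, val (r * cos θ, r * sin θ) (mono i) = ((r / 2 : ℝ) : ℂ) ^ (i.1 + i.2) *
        Complex.exp ((((i.1 : ℤ) - i.2 : ℤ) : ℂ) * Complex.I * θ) := fun θ => by
      have h1 : toC (r * cos θ, r * sin θ) = r * Complex.exp (θ * Complex.I) := by
        rw [toC_apply, Complex.exp_mul_I]; push_cast; ring
      have h2 : toCbar (r * cos θ, r * sin θ) = r * Complex.exp (-(θ * Complex.I)) := by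
        rw [toCbar_apply, ← neg_mul, Complex.exp_mul_I, Complex.cos_neg, Complex.sin_neg]
        push_cast; ring
      rw [val_mono (hle θ).le, monoFun, h1, h2, mul_div_right_comm, mul_div_right_comm, mul_pow,
        mul_pow, ← Complex.exp_nat_mul, ← Complex.exp_nat_mul,
        show ∀ a b c d : ℂ, a * b * (c * d) = a * c * (b * d) from fun a b c d => by ring,
        ← Complex.exp_add, ← pow_add]
      push_cast
      congr 2
      ring
    simp_rw [e]
    rw [intervalIntegral.integral_const_mul]
    simp only [smul_apply, ContinuousLinearMap.comp_apply, row_mono hs, add_zero, pow_zero, div_one,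
      Complex.ofRealCLM_apply]
    by_cases h : i.1 = i.2
    · simp only [h, sub_self, Int.cast_zero, zero_mul, Complex.exp_zero, if_true,
        intervalIntegral.integral_const, Complex.real_smul]
      push_cast
      rw [← two_mul, pow_mul]
      ring_nf
    · have hn : (((i.1 : ℤ) - i.2 : ℤ) : ℂ) ≠ 0 := by
        rw [Int.cast_ne_zero]; omega
      rw [if_neg h, integral_exp_mul_complex (mul_ne_zero hn Complex.I_ne_zero)]
      have : Complex.exp ((((i.1 : ℤ) - i.2 : ℤ) : ℂ) * Complex.I * (π : ℝ)) =
          Complex.exp ((((i.1 : ℤ) - i.2 : ℤ) : ℂ) * Complex.I * (-π : ℝ)) := by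
        rw [Complex.exp_eq_exp_iff_exists_int]
        exact ⟨(i.1 : ℤ) - i.2, by push_cast; ring⟩
      rw [this]
      simp
  have h2 := Complex.reCLM.intervalIntegral_comp_comm
    (μ := volume) (a := -π) (b := π) (f := fun θ => val (r * cos θ, r * sin θ) a)
    ((hc.clm_apply continuous_const).intervalIntegrable _ _)
  rw [← ContinuousLinearMap.intervalIntegral_apply hi, key] at h2
  simpa [reVal] using h2

theorem setIntegral_reVal (a : Coef) : ∫ q in unitDisk, reVal a q = π * intRow a := by
  have hcont : ContinuousOn (reVal a) {q : ℝ × ℝ | q.1 ^ 2 + q.2 ^ 2 ≤ 1} := fun q hq =>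
    (analyticAt_reVal a (lt_of_le_of_lt hq (by norm_num))).continuousAt.continuousWithinAt
  rw [setIntegral_unitDisk_eq hcont, intRow_eq_integral]
  have h1 : ∫ r in (0 : ℝ)..1, ∫ θ in -π..π, r * reVal a (r * cos θ, r * sin θ) =
      ∫ r in (0 : ℝ)..1, π * (row 0 (r ^ 2) a * (2 * r)) := by
    refine intervalIntegral.integral_congr fun r hr => ?_
    rw [uIcc_of_le zero_le_one] at hr
    simp only [intervalIntegral.integral_const_mul, integral_reVal_polar a hr]
    ring
  have h2 : ∫ r in (0 : ℝ)..1, row 0 (r ^ 2) a * (2 * r) = ∫ s in (0 : ℝ)..1, row 0 s a := by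
    have := intervalIntegral.integral_comp_mul_deriv'' (a := 0) (b := 1) (f := fun r : ℝ => r ^ 2)
      (f' := fun r => 2 * r) (g := fun s => row 0 s a) (by fun_prop)
      (fun x _ => by simpa using (hasDerivAt_pow 2 x).hasDerivWithinAt) (by fun_prop) ?_
    · simpa using this
    · rintro _ ⟨x, hx, rfl⟩
      rw [uIcc_of_le zero_le_one] at hx
      have hs : |x ^ 2| < 4 := by rw [abs_of_nonneg (by positivity)]; nlinarith [hx.1, hx.2]
      exact (hasDerivAt_row 0 hs a).continuousAt.continuousWithinAt
  rw [h1, intervalIntegral.integral_const_mul, h2]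

end Coef

end RealValue

section SolutionData

open Real Set Filter Topology

namespace Coef

theorem green_parity_split {w e o : Coef} (hw : flip w = w) (he : flip e = e) (ho : flip o = -o)
    (h : e + o = green (w * (e + o) ^ 3)) :
    e = green (w * (e ^ 3 + 3 * e * o ^ 2)) ∧ o = green (w * (3 * e ^ 2 * o + o ^ 3)) := by
  have h2 : e - o = green (w * (e - o) ^ 3) := by
    have := congrArg flip h
    rwa [flip_green, flip_mul, hw, pow_succ, pow_two, flip_mul, flip_mul, map_add, he, ho,
      ← sub_eq_add_neg, ← pow_two, ← pow_succ] at this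
  have hs : ∀ a b : Coef, a + a = b + b → a = b := fun a b hab => by
    rw [← two_smul ℝ, ← two_smul ℝ] at hab
    exact smul_right_injective _ (two_ne_zero' ℝ) hab
  constructor
  · apply hs
    rw [← map_add, show w * (e ^ 3 + 3 * e * o ^ 2) + w * (e ^ 3 + 3 * e * o ^ 2) =
      w * (e + o) ^ 3 + w * (e - o) ^ 3 by ring, map_add, ← h, ← h2]
    ring
  · apply hs
    rw [← map_add, show w * (3 * e ^ 2 * o + o ^ 3) + w * (3 * e ^ 2 * o + o ^ 3) =
      w * (e + o) ^ 3 - w * (e - o) ^ 3 by ring, map_sub, ← h, ← h2]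
    ring

theorem exists_pos_forall_le_baseW {δ : ℝ} (hδ : |δ| ≤ 1) :
    ∃ m > 0, ∀ s ∈ Icc (0 : ℝ) 1, m ≤ row 0 s (baseW δ) := by
  have hc : ContinuousOn (fun s => row 0 s (baseW δ)) (Icc 0 1) :=
    fun s hs => (hasDerivAt_row 0 (abs_lt_four hs) _).continuousAt.continuousWithinAt
  obtain ⟨x, hx, hmin⟩ := isCompact_Icc.exists_isMinOn (nonempty_Icc.2 zero_le_one) hc
  exact ⟨_, baseW_pos hδ hx, fun s hs => hmin hs⟩

/-- The even part `e` and the odd part `o` of the coefficients of a solution, with the polynomial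
weight `P` and the parameter `δ` of a nearby reference potential. -/
structure SolutionData (P : Polynomial ℝ) (e o : Coef) (δ : ℝ) : Prop where
  eval_pos : ∀ s ∈ Icc (0 : ℝ) 1, 0 < P.eval s
  swap_e : swap e = e
  flip_e : flip e = e
  swap_o : swap o = o
  flip_o : flip o = -o
  eq_green : e + o = green (ofPoly P * (e + o) ^ 3)
  abs_le : |δ| ≤ 1
  norm_le : ‖(3 : ℝ) • (ofPoly P * (e + o) ^ 2) - (3 : ℝ) • potElt δ‖ ≤ 1 / 2000
  quartic : 9 * intRow (ofPoly P * e ^ 2 * o ^ 2) ^ 2 <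
    intRow (ofPoly P * e ^ 4) * intRow (ofPoly P * o ^ 4)
  row_o : row 1 0 o ≠ 0
  row_e : row 0 0 e ≠ 0

theorem exists_solutionData : ∃ P e o δ, SolutionData P e o δ := by
  obtain ⟨δ, hδ, h1, hpos⟩ := exists_critical
  obtain ⟨m, hm, hmle⟩ := exists_pos_forall_le_baseW hδ
  set z : Coef × Coef × Coef × ℝ := (baseW δ, baseU δ, phi δ, (0 : ℝ)) with hz
  have c1 : ∀ᶠ y : Coef × Coef × Coef × ℝ in 𝓝 z, ‖y.1 - baseW δ‖ < m :=
    ContinuousAt.eventually_lt (by fun_prop) continuousAt_const (by simpa [hz] using hm)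
  have c2 : ∀ᶠ y : Coef × Coef × Coef × ℝ in 𝓝 z,
      ‖(3 : ℝ) • (y.1 * (y.2.1 + y.2.2.2 • y.2.2.1) ^ 2) - (3 : ℝ) • potElt δ‖ < 1 / 2000 :=
    ContinuousAt.eventually_lt (by fun_prop) continuousAt_const
      (by simp [hz, baseW_mul_baseU_sq])
  have c3 : ∀ᶠ y : Coef × Coef × Coef × ℝ in 𝓝 z,
      9 * intRow (y.1 * y.2.1 ^ 2 * y.2.2.1 ^ 2) ^ 2 <
        intRow (y.1 * y.2.1 ^ 4) * intRow (y.1 * y.2.2.1 ^ 4) :=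
    ContinuousAt.eventually_lt (by fun_prop) (by fun_prop) (quartic_inequality hδ h1 hpos)
  have c4 : ∀ᶠ y : Coef × Coef × Coef × ℝ in 𝓝 z, row 1 0 y.2.2.1 ≠ 0 :=
    ContinuousAt.eventually_ne (by fun_prop) (by simp [hz, row_phi, row_zero_phiRad])
  have c5 : ∀ᶠ y : Coef × Coef × Coef × ℝ in 𝓝 z, row 0 0 y.2.1 ≠ 0 :=
    ContinuousAt.eventually_ne (by fun_prop) (baseU_pos (by simp)).ne'
  obtain ⟨P, e, o, ε, ⟨b1, b2, b3, b4, b5⟩, hε, se, fe, so, fo, heq⟩ :=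
    exists_branch hδ h1 hpos (c1.and (c2.and (c3.and (c4.and c5))))
  refine ⟨P, e, ε • o, δ, fun s hs => ?_, se, fe, by rw [map_smul, so], by rw [map_smul, fo, smul_neg],
    heq, hδ, b2.le, ?_, by simpa [hε] using b4, b5⟩
  · have hs4 : √s ^ 2 = s := sq_sqrt hs.1
    have hq : ((√s, 0) : ℝ × ℝ).1 ^ 2 + ((√s, 0) : ℝ × ℝ).2 ^ 2 ≤ 4 := by
      simp only [hs4]; nlinarith [hs.2]
    have hle := abs_reVal_le (ofPoly P - baseW δ) (√s, 0)
    rw [((isRad_ofPoly P).sub (isRad_baseW δ)).reVal hq] at hle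
    simp only [hs4, map_sub, ne_eq, OfNat.ofNat_ne_zero, not_false_eq_true, zero_pow, add_zero,
      row_ofPoly (abs_le_four hs)] at hle
    have := hmle s hs
    have := abs_lt.1 (hle.trans_lt b1)
    linarith
  · have e1 : ofPoly P * e ^ 2 * (ε • o) ^ 2 = ε ^ 2 • (ofPoly P * e ^ 2 * o ^ 2) := by
      rw [smul_pow, mul_smul_comm]
    have e2 : ofPoly P * (ε • o) ^ 4 = ε ^ 4 • (ofPoly P * o ^ 4) := by
      rw [smul_pow, mul_smul_comm]
    rw [e1, e2, map_smul, map_smul, smul_eq_mul, smul_eq_mul]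
    have : 0 < ε ^ 4 := by positivity
    have := mul_lt_mul_of_pos_left b3 this
    linarith

/-! ### First order behaviour at the origin -/

theorem monoFun_zero (i : ℕ × ℕ) : monoFun i 0 = if i = 0 then 1 else 0 := by
  rcases i with ⟨a, b⟩
  rcases a with _ | a <;> rcases b with _ | b <;> simp [monoFun, Prod.ext_iff]

theorem val_zero (a : Coef) : val 0 a = row 0 0 a := by
  have : val 0 = Complex.ofRealCLM.comp (row 0 0) := ext_mono fun i => by
    rw [val_mono (by norm_num), monoFun_zero, ContinuousLinearMap.comp_apply, row_mono (by norm_num)]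
    rcases i with ⟨a, b⟩
    rcases a with _ | a <;> rcases b with _ | b <;> simp [Prod.ext_iff]
  rw [this]; rfl

theorem fderiv_val_zero (a : Coef) (v : ℝ × ℝ) :
    fderiv ℝ val 0 v a = row 1 0 a * toC v + row 1 0 (swap a) * toCbar v := by
  have : fderiv ℝ val 0 v = (toC v) • Complex.ofRealCLM.comp (row 1 0) +
      (toCbar v) • Complex.ofRealCLM.comp ((row 1 0).comp swap) := ext_mono fun i => by
    rw [← fderiv_val_apply (by norm_num),
      (val_mono_eventuallyEq (p := 0) (by norm_num) i).fderiv_eq, fderiv_monoFun_apply,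
      monoFun_zero, monoFun_zero]
    simp only [add_apply, smul_apply, ContinuousLinearMap.comp_apply, swap_mono,
      row_mono (show |(0 : ℝ)| ≤ 4 by norm_num)]
    rcases i with ⟨a, b⟩
    rcases a with _ | _ | a <;> rcases b with _ | _ | b <;> simp [Prod.ext_iff] <;> ring_nf
  rw [this]
  simp [mul_comm]

theorem reVal_zero (a : Coef) : reVal a 0 = row 0 0 a := by
  rw [reVal, val_zero, Complex.ofReal_re]

theorem fderiv_reVal_zero {a : Coef} (ha : swap a = a) (v : ℝ × ℝ) :
    fderiv ℝ (reVal a) 0 v = 2 * row 1 0 a * v.1 := by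
  have h0 : (0 : ℝ × ℝ).1 ^ 2 + (0 : ℝ × ℝ).2 ^ 2 < 4 := by norm_num
  have h := (Complex.reCLM.hasFDerivAt.comp (0 : ℝ × ℝ)
    (analyticAt_val_apply h0 a).differentiableAt.hasFDerivAt).fderiv
  have e : reVal a = (Complex.reCLM : ℂ → ℝ) ∘ fun q => val q a := rfl
  rw [e, h, ContinuousLinearMap.comp_apply, fderiv_val_apply h0, fderiv_val_zero, ha, ← mul_add,
    toC_apply, toCbar_apply]
  simp
  ring

theorem row_flip (m : ℕ) {s : ℝ} (hs : |s| ≤ 4) (a : Coef) :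
    row m s (flip a) = (-1) ^ m * row m s a := by
  have : (row m s).comp flip = ((-1 : ℝ) ^ m) • row m s := ext_mono fun i => by
    simp only [ContinuousLinearMap.comp_apply, flip_mono, map_smul, smul_apply, row_mono hs]
    split_ifs with h
    · rw [h, show i.2 + m + i.2 = 2 * i.2 + m by ring, pow_add, pow_mul]; simp
    · simp
  exact congrArg (fun f => f a) this

end Coef

end SolutionData

section MinimalSymmetry

open Real Set Filter Topology

theorem rot_zero (α : ℝ) : rot α 0 = 0 := by simp [rot]

theorem continuous_rot (α : ℝ) : Continuous (rot α) := by
  unfold rot; fun_prop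

/-- A function that does not vanish at the origin, whose derivative there is a nonzero multiple of
the first coordinate, has an absolute value without rotational symmetries. -/
theorem exists_abs_rot_ne {u : ℝ × ℝ → ℝ} {b : ℝ} (hu : DifferentiableAt ℝ u 0) (h0 : u 0 ≠ 0)
    (hb : b ≠ 0) (hd : ∀ v, fderiv ℝ u 0 v = b * v.1) {α : ℝ}
    (hα : Complex.exp (α * Complex.I) ≠ 1) : ∃ q ∈ unitDisk, |u (rot α q)| ≠ |u q| := by
  by_contra! h
  have hc : ContinuousAt (fun q => u (rot α q) * u q) 0 := by
    have h1 : ContinuousAt u (rot α 0) := by rw [rot_zero]; exact hu.continuousAt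
    exact (ContinuousAt.comp (g := u) h1 (continuous_rot α).continuousAt).mul hu.continuousAt
  have hpos : ∀ᶠ q in 𝓝 (0 : ℝ × ℝ), 0 < u (rot α q) * u q := by
    refine ContinuousAt.eventually_lt continuousAt_const hc ?_
    rw [rot_zero]
    exact mul_self_pos.2 h0
  have hmem : ∀ᶠ q in 𝓝 (0 : ℝ × ℝ), q ∈ unitDisk :=
    isOpen_unitDisk.mem_nhds (by simp [unitDisk])
  have heq : (fun q => u (rot α q)) =ᶠ[𝓝 0] u := by
    filter_upwards [hpos, hmem] with q h1 h2
    rcases abs_eq_abs.1 (h q h2) with h3 | h3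
    · exact h3
    · rw [h3] at h1
      nlinarith [mul_self_nonneg (u q)]
  have hline : HasDerivAt (fun t : ℝ => ((t, 0) : ℝ × ℝ)) (1, 0) 0 :=
    (hasDerivAt_id _).prodMk (hasDerivAt_const _ _)
  have hrot : HasDerivAt (fun t : ℝ => rot α (t, 0)) (cos α, sin α) 0 := by
    have : (fun t : ℝ => rot α (t, 0)) = fun t => (t * cos α, t * sin α) := by
      funext t; simp [rot]
    rw [this]
    simpa using ((hasDerivAt_id (0 : ℝ)).mul_const (cos α)).prodMk
      ((hasDerivAt_id (0 : ℝ)).mul_const (sin α))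
  have d1 : HasDerivAt (fun t : ℝ => u (t, 0)) b 0 := by
    have := HasFDerivAt.comp_hasDerivAt (l := u) (0 : ℝ) (f := fun t : ℝ => ((t, 0) : ℝ × ℝ))
      hu.hasFDerivAt hline
    rw [hd] at this
    simpa [Function.comp_def] using this
  have d2 : HasDerivAt (fun t : ℝ => u (rot α (t, 0))) (b * cos α) 0 := by
    have h2 : HasFDerivAt u (fderiv ℝ u 0) (rot α ((0 : ℝ), 0)) := by
      rw [show rot α ((0 : ℝ), 0) = 0 from rot_zero α]; exact hu.hasFDerivAt
    have := HasFDerivAt.comp_hasDerivAt (l := u) (0 : ℝ) (f := fun t : ℝ => rot α (t, 0)) h2 hrot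
    rw [hd] at this
    simpa [Function.comp_def] using this
  have hev : (fun t : ℝ => u (rot α (t, 0))) =ᶠ[𝓝 0] fun t => u (t, 0) :=
    (show Tendsto (fun t : ℝ => ((t, 0) : ℝ × ℝ)) (𝓝 0) (𝓝 0) from
      hline.continuousAt.tendsto).eventually heq
  have hcos : cos α = 1 := by
    have := (d1.congr_of_eventuallyEq hev).unique d2
    exact mul_left_cancel₀ hb (by linarith)
  have hsin : sin α = 0 := by
    have := sin_sq_add_cos_sq α
    rw [hcos] at this
    exact pow_eq_zero_iff two_ne_zero |>.1 (by linarith)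
  apply hα
  rw [Complex.exp_mul_I, ← Complex.ofReal_cos, ← Complex.ofReal_sin, hcos, hsin]
  simp

/-- The square of the angular derivative of a function with a nonzero first partial derivative at
the origin has a positive integral. -/
theorem setIntegral_angular_sq_pos {u f : ℝ × ℝ → ℝ} {b : ℝ} (hu : ContDiffAt ℝ 1 u 0)
    (hb : b ≠ 0) (hd : ∀ v, fderiv ℝ u 0 v = b * v.1)
    (hf : ContinuousOn f {q | q.1 ^ 2 + q.2 ^ 2 ≤ 1})
    (hfu : ∀ q ∈ unitDisk, f q = fderiv ℝ u q (-q.2, q.1)) :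
    0 < ∫ q in unitDisk, f q ^ 2 := by
  have hex : ∃ q ∈ unitDisk, f q ≠ 0 := by
    by_contra! h
    have hc : ContinuousAt (fun t : ℝ => fderiv ℝ u (0, t) (1, 0)) 0 := by
      have h1 : ContinuousAt (fderiv ℝ u) (0, (0 : ℝ)) :=
        (hu.fderiv_right (m := 0) (by norm_num)).continuousAt
      exact (ContinuousAt.comp (g := fderiv ℝ u) (f := fun t : ℝ => ((0, t) : ℝ × ℝ)) h1
        (by fun_prop)).clm_apply continuousAt_const
    have hz : ∀ᶠ t : ℝ in 𝓝[≠] 0, fderiv ℝ u (0, t) (1, 0) = 0 := by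
      have hev : ∀ᶠ t : ℝ in 𝓝[≠] 0, t ∈ Ioo (-1 : ℝ) 1 :=
        mem_nhdsWithin_of_mem_nhds (Ioo_mem_nhds (by norm_num) (by norm_num))
      filter_upwards [hev, self_mem_nhdsWithin] with t ht h0
      have hm : ((0, t) : ℝ × ℝ) ∈ unitDisk := by
        simp only [unitDisk, Set.mem_ofPred_eq]; nlinarith [ht.1, ht.2]
      have h2 := hfu _ hm
      rw [h _ hm, show ((-t, 0) : ℝ × ℝ) = (-t) • ((1, 0) : ℝ × ℝ) by simp, map_smul,
        smul_eq_mul] at h2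
      exact (mul_eq_zero.1 h2.symm).resolve_left (neg_ne_zero.2 h0)
    have h3 : Tendsto (fun t : ℝ => fderiv ℝ u (0, t) (1, 0)) (𝓝[≠] 0) (𝓝 0) :=
      tendsto_const_nhds.congr' (hz.mono fun t ht => ht.symm)
    have h4 := tendsto_nhds_unique h3 (hc.tendsto.mono_left nhdsWithin_le_nhds)
    have h5 := hd (1, 0)
    rw [show ((0, 0) : ℝ × ℝ) = 0 from rfl, h5] at h4
    simp at h4
    exact hb h4.symm
  obtain ⟨q, hq, hq0⟩ := hex
  rw [setIntegral_pos_iff_support_of_nonneg_ae (Eventually.of_forall fun _ => sq_nonneg _)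
    (ContinuousOn.integrableOn_unitDisk (hf.pow 2))]
  have ht : IsOpen (unitDisk ∩ f ⁻¹' {y | y ≠ 0}) :=
    (hf.mono unitDisk_subset_closedDisk).isOpen_inter_preimage isOpen_unitDisk isOpen_ne
  refine (ht.measure_pos volume ⟨q, hq, hq0⟩).trans_le (measure_mono fun p hp => ⟨?_, hp.1⟩)
  exact pow_ne_zero 2 hp.2

end MinimalSymmetry

section Solution

open Real Set Filter Topology IntPoly

namespace Coef.SolutionData

variable {P : Polynomial ℝ} {e o : Coef} {δ : ℝ}

theorem swap_add (h : SolutionData P e o δ) : swap (e + o) = e + o := by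
  rw [map_add, h.swap_e, h.swap_o]

theorem lapF_reVal_eq (h : SolutionData P e o δ) {q : ℝ × ℝ} (hq : q.1 ^ 2 + q.2 ^ 2 < 4) :
    lapF (reVal (e + o)) q = -(P.eval (q.1 ^ 2 + q.2 ^ 2) * reVal (e + o) q ^ 3) := by
  have hl := lapF_reVal_green (ofPoly P * (e + o) ^ 3) hq
  rw [← h.eq_green, reVal_mul hq.le (isRad_ofPoly P).swap (swap_pow h.swap_add 3),
    reVal_pow hq.le h.swap_add, reVal_ofPoly hq.le] at hl
  exact hl

theorem continuousOn_eval (P : Polynomial ℝ) (s : Set (ℝ × ℝ)) :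
    ContinuousOn (fun q : ℝ × ℝ => P.eval (q.1 ^ 2 + q.2 ^ 2)) s :=
  (P.continuous.comp (by fun_prop : Continuous fun q : ℝ × ℝ => q.1 ^ 2 + q.2 ^ 2)).continuousOn

theorem setIntegral_eval_mul (P : Polynomial ℝ) {a : Coef} (ha : swap a = a) :
    ∫ q in unitDisk, P.eval (q.1 ^ 2 + q.2 ^ 2) * reVal a q = π * intRow (ofPoly P * a) := by
  rw [← setIntegral_reVal]
  refine setIntegral_congr_fun isOpen_unitDisk.measurableSet fun q hq => ?_
  have hq4 : q.1 ^ 2 + q.2 ^ 2 ≤ 4 := by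
    have : q.1 ^ 2 + q.2 ^ 2 < 1 := hq
    linarith
  simp only [reVal_mul hq4 (isRad_ofPoly P).swap ha, reVal_ofPoly hq4]

theorem exists_rank_eq_two (h : SolutionData P e o δ) :
    ∃ V : Submodule ℝ (ℝ × ℝ → ℝ), NegDefSubspace (fun q => P.eval (q.1 ^ 2 + q.2 ^ 2))
      (reVal (e + o)) V ∧ Module.rank ℝ V = 2 := by
  have hlt : ∀ {q : ℝ × ℝ}, q.1 ^ 2 + q.2 ^ 2 ≤ 1 → q.1 ^ 2 + q.2 ^ 2 < 4 := fun h => by linarith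
  obtain ⟨ge, go⟩ := green_parity_split (isRad_ofPoly P).flip h.flip_e h.flip_o h.eq_green
  have hsq : ∀ {a : Coef}, swap a = a → ∀ n, swap (a ^ n) = a ^ n := fun ha n => swap_pow ha n
  have hth : (3 : Coef) = (3 : ℝ) • 1 := by
    rw [← Algebra.algebraMap_eq_smul_one, map_ofNat]
  have i1 : ∫ q in unitDisk, P.eval (q.1 ^ 2 + q.2 ^ 2) * reVal e q ^ 4 =
      π * intRow (ofPoly P * e ^ 4) := by
    rw [← setIntegral_eval_mul P (hsq h.swap_e 4)]
    refine setIntegral_congr_fun isOpen_unitDisk.measurableSet fun q hq => ?_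
    simp only [reVal_pow (hlt (unitDisk_subset_closedDisk hq)).le h.swap_e]
  have i2 : ∫ q in unitDisk, P.eval (q.1 ^ 2 + q.2 ^ 2) * reVal o q ^ 4 =
      π * intRow (ofPoly P * o ^ 4) := by
    rw [← setIntegral_eval_mul P (hsq h.swap_o 4)]
    refine setIntegral_congr_fun isOpen_unitDisk.measurableSet fun q hq => ?_
    simp only [reVal_pow (hlt (unitDisk_subset_closedDisk hq)).le h.swap_o]
  have i3 : ∫ q in unitDisk, P.eval (q.1 ^ 2 + q.2 ^ 2) * reVal e q ^ 2 * reVal o q ^ 2 =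
      π * intRow (ofPoly P * e ^ 2 * o ^ 2) := by
    rw [mul_assoc (ofPoly P), ← setIntegral_eval_mul P (a := e ^ 2 * o ^ 2)
      (by rw [swap_mul, hsq h.swap_e, hsq h.swap_o])]
    refine setIntegral_congr_fun isOpen_unitDisk.measurableSet fun q hq => ?_
    have hq4 := (hlt (unitDisk_subset_closedDisk hq)).le
    simp only [reVal_mul hq4 (hsq h.swap_e 2) (hsq h.swap_o 2), reVal_pow hq4 h.swap_e,
      reVal_pow hq4 h.swap_o, mul_assoc]
  have hnn : ∀ a : Coef, 0 ≤ ∫ q in unitDisk, P.eval (q.1 ^ 2 + q.2 ^ 2) * reVal a q ^ 4 :=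
    fun a => setIntegral_nonneg isOpen_unitDisk.measurableSet fun q hq =>
      mul_nonneg (h.eval_pos _ ⟨by positivity, unitDisk_subset_closedDisk hq⟩).le (by positivity)
  have hq' : 9 * (π * intRow (ofPoly P * e ^ 2 * o ^ 2)) ^ 2 <
      π * intRow (ofPoly P * e ^ 4) * (π * intRow (ofPoly P * o ^ 4)) := by
    have := mul_lt_mul_of_pos_left h.quartic (show 0 < π ^ 2 by positivity)
    linarith
  have key := exists_negDefSubspace_rank_two (w := fun q => P.eval (q.1 ^ 2 + q.2 ^ 2))
    (e := reVal e) (o := reVal o) (continuousOn_eval P _)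
    (fun q hq => analyticAt_reVal e (hlt hq)) (fun q hq => analyticAt_reVal o (hlt hq))
    (fun q hq => by rw [ge]; exact reVal_green_of_eq_one _ hq)
    (fun q hq => by rw [go]; exact reVal_green_of_eq_one _ hq)
    (fun q hq => by
      have hq4 := hlt (unitDisk_subset_closedDisk hq)
      have hl := lapF_reVal_green (ofPoly P * (e ^ 3 + 3 * e * o ^ 2)) hq4
      rw [← ge, hth, smul_mul_assoc, one_mul, smul_mul_assoc, reVal_mul hq4.le
        (isRad_ofPoly P).swap (by rw [map_add, map_smul, swap_mul, hsq h.swap_e, hsq h.swap_o,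
          h.swap_e]), reVal_add, reVal_smul, reVal_mul hq4.le h.swap_e (hsq h.swap_o 2),
        reVal_pow hq4.le h.swap_e, reVal_pow hq4.le h.swap_o, reVal_ofPoly hq4.le] at hl
      rw [hl]; ring)
    (fun q hq => by
      have hq4 := hlt (unitDisk_subset_closedDisk hq)
      have hl := lapF_reVal_green (ofPoly P * (3 * e ^ 2 * o + o ^ 3)) hq4
      rw [← go, hth, smul_mul_assoc, one_mul, smul_mul_assoc, reVal_mul hq4.le
        (isRad_ofPoly P).swap (by rw [map_add, map_smul, swap_mul, hsq h.swap_e, hsq h.swap_o,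
          h.swap_o]), reVal_add, reVal_smul, reVal_mul hq4.le (hsq h.swap_e 2) h.swap_o,
        reVal_pow hq4.le h.swap_e, reVal_pow hq4.le h.swap_o, reVal_ofPoly hq4.le] at hl
      rw [hl]; ring)
    (fun q => by simp) (fun q => by rw [reVal_neg, h.flip_e])
    (fun q => by rw [reVal_neg, h.flip_o, ← neg_one_smul ℝ, reVal_smul]; ring)
    (by
      refine (hnn e).lt_of_ne' fun h0 => ?_
      rw [i1] at h0
      rw [h0, zero_mul] at hq'
      exact absurd hq' (not_lt.2 (by positivity)))
    (by simp only [i1, i2, i3]; exact hq')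
  have hfun : (fun q => reVal e q + reVal o q) = reVal (e + o) :=
    funext fun q => (reVal_add e o q).symm
  rwa [hfun] at key

theorem row_one_add (h : SolutionData P e o δ) : row 1 0 (e + o) = row 1 0 o := by
  have := row_flip 1 (s := 0) (by norm_num) e
  rw [h.flip_e] at this
  rw [map_add]
  linarith

theorem row_zero_add (h : SolutionData P e o δ) : row 0 0 (e + o) = row 0 0 e := by
  have := row_flip 0 (s := 0) (by norm_num) o
  rw [h.flip_o, map_neg] at this
  rw [map_add]
  linarith

theorem fderiv_zero (h : SolutionData P e o δ) (v : ℝ × ℝ) :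
    fderiv ℝ (reVal (e + o)) 0 v = 2 * row 1 0 o * v.1 := by
  rw [fderiv_reVal_zero h.swap_add, h.row_one_add]

theorem rank_le_two (h : SolutionData P e o δ) {V : Submodule ℝ (ℝ × ℝ → ℝ)}
    (hV : NegDefSubspace (fun q => P.eval (q.1 ^ 2 + q.2 ^ 2)) (reVal (e + o)) V) :
    Module.rank ℝ V ≤ 2 := by
  have hlt : ∀ {q : ℝ × ℝ}, q.1 ^ 2 + q.2 ^ 2 ≤ 1 → q.1 ^ 2 + q.2 ^ 2 < 4 := fun h => by linarith
  have hu : ContinuousOn (reVal (e + o)) {q | q.1 ^ 2 + q.2 ^ 2 ≤ 1} := fun q hq =>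
    (analyticAt_reVal _ (hlt hq)).continuousAt.continuousWithinAt
  have hf : ContinuousOn (reDth (e + o)) {q | q.1 ^ 2 + q.2 ^ 2 ≤ 1} := fun q hq =>
    (analyticAt_reDth _ (hlt hq)).continuousAt.continuousWithinAt
  refine rank_le_two_of_negDefSubspace (f := reDth (e + o)) (δ := δ) (continuousOn_eval P _) hu
    h.abs_le (fun q hq => ?_) (fun q hq => analyticAt_reDth _ (hlt hq))
    (fun q hq => by rw [h.eq_green]; exact reDth_green_of_eq_one _ hq) (fun q hq => ?_)
    (setIntegral_angular_sq_pos (analyticAt_reVal (e + o) (by norm_num)).contDiffAt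
      (mul_ne_zero two_ne_zero h.row_o) h.fderiv_zero hf
      fun q hq => reDth_apply _ (hlt (unitDisk_subset_closedDisk hq))) hV
  · have hq1 := unitDisk_subset_closedDisk hq
    have hq4 := (hlt hq1).le
    have hle := (abs_reVal_le _ q).trans h.norm_le
    rw [sub_eq_add_neg, ← neg_smul, reVal_add, reVal_smul, reVal_smul,
      reVal_mul hq4 (isRad_ofPoly P).swap (swap_pow h.swap_add 2), reVal_pow hq4 h.swap_add,
      reVal_ofPoly hq4, (isRad_potElt δ).reVal hq4,
      row_potElt (abs_le_four ⟨by positivity, hq1⟩)] at hle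
    rw [show ∀ a b c : ℝ, 3 * a * b - 3 * c = 3 * (a * b) + -3 * c from fun a b c => by ring]
    exact hle
  · have hq4 := hlt (unitDisk_subset_closedDisk hq)
    have hl := lapF_reDth_green (ofPoly P * (e + o) ^ 3) hq4
    rw [← h.eq_green, reDth_radial_mul_cube (isRad_ofPoly P) h.swap_add hq4,
      reVal_ofPoly hq4.le] at hl
    exact hl

end Coef.SolutionData

theorem closure_unitDisk_subset : closure unitDisk ⊆ {q | q.1 ^ 2 + q.2 ^ 2 ≤ 1} :=
  closure_minimal unitDisk_subset_closedDisk isCompact_closedDisk.isClosed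

end Solution

/-- There exists a positive radial polynomial weight `w` on the disk such that
`−Δu = w u³`, `u|_{∂Ω} = 0` has a real analytic solution of Morse index `2`
whose absolute value is not invariant under any nontrivial rotation. -/
theorem exists_weight_and_index_two_minimally_symmetric_solution :
    ∃ (P : Polynomial ℝ) (u : ℝ × ℝ → ℝ),
      (∀ q ∈ closure unitDisk, 0 < P.eval (q.1 ^ 2 + q.2 ^ 2)) ∧
      (∃ U : Set (ℝ × ℝ), IsOpen U ∧ closure unitDisk ⊆ U ∧ AnalyticOnNhd ℝ u U) ∧
      (∀ q ∈ unitDisk, -lap u q = P.eval (q.1 ^ 2 + q.2 ^ 2) * (u q) ^ 3) ∧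
      (∀ q : ℝ × ℝ, q.1 ^ 2 + q.2 ^ 2 = 1 → u q = 0) ∧
      MorseIndexEq (fun q => P.eval (q.1 ^ 2 + q.2 ^ 2)) u 2 ∧
      (∀ α : ℝ, Complex.exp (α * Complex.I) ≠ 1 →
        ∃ q ∈ unitDisk, |u (rot α q)| ≠ |u q|) := by
  obtain ⟨P, e, o, δ, h⟩ := Coef.exists_solutionData
  have h0 : (0 : ℝ × ℝ).1 ^ 2 + (0 : ℝ × ℝ).2 ^ 2 < 4 := by norm_num
  refine ⟨P, Coef.reVal (e + o), fun q hq => h.eval_pos _ ⟨by positivity,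
    closure_unitDisk_subset hq⟩, ⟨{q | q.1 ^ 2 + q.2 ^ 2 < 4}, ?_, fun q hq => ?_,
    fun q hq => Coef.analyticAt_reVal _ hq⟩, fun q hq => ?_, fun q hq => ?_, ⟨?_, fun V hV => ?_⟩,
    fun α hα => ?_⟩
  · exact isOpen_lt (by fun_prop) continuous_const
  · have hq1 : q.1 ^ 2 + q.2 ^ 2 ≤ 1 := closure_unitDisk_subset hq
    exact lt_of_le_of_lt hq1 (by norm_num)
  · have hq4 : q.1 ^ 2 + q.2 ^ 2 < 4 := lt_trans (show q.1 ^ 2 + q.2 ^ 2 < 1 from hq) (by norm_num)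
    rw [lap_eq_lapF (Coef.analyticAt_reVal _ hq4), h.lapF_reVal_eq hq4, neg_neg]
  · rw [h.eq_green]
    exact Coef.reVal_green_of_eq_one _ hq
  · exact_mod_cast h.exists_rank_eq_two
  · exact_mod_cast h.rank_le_two hV
  · exact exists_abs_rot_ne (Coef.analyticAt_reVal _ h0).differentiableAt
      (by rw [Coef.reVal_zero, h.row_zero_add]; exact h.row_e)
      (mul_ne_zero two_ne_zero h.row_o) h.fderiv_zero hα
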